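/- For every natural number k ≥ 1, the product 𝔈^k is homeomorphic to the k-th symmetric product F_k(𝔈), and the product 𝔈_c^k is homeomorphic to the k-th symmetric product F_k(𝔈_c) (each symmetric product carrying the Vietoris topology). -/

import Mathlib

open Set Topology

noncomputable section

/-- The Vietoris topology on the powerset of `X` induced by a topology `τ`,
generated by the sets `{F | F ⊆ U}` and `{F | F ∩ U ≠ ∅}` for `U` a nonempty `τ`-open set. -/
def VietorisTop {X : Type*} (τ : TopologicalSpace X) : TopologicalSpace (Set X) :=
  TopologicalSpace.generateFrom
    ({S : Set (Set X) | ∃ U : Set X, IsOpen[τ] U ∧ U.Nonempty ∧ S = {F : Set X | F ⊆ U}} ∪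
     {S : Set (Set X) | ∃ U : Set X, IsOpen[τ] U ∧ U.Nonempty ∧ S = {F : Set X | (F ∩ U).Nonempty}})

/-- The hyperspace `K(X)` of nonempty compact subsets of `X`. -/
def HypK (X : Type*) [TopologicalSpace X] : Type _ := {F : Set X // F.Nonempty ∧ IsCompact F}

/-- `K(X)` carries the Vietoris topology. -/
instance (X : Type*) [τ : TopologicalSpace X] : TopologicalSpace (HypK X) :=
  (VietorisTop τ).induced Subtype.val

/-- The `n`-th symmetric product `F_n(X)`: nonempty subsets of `X` with at most `n` points. -/
def HypFn (n : ℕ) (X : Type*) [TopologicalSpace X] : Type _ :=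
  {F : Set X // F.Nonempty ∧ F.Finite ∧ F.ncard ≤ n}

/-- `F_n(X)` carries the Vietoris topology. -/
instance (n : ℕ) (X : Type*) [τ : TopologicalSpace X] : TopologicalSpace (HypFn n X) :=
  (VietorisTop τ).induced Subtype.val

/-- The hyperspace `F(X)` of nonempty finite subsets of `X`. -/
def HypFin (X : Type*) [TopologicalSpace X] : Type _ := {F : Set X // F.Nonempty ∧ F.Finite}

/-- `F(X)` carries the Vietoris topology. -/
instance (X : Type*) [τ : TopologicalSpace X] : TopologicalSpace (HypFin X) :=
  (VietorisTop τ).induced Subtype.val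

/-- A space is almost zero-dimensional if every point has a neighborhood basis consisting of
sets each of which is an intersection of clopen sets. -/
def IsAZD (X : Type*) [TopologicalSpace X] : Prop :=
  ∀ x : X, ∀ U ∈ nhds x, ∃ V ∈ nhds x, V ⊆ U ∧
    ∃ C : Set (Set X), (∀ c ∈ C, IsClopen c) ∧ V = ⋂₀ C

/-- `X` is `𝒜`-cohesive: every point has a neighborhood containing no nonempty proper
subset of an element `A ∈ 𝒜` that is clopen in the subspace topology of `A`. -/
def CohesiveWrt (X : Type*) [TopologicalSpace X] (𝒜 : Set (Set X)) : Prop :=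
  ∀ x : X, ∃ U ∈ nhds x, ∀ A ∈ 𝒜, ∀ C : Set X,
    C ⊆ U → C ⊆ A → C.Nonempty → C ≠ A → ¬ IsClopen {y : A | (y : X) ∈ C}

/-- A space is cohesive if it is `{X}`-cohesive. -/
def Cohesive (X : Type*) [TopologicalSpace X] : Prop := CohesiveWrt X {Set.univ}

/-- Erdős space: the rational points of the Hilbert space `ℓ²`. -/
def ErdosSpace : Type :=
  {x : lp (fun _ : ℕ => ℝ) 2 // ∀ n : ℕ, ∃ q : ℚ, x.val n = (q : ℝ)}

instance : TopologicalSpace ErdosSpace := by unfold ErdosSpace; infer_instance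

/-- Complete Erdős space: points of `ℓ²` all of whose coordinates lie in `{0} ∪ {1/m : m ≥ 1}`. -/
def CompleteErdosSpace : Type :=
  {x : lp (fun _ : ℕ => ℝ) 2 // ∀ n : ℕ, x.val n = 0 ∨ ∃ m : ℕ, 0 < m ∧ x.val n = 1 / (m : ℝ)}

instance : TopologicalSpace CompleteErdosSpace := by unfold CompleteErdosSpace; infer_instance

namespace ErdosModel

/-! ### Homeomorphisms that almost preserve a weight -/

/-- The weighted spaces `(A, φ)` and `(B, ψ)` have a homeomorphism along which the weights differ
by a continuous function bounded by `ε`. -/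
def NearHomeo {A B : Type*} [TopologicalSpace A] [TopologicalSpace B] (ε : ℝ)
    (φ : A → ℝ) (ψ : B → ℝ) : Prop :=
  ∃ h : A ≃ₜ B, (∀ a, |ψ (h a) - φ a| ≤ ε) ∧ Continuous fun a => ψ (h a) - φ a

section NearHomeo

variable {A B C D : Type*} [TopologicalSpace A] [TopologicalSpace B] [TopologicalSpace C]
  [TopologicalSpace D]

theorem NearHomeo.of_homeo {φ : A → ℝ} {ψ : B → ℝ} (h : A ≃ₜ B) (hψ : ∀ a, ψ (h a) = φ a) :
    NearHomeo 0 φ ψ := by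
  refine ⟨h, fun a => by simp [hψ], ?_⟩
  simp only [hψ, sub_self]
  exact continuous_const

theorem NearHomeo.refl (φ : A → ℝ) : NearHomeo 0 φ φ := .of_homeo (.refl A) fun _ => rfl

theorem NearHomeo.mono {ε δ : ℝ} {φ : A → ℝ} {ψ : B → ℝ} (h : NearHomeo ε φ ψ) (hε : ε ≤ δ) :
    NearHomeo δ φ ψ :=
  let ⟨e, he, hc⟩ := h
  ⟨e, fun a => (he a).trans hε, hc⟩

theorem NearHomeo.symm {ε : ℝ} {φ : A → ℝ} {ψ : B → ℝ} (h : NearHomeo ε φ ψ) :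
    NearHomeo ε ψ φ := by
  obtain ⟨e, he, hc⟩ := h
  refine ⟨e.symm, fun b => ?_, ?_⟩
  · have := he (e.symm b)
    rwa [e.apply_symm_apply, abs_sub_comm] at this
  · have := (hc.comp e.symm.continuous).neg
    refine this.congr fun b => ?_
    simp

theorem NearHomeo.trans {ε δ : ℝ} {φ : A → ℝ} {ψ : B → ℝ} {χ : C → ℝ} (h : NearHomeo ε φ ψ)
    (h' : NearHomeo δ ψ χ) : NearHomeo (ε + δ) φ χ := by
  obtain ⟨e, he, hc⟩ := h
  obtain ⟨e', he', hc'⟩ := h'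
  refine ⟨e.trans e', fun a => ?_, ?_⟩
  · have h1 := abs_le.1 (he a)
    have h2 := abs_le.1 (he' (e a))
    rw [abs_le, Homeomorph.trans_apply]
    constructor <;> linarith
  · refine (hc.add (hc'.comp e.continuous)).congr fun a => ?_
    simp

theorem NearHomeo.prod {ε δ : ℝ} {φ : A → ℝ} {ψ : B → ℝ} {φ' : C → ℝ} {ψ' : D → ℝ}
    (h : NearHomeo ε φ ψ) (h' : NearHomeo δ φ' ψ') :
    NearHomeo (ε + δ) (fun p : A × C => φ p.1 + φ' p.2) (fun p : B × D => ψ p.1 + ψ' p.2) := by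
  obtain ⟨e, he, hc⟩ := h
  obtain ⟨e', he', hc'⟩ := h'
  refine ⟨e.prodCongr e', fun a => ?_, ?_⟩
  · have h1 := abs_le.1 (he a.1)
    have h2 := abs_le.1 (he' a.2)
    rw [abs_le]
    simp only [Homeomorph.coe_prodCongr, Prod.map_fst, Prod.map_snd]
    constructor <;> linarith
  · refine ((hc.comp continuous_fst).add (hc'.comp continuous_snd)).congr fun a => ?_
    simp
    ring

theorem NearHomeo.add_const {ε : ℝ} {φ : A → ℝ} {ψ : B → ℝ} (h : NearHomeo ε φ ψ) (c : ℝ) :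
    NearHomeo ε (fun a => φ a + c) (fun b => ψ b + c) := by
  simpa [NearHomeo] using h

theorem NearHomeo.mul_const {ε : ℝ} {φ : A → ℝ} {ψ : B → ℝ} (h : NearHomeo ε φ ψ) {c : ℝ}
    (hc : 0 ≤ c) : NearHomeo (c * ε) (fun a => c * φ a) (fun b => c * ψ b) := by
  obtain ⟨e, he, hcont⟩ := h
  refine ⟨e, fun a => ?_, ?_⟩
  · rw [← mul_sub, abs_mul, abs_of_nonneg hc]
    exact mul_le_mul_of_nonneg_left (he a) hc
  · exact (hcont.const_mul c).congr fun a => by ring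

theorem NearHomeo.shift (φ : A → ℝ) {c c' ε : ℝ} (h : |c' - c| ≤ ε) :
    NearHomeo ε (fun a => φ a + c) (fun a => φ a + c') := by
  refine ⟨.refl A, fun a => ?_, ?_⟩
  · simpa using h
  · simpa using continuous_const

theorem continuous_of_fibers {I : Type*} {p : A → I} (hp : IsLocallyConstant p) {f : A → B}
    (hf : ∀ i, Continuous fun a : {a // p a = i} => f a) : Continuous f := by
  refine continuous_iff_continuousAt.2 fun a => ?_
  have ho : IsOpen {x | p x = p a} := hp.isOpen_fiber (p a)
  have h : ContinuousOn f {x | p x = p a} := continuousOn_iff_continuous_domRestrict.2 (hf (p a))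
  exact h.continuousAt (ho.mem_nhds rfl)

/-- Glue homeomorphisms between the fibres of two locally constant maps. -/
theorem NearHomeo.exists_glue {I : Type*} {p : A → I} {q : B → I} (hp : IsLocallyConstant p)
    (hq : IsLocallyConstant q) {ε : ℝ} {φ : A → ℝ} {ψ : B → ℝ}
    (H : ∀ i, NearHomeo ε (fun a : {a // p a = i} => φ a) (fun b : {b // q b = i} => ψ b)) :
    ∃ h : A ≃ₜ B, (∀ a, q (h a) = p a) ∧ (∀ a, |ψ (h a) - φ a| ≤ ε) ∧
      Continuous fun a => ψ (h a) - φ a := by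
  choose e he hc using H
  have key : ∀ i (a : {a // p a = i}), (e (p a) ⟨a, rfl⟩ : B) = e i a := by
    rintro i ⟨a, rfl⟩; rfl
  have key' : ∀ i (b : {b // q b = i}), ((e (q b)).symm ⟨b, rfl⟩ : A) = (e i).symm b := by
    rintro i ⟨b, rfl⟩; rfl
  refine ⟨⟨⟨fun a => e (p a) ⟨a, rfl⟩, fun b => (e (q b)).symm ⟨b, rfl⟩, fun a => ?_,
    fun b => ?_⟩, ?_, ?_⟩, fun a => (e (p a) ⟨a, rfl⟩).2, fun a => he (p a) ⟨a, rfl⟩, ?_⟩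
  · change ((e (q (e (p a) ⟨a, rfl⟩))).symm ⟨(e (p a) ⟨a, rfl⟩ : B), rfl⟩ : A) = a
    rw [key' (p a) (e (p a) ⟨a, rfl⟩), (e (p a)).symm_apply_apply]
  · change (e (p ((e (q b)).symm ⟨b, rfl⟩)) ⟨((e (q b)).symm ⟨b, rfl⟩ : A), rfl⟩ : B) = b
    rw [key (q b) ((e (q b)).symm ⟨b, rfl⟩), (e (q b)).apply_symm_apply]
  · refine continuous_of_fibers hp fun i => ?_
    exact (continuous_subtype_val.comp (e i).continuous).congr fun a => (key i a).symm
  · refine continuous_of_fibers hq fun i => ?_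
    exact (continuous_subtype_val.comp (e i).symm.continuous).congr fun a => (key' i a).symm
  · refine continuous_of_fibers hp fun i => ?_
    exact (hc i).congr fun a => by
      change ψ (e i a) - φ a = ψ (e (p a) ⟨a, rfl⟩ : B) - φ a
      rw [key i a]

theorem NearHomeo.glue {I : Type*} {p : A → I} {q : B → I} (hp : IsLocallyConstant p)
    (hq : IsLocallyConstant q) {ε : ℝ} {φ : A → ℝ} {ψ : B → ℝ}
    (H : ∀ i, NearHomeo ε (fun a : {a // p a = i} => φ a) (fun b : {b // q b = i} => ψ b)) :
    NearHomeo ε φ ψ :=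
  let ⟨h, _, hb, hc⟩ := NearHomeo.exists_glue hp hq H
  ⟨h, hb, hc⟩

end NearHomeo

/-! ### Graphs of weights -/

/-- The graph of `φ`, that is `A` with the topology refined so that `φ` becomes continuous. -/
abbrev Graph {A : Type*} (φ : A → ℝ) : Type _ := {p : A × ℝ // p.2 = φ p.1}

theorem Graph.ext {A : Type*} {φ : A → ℝ} {p q : Graph φ} (h : p.1.1 = q.1.1) : p = q :=
  Subtype.ext (Prod.ext h (by rw [p.2, q.2, h]))

section Graph

variable {A B : Type*} [TopologicalSpace A] [TopologicalSpace B]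

theorem continuous_graph_weight (φ : A → ℝ) : Continuous fun p : Graph φ => φ p.1.1 :=
  (continuous_snd.comp continuous_subtype_val).congr fun p => p.2

theorem continuous_graph_fst (φ : A → ℝ) : Continuous fun p : Graph φ => p.1.1 :=
  continuous_fst.comp continuous_subtype_val

theorem NearHomeo.graph {ε : ℝ} {φ : A → ℝ} {ψ : B → ℝ} (h : NearHomeo ε φ ψ) :
    Nonempty (Graph φ ≃ₜ Graph ψ) := by
  obtain ⟨e, -, hc⟩ := h
  refine ⟨⟨⟨fun p => ⟨(e p.1.1, ψ (e p.1.1)), rfl⟩,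
    fun p => ⟨(e.symm p.1.1, φ (e.symm p.1.1)), rfl⟩, fun p => ?_, fun p => ?_⟩, ?_, ?_⟩⟩
  · exact Graph.ext (by simp)
  · exact Graph.ext (by simp)
  · refine Continuous.subtype_mk (.prodMk (e.continuous.comp (continuous_graph_fst φ)) ?_) _
    refine ((hc.comp (continuous_graph_fst φ)).add (continuous_graph_weight φ)).congr fun p => ?_
    simp
  · refine Continuous.subtype_mk (.prodMk (e.symm.continuous.comp (continuous_graph_fst ψ)) ?_) _
    refine ((continuous_graph_weight ψ).sub
      ((hc.comp e.symm.continuous).comp (continuous_graph_fst ψ))).congr fun p => ?_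
    simp

theorem graph_const_mul (φ : A → ℝ) {c : ℝ} (hc : c ≠ 0) :
    Nonempty (Graph (fun a => c * φ a) ≃ₜ Graph φ) := by
  refine ⟨⟨⟨fun p => ⟨(p.1.1, φ p.1.1), rfl⟩, fun p => ⟨(p.1.1, c * φ p.1.1), rfl⟩,
    fun p => ?_, fun p => ?_⟩, ?_, ?_⟩⟩
  · exact Graph.ext (φ := fun a => c * φ a) rfl
  · exact Graph.ext rfl
  · refine Continuous.subtype_mk (.prodMk (continuous_graph_fst _) ?_) _
    refine ((continuous_graph_weight fun a => c * φ a).const_mul c⁻¹).congr fun p => ?_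
    field_simp
  · exact Continuous.subtype_mk (.prodMk (continuous_graph_fst _)
      ((continuous_graph_weight φ).const_mul c)) _

theorem graph_prod {φ : A → ℝ} {ψ : B → ℝ} (hφ : LowerSemicontinuous φ)
    (hψ : LowerSemicontinuous ψ) :
    Nonempty (Graph φ × Graph ψ ≃ₜ Graph fun p : A × B => φ p.1 + ψ p.2) := by
  set χ : A × B → ℝ := fun p => φ p.1 + ψ p.2
  have c1 := continuous_graph_fst χ
  have lφ : LowerSemicontinuous fun p : Graph χ => φ p.1.1.1 :=
    hφ.comp (continuous_fst.comp c1)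
  have lψ : LowerSemicontinuous fun p : Graph χ => ψ p.1.1.2 :=
    hψ.comp (continuous_snd.comp c1)
  have hc := continuous_graph_weight χ
  have cφ : Continuous fun p : Graph χ => φ p.1.1.1 := by
    refine continuous_iff_lower_upperSemicontinuous.2 ⟨lφ, ?_⟩
    intro p y hy
    have h1 := lψ p (χ p.1.1 - (y + φ p.1.1.1) / 2) (by simp only [χ]; linarith)
    have hy' : φ p.1.1.1 < y := hy
    have h2 := (hc.tendsto p).eventually_lt_const
      (show χ p.1.1 < χ p.1.1 + (y - φ p.1.1.1) / 2 by linarith)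
    filter_upwards [h1, h2] with q hq1 hq2
    simp only [χ] at hq1 hq2
    linarith
  have cψ : Continuous fun p : Graph χ => ψ p.1.1.2 :=
    (hc.sub cφ).congr fun p => by simp [χ]
  refine ⟨⟨⟨fun p => ⟨((p.1.1.1, p.2.1.1), φ p.1.1.1 + ψ p.2.1.1), rfl⟩,
    fun p => (⟨(p.1.1.1, φ p.1.1.1), rfl⟩, ⟨(p.1.1.2, ψ p.1.1.2), rfl⟩),
    fun p => ?_, fun p => ?_⟩, ?_, ?_⟩⟩
  · exact Prod.ext (Graph.ext rfl) (Graph.ext rfl)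
  · exact Graph.ext rfl
  · refine Continuous.subtype_mk (.prodMk (.prodMk ?_ ?_) (.add ?_ ?_)) _
    · exact (continuous_graph_fst φ).comp continuous_fst
    · exact (continuous_graph_fst ψ).comp continuous_snd
    · exact (continuous_graph_weight φ).comp continuous_fst
    · exact (continuous_graph_weight ψ).comp continuous_snd
  · exact .prodMk (.subtype_mk (.prodMk (continuous_fst.comp c1) cφ) _)
      (.subtype_mk (.prodMk (continuous_snd.comp c1) cψ) _)

end Graph

/-! ### Homeomorphisms from parallel splitting schemes -/

/-- The children `c n s` of a state `s` split the set `W s` into two disjoint pieces. -/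
structure Splits {S Z : Type*} (W : S → Set Z) (c : ℕ → S → Bool → S) : Prop where
  subset : ∀ n s b, W (c n s b) ⊆ W s
  cover : ∀ n s, ∀ z ∈ W s, ∃ b, z ∈ W (c n s b)
  disj : ∀ n s z b b', z ∈ W (c n s b) → z ∈ W (c n s b') → b = b'

open Classical in
/-- The sequence of states whose sets contain `z`. -/
def branch {S Z : Type*} (W : S → Set Z) (c : ℕ → S → Bool → S) (s₀ : S) (z : Z) : ℕ → S
  | 0 => s₀
  | n + 1 => c n (branch W c s₀ z n) (decide (z ∈ W (c n (branch W c s₀ z n) true)))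

namespace Splits

variable {S Z : Type*} {W : S → Set Z} {c : ℕ → S → Bool → S} {s₀ : S}

theorem mem_branch (h : Splits W c) (h0 : W s₀ = univ) (z : Z) (n : ℕ) :
    z ∈ W (branch W c s₀ z n) := by
  induction n with
  | zero => simp [branch, h0]
  | succ n ih =>
    obtain ⟨b, hb⟩ := h.cover n _ z ih
    rw [branch]
    by_cases hz : z ∈ W (c n (branch W c s₀ z n) true)
    · simp [hz]
    · cases b with
      | true => exact absurd hb hz
      | false => simpa [hz] using hb

theorem anti (h : Splits W c) (z : Z) : Antitone fun n => W (branch W c s₀ z n) :=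
  antitone_nat_of_succ_le fun n => by
    rw [branch]
    exact h.subset _ _ _

theorem branch_eq (h : Splits W c) {s : ℕ → S} (hs0 : s 0 = s₀) {z : Z} {N : ℕ}
    (hs : ∀ n < N, ∃ b, s (n + 1) = c n (s n) b) (hz : ∀ n ≤ N, z ∈ W (s n)) :
    ∀ n ≤ N, branch W c s₀ z n = s n := by
  intro n
  induction n with
  | zero => intro; simp [branch, hs0]
  | succ n ih =>
    intro hn
    obtain ⟨b, hb⟩ := hs n (by omega)
    have hm := hz (n + 1) hn
    rw [branch, ih (by omega), hb]
    rw [hb] at hm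
    congr 1
    by_cases ht : z ∈ W (c n (s n) true)
    · simpa [ht] using h.disj n (s n) z _ _ ht hm
    · cases b with
      | true => exact absurd hm ht
      | false => simpa using ht

theorem branch_succ (z : Z) (n : ℕ) :
    ∃ b, branch W c s₀ z (n + 1) = c n (branch W c s₀ z n) b := ⟨_, rfl⟩

theorem branch_congr (h : Splits W c) {z z' : Z} {n : ℕ}
    (hz : z' ∈ W (branch W c s₀ z n)) : ∀ m ≤ n, branch W c s₀ z' m = branch W c s₀ z m :=
  h.branch_eq rfl (fun _ _ => branch_succ z _) fun _ hm => h.anti z hm hz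

end Splits

/-- Two parallel splitting schemes whose branches correspond induce a homeomorphism. -/
theorem exists_homeo_of_splits {S X Y : Type*} [TopologicalSpace X] [TopologicalSpace Y]
    [T2Space X] [T2Space Y] {U : S → Set X} {V : S → Set Y} {c : ℕ → S → Bool → S} {s₀ : S}
    (hU : Splits U c) (hV : Splits V c) (hUo : ∀ s, IsOpen (U s)) (hVo : ∀ s, IsOpen (V s))
    (hU0 : U s₀ = univ) (hV0 : V s₀ = univ)
    (nhdsX : ∀ x, ∀ O ∈ 𝓝 x, ∃ n, U (branch U c s₀ x n) ⊆ O)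
    (nhdsY : ∀ y, ∀ O ∈ 𝓝 y, ∃ n, V (branch V c s₀ y n) ⊆ O)
    (hX : ∀ x, ∃ y, ∀ n, y ∈ V (branch U c s₀ x n))
    (hY : ∀ y, ∃ x, ∀ n, x ∈ U (branch V c s₀ y n)) :
    ∃ h : X ≃ₜ Y, ∀ x, branch V c s₀ (h x) = branch U c s₀ x := by
  choose f hf using hX
  choose g hg using hY
  have bf : ∀ x, branch V c s₀ (f x) = branch U c s₀ x := fun x => funext fun n =>
    hV.branch_eq rfl (fun _ _ => Splits.branch_succ x _) (fun m _ => hf x m) n le_rfl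
  have bg : ∀ y, branch U c s₀ (g y) = branch V c s₀ y := fun y => funext fun n =>
    hU.branch_eq rfl (fun _ _ => Splits.branch_succ y _) (fun m _ => hg y m) n le_rfl
  have injX : ∀ x x', branch U c s₀ x = branch U c s₀ x' → x = x' := by
    intro x x' hxx
    by_contra hne
    obtain ⟨n, hn⟩ := nhdsX x {x'}ᶜ (isOpen_compl_singleton.mem_nhds hne)
    have := hU.mem_branch hU0 x' n
    rw [← hxx] at this
    exact hn this rfl
  have injY : ∀ y y', branch V c s₀ y = branch V c s₀ y' → y = y' := by
    intro y y' hyy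
    by_contra hne
    obtain ⟨n, hn⟩ := nhdsY y {y'}ᶜ (isOpen_compl_singleton.mem_nhds hne)
    have := hV.mem_branch hV0 y' n
    rw [← hyy] at this
    exact hn this rfl
  refine ⟨⟨⟨f, g, fun x => injX _ _ (by rw [bg, bf]), fun y => injY _ _ (by rw [bf, bg])⟩, ?_, ?_⟩,
    bf⟩
  · refine continuous_iff_continuousAt.2 fun x O hO => ?_
    obtain ⟨n, hn⟩ := nhdsY (f x) O hO
    refine Filter.mem_map.2 (Filter.mem_of_superset
      ((hUo _).mem_nhds (hU.mem_branch hU0 x n)) fun x' hx' => hn ?_)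
    change f x' ∈ _
    rw [bf, ← hU.branch_congr hx' n le_rfl]
    exact hf x' n
  · refine continuous_iff_continuousAt.2 fun y O hO => ?_
    obtain ⟨n, hn⟩ := nhdsX (g y) O hO
    refine Filter.mem_map.2 (Filter.mem_of_superset
      ((hVo _).mem_nhds (hV.mem_branch hV0 y n)) fun z hz => hn ?_)
    change g z ∈ _
    rw [bg, ← hV.branch_congr hz n le_rfl]
    exact hg z n

/-! ### Splitting schemes steered by minimizers -/

/-- Clopen sets `U`, `V` with points `p`, `q` minimizing the respective weights. -/
structure MinPair {A B : Type*} [TopologicalSpace A] [TopologicalSpace B] (φ : A → ℝ)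
    (ψ : B → ℝ) where
  U : Set A
  V : Set B
  p : A
  q : B
  clopenU : IsClopen U
  clopenV : IsClopen V
  memU : p ∈ U
  memV : q ∈ V
  minU : ∀ a ∈ U, φ p ≤ φ a
  minV : ∀ b ∈ V, ψ q ≤ ψ b

/-- A countable basis of clopen sets. -/
def ClopenBasis (A : Type*) [TopologicalSpace A] : Prop :=
  ∃ D : ℕ → Set A, (∀ n, IsClopen (D n)) ∧ ∀ x, ∀ O ∈ 𝓝 x, ∃ n, x ∈ D n ∧ D n ⊆ O

section MinPair

variable {A B : Type*} [TopologicalSpace A] [TopologicalSpace B] {φ : A → ℝ} {ψ : B → ℝ}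

/-- Exchange the two sides. -/
def MinPair.swap (m : MinPair φ ψ) : MinPair ψ φ :=
  ⟨m.V, m.U, m.q, m.p, m.clopenV, m.clopenU, m.memV, m.memU, m.minV, m.minU⟩

/-- The first clopen set of an optional pair. -/
def setU (s : Option (MinPair φ ψ)) : Set A := s.elim ∅ MinPair.U

/-- The second clopen set of an optional pair. -/
def setV (s : Option (MinPair φ ψ)) : Set B := s.elim ∅ MinPair.V

/-- Either the designated points are unchanged, or both change and are related by `E`. -/
def Moves (E : A → B → A → B → Prop) (p : A) (q : B) (p₁ : A) (q₁ : B) : Prop :=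
  (p₁ = p ∧ q₁ = q) ∨ (p₁ ≠ p ∧ q₁ ≠ q ∧ E p q p₁ q₁)

/-- `c` splits both sets of `s` in two, the designated points moving according to `E`. -/
structure IsSplit (E : A → B → A → B → Prop) (s : Option (MinPair φ ψ))
    (c : Bool → Option (MinPair φ ψ)) : Prop where
  subU : ∀ b, setU (c b) ⊆ setU s
  subV : ∀ b, setV (c b) ⊆ setV s
  coverU : ∀ z ∈ setU s, ∃ b, z ∈ setU (c b)
  coverV : ∀ z ∈ setV s, ∃ b, z ∈ setV (c b)
  disjU : ∀ z b b', z ∈ setU (c b) → z ∈ setU (c b') → b = b'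
  disjV : ∀ z b b', z ∈ setV (c b) → z ∈ setV (c b') → b = b'
  moves : ∀ m ∈ s, ∀ b, ∀ m' ∈ c b, Moves E m.p m.q m'.p m'.q

theorem setU_swap (s : Option (MinPair φ ψ)) : setU (s.map MinPair.swap) = setV s := by
  cases s <;> rfl

theorem setV_swap (s : Option (MinPair φ ψ)) : setV (s.map MinPair.swap) = setU s := by
  cases s <;> rfl

theorem IsSplit.swap {E : A → B → A → B → Prop} {E' : B → A → B → A → Prop}
    (hE : ∀ p q p' q', E p q p' q' → E' q p q' p') {s : Option (MinPair φ ψ)}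
    {c : Bool → Option (MinPair φ ψ)} (h : IsSplit E s c) :
    IsSplit E' (s.map MinPair.swap) fun b => (c b).map MinPair.swap := by
  refine ⟨?_, ?_, ?_, ?_, ?_, ?_, ?_⟩ <;> try simp only [setU_swap, setV_swap]
  · exact h.subV
  · exact h.subU
  · exact h.coverV
  · exact h.coverU
  · exact h.disjV
  · exact h.disjU
  · intro m hm b m' hm'
    obtain ⟨n, hn, rfl⟩ := Option.mem_map.1 hm
    obtain ⟨n', hn', rfl⟩ := Option.mem_map.1 hm'
    rcases h.moves n hn b n' hn' with ⟨h1, h2⟩ | ⟨h1, h2, h3⟩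
    · exact .inl ⟨h2, h1⟩
    · exact .inr ⟨h2, h1, hE _ _ _ _ h3⟩

/-- On a nonempty clopen set a weight with compact sublevel sets attains its minimum. -/
theorem exists_minimizer [T2Space A] (hφ : ∀ r, IsCompact {a | φ a ≤ r}) {U : Set A}
    (hU : IsClosed U) (hne : U.Nonempty) : ∃ p ∈ U, ∀ a ∈ U, φ p ≤ φ a := by
  obtain ⟨x, hx⟩ := hne
  have hlsc : LowerSemicontinuous φ := by
    refine lowerSemicontinuous_iff_isClosed_preimage.2 fun r => (hφ r).isClosed
  obtain ⟨p, hp, hmin⟩ := (hlsc.lowerSemicontinuousOn _).exists_isMinOn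
    (s := {a | φ a ≤ φ x} ∩ U) ⟨x, le_refl (φ x), hx⟩ ((hφ _).inter_right hU)
  refine ⟨p, hp.2, fun a ha => ?_⟩
  by_cases h : φ a ≤ φ x
  · exact hmin ⟨h, ha⟩
  · exact (hp.1 : φ p ≤ φ x).trans (not_le.1 h).le

/-- The step available on the first side of a scheme. -/
def CanMove (φ : A → ℝ) (ψ : B → ℝ) (E : A → B → A → B → Prop) : Prop :=
  ∀ p q p', ∀ V ∈ 𝓝 q, φ p ≤ φ p' → p' ≠ p → ∃ V' ⊆ V, IsClopen V' ∧ q ∉ V' ∧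
    ∃ q' ∈ V', (∀ b ∈ V', ψ q' ≤ ψ b) ∧ E p q p' q'

theorem exists_split [T2Space A] (hφ : ∀ r, IsCompact {a | φ a ≤ r})
    {E : A → B → A → B → Prop} (hE : CanMove φ ψ E) {D : Set A} (hD : IsClopen D)
    (s : Option (MinPair φ ψ)) :
    ∃ c, IsSplit E s c ∧ ∀ b, setU (c b) ⊆ D ∨ Disjoint (setU (c b)) D := by
  rcases s with _ | m
  · refine ⟨fun _ => none, ⟨?_, ?_, ?_, ?_, ?_, ?_, ?_⟩, ?_⟩ <;> simp [setU, setV]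
  obtain ⟨D', hD', hp, hDD⟩ : ∃ D', IsClopen D' ∧ m.p ∈ D' ∧ (D' = D ∨ D' = Dᶜ) := by
    by_cases h : m.p ∈ D
    · exact ⟨D, hD, h, .inl rfl⟩
    · exact ⟨Dᶜ, hD.compl, h, .inr rfl⟩
  have sep1 : ∀ W ⊆ D', W ⊆ D ∨ Disjoint W D := by
    intro W hW
    rcases hDD with rfl | rfl
    · exact .inl hW
    · exact .inr (disjoint_left.2 fun x hx => hW hx)
  have sep2 : ∀ W ⊆ D'ᶜ, W ⊆ D ∨ Disjoint W D := by
    intro W hW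
    rcases hDD with rfl | rfl
    · exact .inr (disjoint_left.2 fun x hx => hW hx)
    · exact .inl (by simpa using hW)
  by_cases hne : (m.U \ D').Nonempty
  · obtain ⟨p', hp', hmin⟩ := exists_minimizer hφ (m.clopenU.diff hD').isClosed hne
    obtain ⟨V', hV', hcl, hq, q', hq', hmin', hE'⟩ := hE m.p m.q p' m.V
      (m.clopenV.isOpen.mem_nhds m.memV) (m.minU _ hp'.1) (fun h => hp'.2 (h ▸ hp))
    refine ⟨fun b => bif b then
      some ⟨m.U ∩ D', m.V \ V', m.p, m.q, m.clopenU.inter hD', m.clopenV.diff hcl, ⟨m.memU, hp⟩,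
        ⟨m.memV, hq⟩, fun a ha => m.minU a ha.1, fun b hb => m.minV b hb.1⟩
      else some ⟨m.U \ D', V', p', q', m.clopenU.diff hD', hcl, hp', hq', hmin, hmin'⟩,
      ⟨?_, ?_, ?_, ?_, ?_, ?_, ?_⟩, ?_⟩
    · rintro (_ | _)
      · exact sdiff_subset
      · exact inter_subset_left
    · rintro (_ | _)
      · exact hV'
      · exact sdiff_subset
    · intro z hz
      by_cases h : z ∈ D'
      · exact ⟨true, hz, h⟩
      · exact ⟨false, hz, h⟩
    · intro z hz
      by_cases h : z ∈ V'
      · exact ⟨false, h⟩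
      · exact ⟨true, hz, h⟩
    · rintro z (_ | _) (_ | _) h1 h2
      · rfl
      · exact absurd h2.2 h1.2
      · exact absurd h1.2 h2.2
      · rfl
    · rintro z (_ | _) (_ | _) h1 h2
      · rfl
      · exact absurd h1 h2.2
      · exact absurd h2 h1.2
      · rfl
    · rintro _ ⟨⟩ (_ | _) _ ⟨⟩
      · exact .inr ⟨ne_of_mem_of_not_mem hp hp'.2 |>.symm, ne_of_mem_of_not_mem hq' hq, hE'⟩
      · exact .inl ⟨rfl, rfl⟩
    · rintro (_ | _)
      · exact sep2 _ fun x hx => hx.2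
      · exact sep1 _ inter_subset_right
  · have hsub : m.U ⊆ D' := fun x hx => by_contra fun h => hne ⟨x, hx, h⟩
    refine ⟨fun b => bif b then some m else none, ⟨?_, ?_, ?_, ?_, ?_, ?_, ?_⟩, ?_⟩
    · rintro (_ | _)
      · exact empty_subset _
      · exact subset_rfl
    · rintro (_ | _)
      · exact empty_subset _
      · exact subset_rfl
    · exact fun z hz => ⟨true, hz⟩
    · exact fun z hz => ⟨true, hz⟩
    · rintro z (_ | _) (_ | _) h1 h2
      · rfl
      · exact h1.elim
      · exact h2.elim
      · rfl
    · rintro z (_ | _) (_ | _) h1 h2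
      · rfl
      · exact h1.elim
      · exact h2.elim
      · rfl
    · rintro _ ⟨⟩ (_ | _) _ h
      · simp at h
      · cases h
        exact .inl ⟨rfl, rfl⟩
    · rintro (_ | _)
      · exact .inl (empty_subset _)
      · exact sep1 _ hsub


theorem exists_homeo_of_canMove [T2Space A] [T2Space B] (hφ : ∀ r, IsCompact {a | φ a ≤ r})
    (hψ : ∀ r, IsCompact {b | ψ b ≤ r}) (hA : ClopenBasis A) (hB : ClopenBasis B)
    {E : ℕ → A → B → A → B → Prop} (hE : ∀ n, CanMove φ ψ (E n))
    (hE' : ∀ n, CanMove ψ φ fun q p q' p' => E n p q p' q') {p₀ : A} {q₀ : B}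
    (hp₀ : ∀ a, φ p₀ ≤ φ a) (hq₀ : ∀ b, ψ q₀ ≤ ψ b)
    (bdd : ∀ (p : ℕ → A) (q : ℕ → B), p 0 = p₀ → q 0 = q₀ →
      Monotone (fun n => φ (p n)) → Monotone (fun n => ψ (q n)) →
      (∀ n, Moves (E n) (p n) (q n) (p (n + 1)) (q (n + 1))) →
      (BddAbove (range fun n => φ (p n)) ↔ BddAbove (range fun n => ψ (q n)))) :
    ∃ (h : A ≃ₜ B) (p : A → ℕ → A) (q : A → ℕ → B),
      (∀ a, p a 0 = p₀ ∧ q a 0 = q₀) ∧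
      (∀ a n, Moves (E n) (p a n) (q a n) (p a (n + 1)) (q a (n + 1))) ∧
      (∀ a n, φ (p a n) ≤ φ a) ∧ (∀ a n, ψ (q a n) ≤ ψ (h a)) ∧
      (∀ a, Filter.Tendsto (p a) .atTop (𝓝 a)) ∧ (∀ a, Filter.Tendsto (q a) .atTop (𝓝 (h a))) ∧
      ∀ a n, ∀ᶠ a' in 𝓝 a, p a' n = p a n ∧ q a' n = q a n := by
  obtain ⟨DA, hDA, basA⟩ := hA
  obtain ⟨DB, hDB, basB⟩ := hB
  have step : ∀ n (s : Option (MinPair φ ψ)), ∃ c, IsSplit (E n) s c ∧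
      (n % 2 = 0 → ∀ b, setU (c b) ⊆ DA (n / 2) ∨ Disjoint (setU (c b)) (DA (n / 2))) ∧
      (n % 2 = 1 → ∀ b, setV (c b) ⊆ DB (n / 2) ∨ Disjoint (setV (c b)) (DB (n / 2))) := by
    intro n s
    rcases Nat.mod_two_eq_zero_or_one n with hn | hn
    · obtain ⟨c, h1, h2⟩ := exists_split hφ (hE n) (hDA (n / 2)) s
      exact ⟨c, h1, fun _ => h2, fun h => by omega⟩
    · obtain ⟨c, h1, h2⟩ := exists_split hψ (hE' n) (hDB (n / 2)) (s.map MinPair.swap)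
      refine ⟨fun b => (c b).map MinPair.swap, ?_, fun h => by omega, fun _ b => ?_⟩
      · have := h1.swap (E' := E n) fun _ _ _ _ h => h
        rw [Option.map_map] at this
        have hid : (MinPair.swap ∘ MinPair.swap : MinPair φ ψ → MinPair φ ψ) = id := rfl
        rwa [hid, Option.map_id_fun, id] at this
      · rw [setV_swap]
        exact h2 b
  choose c hc sepA sepB using step
  have sU : Splits (setU (φ := φ) (ψ := ψ)) c :=
    ⟨fun n s => (hc n s).subU, fun n s => (hc n s).coverU, fun n s => (hc n s).disjU⟩
  have sV : Splits (setV (φ := φ) (ψ := ψ)) c :=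
    ⟨fun n s => (hc n s).subV, fun n s => (hc n s).coverV, fun n s => (hc n s).disjV⟩
  set m₀ : MinPair φ ψ := ⟨univ, univ, p₀, q₀, isClopen_univ, isClopen_univ, trivial, trivial,
    fun a _ => hp₀ a, fun b _ => hq₀ b⟩
  set s₀ : Option (MinPair φ ψ) := some m₀
  have hU0 : setU s₀ = univ := rfl
  have hV0 : setV s₀ = univ := rfl
  have nA : ∀ a, ∀ O ∈ 𝓝 a, ∃ n, setU (branch setU c s₀ a n) ⊆ O := by
    intro a O hO
    obtain ⟨m, hm, hmO⟩ := basA a O hO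
    have hmem := sU.mem_branch hU0 a (2 * m + 1)
    refine ⟨2 * m + 1, ?_⟩
    obtain ⟨b, hb⟩ := Splits.branch_succ (W := setU) (c := c) (s₀ := s₀) a (2 * m)
    rw [hb] at hmem ⊢
    rcases sepA (2 * m) (branch setU c s₀ a (2 * m)) (by omega) b with h | h
    · rw [show 2 * m / 2 = m by omega] at h
      exact h.trans hmO
    · rw [show 2 * m / 2 = m by omega] at h
      exact (disjoint_left.1 h hmem hm).elim
  have nB : ∀ a, ∀ O ∈ 𝓝 a, ∃ n, setV (branch setV c s₀ a n) ⊆ O := by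
    intro a O hO
    obtain ⟨m, hm, hmO⟩ := basB a O hO
    have hmem := sV.mem_branch hV0 a (2 * m + 2)
    refine ⟨2 * m + 2, ?_⟩
    obtain ⟨b, hb⟩ := Splits.branch_succ (W := setV) (c := c) (s₀ := s₀) a (2 * m + 1)
    rw [hb] at hmem ⊢
    rcases sepB (2 * m + 1) (branch setV c s₀ a (2 * m + 1)) (by omega) b with h | h
    · rw [show (2 * m + 1) / 2 = m by omega] at h
      exact h.trans hmO
    · rw [show (2 * m + 1) / 2 = m by omega] at h
      exact (disjoint_left.1 h hmem hm).elim
  have chain : ∀ m : ℕ → MinPair φ ψ, m 0 = m₀ →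
      (∀ n, ∃ b, some (m (n + 1)) = c n (some (m n)) b) →
      Monotone (fun n => φ (m n).p) ∧ Monotone (fun n => ψ (m n).q) ∧
      Antitone (fun n => (m n).U) ∧ Antitone (fun n => (m n).V) ∧
      (∀ n, Moves (E n) (m n).p (m n).q (m (n + 1)).p (m (n + 1)).q) := by
    intro m _ hm
    have aU : Antitone (fun n => (m n).U) := antitone_nat_of_succ_le fun n => by
      obtain ⟨b, hb⟩ := hm n
      have := (hc n (some (m n))).subU b
      rwa [← hb] at this
    have aV : Antitone (fun n => (m n).V) := antitone_nat_of_succ_le fun n => by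
      obtain ⟨b, hb⟩ := hm n
      have := (hc n (some (m n))).subV b
      rwa [← hb] at this
    refine ⟨monotone_nat_of_le_succ fun n => (m n).minU _ (aU n.le_succ (m (n + 1)).memU),
      monotone_nat_of_le_succ fun n => (m n).minV _ (aV n.le_succ (m (n + 1)).memV), aU, aV,
      fun n => ?_⟩
    obtain ⟨b, hb⟩ := hm n
    exact (hc n (some (m n))).moves _ rfl b _ hb.symm
  have some_of : ∀ s : ℕ → Option (MinPair φ ψ), s 0 = s₀ → (∀ n, ∃ b, s (n + 1) = c n (s n) b) →
      (∀ n, (setU (s n)).Nonempty ∨ (setV (s n)).Nonempty) →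
      ∃ m : ℕ → MinPair φ ψ, m 0 = m₀ ∧ (∀ n, s n = some (m n)) ∧
        ∀ n, ∃ b, some (m (n + 1)) = c n (some (m n)) b := by
    intro s hs0 hs hne
    have : ∀ n, ∃ m, s n = some m := by
      intro n
      have h := hne n
      cases hn : s n with
      | none => simp [hn, setU, setV] at h
      | some m => exact ⟨m, rfl⟩
    choose m hm using this
    refine ⟨m, Option.some_injective _ ((hm 0).symm.trans hs0), hm, fun n => ?_⟩
    rw [← hm, ← hm]
    exact hs n
  have chainU : ∀ a, ∃ m : ℕ → MinPair φ ψ, m 0 = m₀ ∧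
      (∀ n, branch setU c s₀ a n = some (m n)) ∧
        ∀ n, ∃ b, some (m (n + 1)) = c n (some (m n)) b :=
    fun a => some_of _ rfl (Splits.branch_succ a) fun n => .inl ⟨a, sU.mem_branch hU0 a n⟩
  have chainV : ∀ a, ∃ m : ℕ → MinPair φ ψ, m 0 = m₀ ∧
      (∀ n, branch setV c s₀ a n = some (m n)) ∧
        ∀ n, ∃ b, some (m (n + 1)) = c n (some (m n)) b :=
    fun a => some_of _ rfl (Splits.branch_succ a) fun n => .inr ⟨a, sV.mem_branch hV0 a n⟩
  have openU : ∀ s : Option (MinPair φ ψ), IsOpen (setU s) := by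
    rintro (_ | m)
    · exact isOpen_empty
    · exact m.clopenU.isOpen
  have openV : ∀ s : Option (MinPair φ ψ), IsOpen (setV s) := by
    rintro (_ | m)
    · exact isOpen_empty
    · exact m.clopenV.isOpen
  obtain ⟨h, hh⟩ : ∃ h : A ≃ₜ B, ∀ a, branch setV c s₀ (h a) = branch setU c s₀ a := by
    refine exists_homeo_of_splits sU sV openU openV hU0 hV0 nA nB (fun a => ?_) fun b => ?_
    · obtain ⟨m, hm0, hm, hstep⟩ := chainU a
      obtain ⟨mp, mq, aU, aV, hmov⟩ := chain m hm0 hstep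
      have hb := (bdd (fun n => (m n).p) (fun n => (m n).q) (by rw [hm0]) (by rw [hm0]) mp mq
        hmov).1 ⟨φ a, by
          rintro _ ⟨n, rfl⟩
          refine (m n).minU a ?_
          have := sU.mem_branch hU0 a n
          rwa [hm n] at this⟩
      obtain ⟨r, hr⟩ := hb
      obtain ⟨y, hy⟩ := IsCompact.nonempty_iInter_of_sequence_nonempty_isCompact_isClosed
        (fun n => {b | ψ b ≤ r} ∩ (m n).V) (fun n => inter_subset_inter_right _ (aV n.le_succ))
        (fun n => ⟨(m n).q, hr ⟨n, rfl⟩, (m n).memV⟩) ((hψ r).inter_right (m 0).clopenV.isClosed)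
        (fun n => (hψ r).isClosed.inter (m n).clopenV.isClosed)
      refine ⟨y, fun n => ?_⟩
      rw [hm n]
      exact (mem_iInter.1 hy n).2
    · obtain ⟨m, hm0, hm, hstep⟩ := chainV b
      obtain ⟨mp, mq, aU, aV, hmov⟩ := chain m hm0 hstep
      have hb := (bdd (fun n => (m n).p) (fun n => (m n).q) (by rw [hm0]) (by rw [hm0]) mp mq
        hmov).2 ⟨ψ b, by
          rintro _ ⟨n, rfl⟩
          refine (m n).minV b ?_
          have := sV.mem_branch hV0 b n
          rwa [hm n] at this⟩
      obtain ⟨r, hr⟩ := hb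
      obtain ⟨y, hy⟩ := IsCompact.nonempty_iInter_of_sequence_nonempty_isCompact_isClosed
        (fun n => {b | φ b ≤ r} ∩ (m n).U) (fun n => inter_subset_inter_right _ (aU n.le_succ))
        (fun n => ⟨(m n).p, hr ⟨n, rfl⟩, (m n).memU⟩) ((hφ r).inter_right (m 0).clopenU.isClosed)
        (fun n => (hφ r).isClosed.inter (m n).clopenU.isClosed)
      refine ⟨y, fun n => ?_⟩
      rw [hm n]
      exact (mem_iInter.1 hy n).2
  choose m hm0 hm hstep using chainU
  have memU : ∀ a n, a ∈ (m a n).U := fun a n => by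
    have := sU.mem_branch hU0 a n
    rwa [hm a n] at this
  have memV : ∀ a n, h a ∈ (m a n).V := fun a n => by
    have := sV.mem_branch hV0 (h a) n
    rwa [hh, hm a n] at this
  refine ⟨h, fun a n => (m a n).p, fun a n => (m a n).q, fun a => ?_, fun a => ?_,
    fun a n => (m a n).minU a (memU a n), fun a n => (m a n).minV _ (memV a n), fun a O hO => ?_,
    fun a O hO => ?_, fun a n => ?_⟩
  · simp [hm0, m₀]
  · exact (chain (m a) (hm0 a) (hstep a)).2.2.2.2
  · obtain ⟨n, hn⟩ := nA a O hO
    refine Filter.mem_map.2 (Filter.mem_atTop_sets.2 ⟨n, fun k hk => hn ?_⟩)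
    rw [hm]
    exact (chain (m a) (hm0 a) (hstep a)).2.2.1 hk (m a k).memU
  · obtain ⟨n, hn⟩ := nB (h a) O hO
    refine Filter.mem_map.2 (Filter.mem_atTop_sets.2 ⟨n, fun k hk => hn ?_⟩)
    rw [hh, hm]
    exact (chain (m a) (hm0 a) (hstep a)).2.2.2.1 hk (m a k).memV
  · filter_upwards [(openU _).mem_nhds (sU.mem_branch hU0 a n)] with a' ha'
    have := sU.branch_congr ha' n le_rfl
    rw [hm, hm] at this
    rw [Option.some_injective _ this]
    exact ⟨rfl, rfl⟩

end MinPair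

section ClopenBasis

variable {A B : Type*} [TopologicalSpace A] [TopologicalSpace B]

theorem ClopenBasis.of_isTopologicalBasis [SecondCountableTopology A]
    (h : TopologicalSpace.IsTopologicalBasis {s : Set A | IsClopen s}) : ClopenBasis A := by
  obtain ⟨c, hc, hcount, hb⟩ := h.exists_countable
  have hcount' : (insert ∅ c).Countable := hcount.insert ∅
  obtain ⟨D, hD⟩ := hcount'.exists_eq_range (insert_nonempty _ _)
  refine ⟨D, fun n => ?_, fun x O hO => ?_⟩
  · have : D n ∈ insert ∅ c := hD ▸ mem_range_self n
    rcases this with h | h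
    · exact h ▸ isClopen_empty
    · exact hc h
  · obtain ⟨t, ht, hxt, htO⟩ := hb.mem_nhds_iff.1 hO
    obtain ⟨n, rfl⟩ : t ∈ range D := hD ▸ mem_insert_of_mem _ ht
    exact ⟨n, hxt, htO⟩

theorem ClopenBasis.of_isInducing (hB : ClopenBasis B) {f : A → B} (hf : IsInducing f) :
    ClopenBasis A := by
  obtain ⟨D, hD, hb⟩ := hB
  refine ⟨fun n => f ⁻¹' D n, fun n => (hD n).preimage hf.continuous, fun x O hO => ?_⟩
  rw [hf.nhds_eq_comap] at hO
  obtain ⟨t, ht, htO⟩ := hO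
  obtain ⟨n, hn, hnt⟩ := hb _ t ht
  exact ⟨n, hn, (preimage_mono hnt).trans htO⟩

theorem clopenBasis_of_profinite [SecondCountableTopology A] [CompactSpace A] [T2Space A]
    [TotallyDisconnectedSpace A] : ClopenBasis A :=
  .of_isTopologicalBasis isTopologicalBasis_isClopen

theorem clopenBasis_of_countable [Countable A] [TopologicalSpace.MetrizableSpace A] :
    ClopenBasis A := by
  let _ := TopologicalSpace.metrizableSpaceMetric A
  have : SecondCountableTopology A := UniformSpace.secondCountable_of_separable A
  refine .of_isTopologicalBasis (TopologicalSpace.isTopologicalBasis_of_isOpen_of_nhds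
    (fun u hu => hu.isOpen) fun x U hx hU => ?_)
  obtain ⟨r, hr, hrU⟩ := Metric.isOpen_iff.1 hU x hx
  obtain ⟨s, hs, hs0, hsr⟩ := ((countable_range fun y => dist y x).dense_compl ℝ).exists_between hr
  have : Metric.ball x s = Metric.closedBall x s := by
    ext y
    simp only [Metric.mem_ball, Metric.mem_closedBall]
    exact ⟨le_of_lt, fun h => lt_of_le_of_ne h fun h' => hs ⟨y, h'⟩⟩
  refine ⟨Metric.ball x s, ⟨?_, Metric.isOpen_ball⟩, Metric.mem_ball_self hs0,
    (Metric.ball_subset_ball hsr.le).trans hrU⟩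
  rw [this]
  exact Metric.isClosed_closedBall

end ClopenBasis

/-! ### Countable spaces without isolated points -/

/-- A countable metrizable space without isolated points. -/
structure RatLike (A : Type*) [TopologicalSpace A] : Prop where
  countable : Countable A
  metrizable : TopologicalSpace.MetrizableSpace A
  crowded : ∀ x : A, (𝓝[≠] x).NeBot

section RatLike

variable {A B : Type*}

theorem RatLike.canMove [TopologicalSpace B] (hB : RatLike B) {φ : A → ℝ} {ψ : B → ℝ}
    (hψ : ∀ r, IsCompact {a | ψ a ≤ r}) : CanMove φ ψ fun _ _ _ _ => True := by
  have := hB.countable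
  have := hB.metrizable
  obtain ⟨D, hD, hb⟩ := clopenBasis_of_countable (A := B)
  intro p q p' V hV _ _
  have := hB.crowded q
  obtain ⟨x, hxV, hxq⟩ := (Filter.NeBot.nonempty_of_mem this
    (inter_mem_nhdsWithin _ (mem_interior_iff_mem_nhds.2 hV |> isOpen_interior.mem_nhds)))
  obtain ⟨n, hn, hnO⟩ := hb x (interior V ∩ {q}ᶜ)
    ((isOpen_interior.inter isOpen_compl_singleton).mem_nhds ⟨hxq, hxV⟩)
  obtain ⟨q', hq', hmin⟩ := exists_minimizer hψ (hD n).isClosed ⟨x, hn⟩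
  exact ⟨D n, fun y hy => interior_subset (hnO hy).1, hD n, fun h => (hnO h).2 rfl, q', hq', hmin,
    trivial⟩

theorem isCompact_le_of_injective [TopologicalSpace A] {f : A → ℕ} (hf : Function.Injective f)
    (r : ℝ) : IsCompact {a | (f a : ℝ) ≤ r} :=
  Set.Finite.isCompact (((finite_Iic ⌊r⌋₊).preimage hf.injOn).subset fun _ ha => Nat.le_floor ha)

theorem Moves.bddAbove {f : A → ℕ} (hf : Function.Injective f) {ψ : B → ℝ}
    {E : ℕ → A → B → A → B → Prop} {p : ℕ → A} {q : ℕ → B}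
    (hmono : Monotone fun n => (f (p n) : ℝ)) (hq : Monotone fun n => ψ (q n))
    (hm : ∀ n, Moves (E n) (p n) (q n) (p (n + 1)) (q (n + 1)))
    (hb : BddAbove (range fun n => (f (p n) : ℝ))) : BddAbove (range fun n => ψ (q n)) := by
  obtain ⟨r, hr⟩ := hb
  have hbn : BddAbove (range fun n => f (p n)) := ⟨⌊r⌋₊, by
    rintro _ ⟨n, rfl⟩
    exact Nat.le_floor (hr ⟨n, rfl⟩)⟩
  obtain ⟨N, hN⟩ := Nat.sSup_mem (range_nonempty _) hbn
  have hconst : ∀ n ≥ N, p n = p N := fun n hn => hf (le_antisymm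
    ((le_csSup hbn ⟨n, rfl⟩).trans hN.ge) (Nat.cast_le.1 (hmono hn : (f (p N) : ℝ) ≤ f (p n))))
  have hqc : ∀ n ≥ N, q n = q N := by
    intro n hn
    induction n, hn using Nat.le_induction with
    | base => rfl
    | succ n hn ih =>
      rcases hm n with ⟨_, h⟩ | ⟨h, _⟩
      · rw [h, ih]
      · exact absurd ((hconst _ (by omega)).trans (hconst n hn).symm) h
  refine ⟨ψ (q N), ?_⟩
  rintro _ ⟨n, rfl⟩
  rcases le_total n N with h | h
  · exact hq h
  · exact (congrArg ψ (hqc n h)).le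

theorem Moves.swap {E : A → B → A → B → Prop} {p p' : A} {q q' : B} (h : Moves E p q p' q') :
    Moves (fun q p q' p' => E p q p' q') q p q' p' := by
  rcases h with ⟨h1, h2⟩ | ⟨h1, h2, h3⟩
  · exact .inl ⟨h2, h1⟩
  · exact .inr ⟨h2, h1, h3⟩

/-- Sierpiński: any two nonempty countable metrizable spaces without isolated points are
homeomorphic. -/
theorem RatLike.nonempty_homeomorph [TopologicalSpace A] [TopologicalSpace B]
    [Nonempty A] [Nonempty B] (hA : RatLike A) (hB : RatLike B) :
    Nonempty (A ≃ₜ B) := by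
  have := hA.countable
  have := hA.metrizable
  have := hB.countable
  have := hB.metrizable
  obtain ⟨f, hf⟩ := exists_injective_nat A
  obtain ⟨g, hg⟩ := exists_injective_nat B
  obtain ⟨p₀, -, hp⟩ := exists_minimizer (isCompact_le_of_injective hf) isClosed_univ univ_nonempty
  obtain ⟨q₀, -, hq⟩ := exists_minimizer (isCompact_le_of_injective hg) isClosed_univ univ_nonempty
  obtain ⟨h, -⟩ := exists_homeo_of_canMove (isCompact_le_of_injective hf)
    (isCompact_le_of_injective hg) clopenBasis_of_countable clopenBasis_of_countable
    (E := fun _ _ _ _ _ => True) (fun _ => hB.canMove (isCompact_le_of_injective hg))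
    (fun _ => hA.canMove (isCompact_le_of_injective hf)) (fun a => hp a trivial)
    (fun b => hq b trivial)
    fun p q _ _ mp mq hm => ⟨Moves.bddAbove (ψ := fun b => (g b : ℝ)) hf mp mq hm,
      Moves.bddAbove (ψ := fun a => (f a : ℝ)) hg mq mp fun n => (hm n).swap⟩
  exact ⟨h⟩

end RatLike

/-! ### Lelek weights -/

/-- Weights with compact sublevel sets on zero-dimensional spaces such that near every point all
larger values are almost attained. -/
structure IsLelek {A : Type*} [TopologicalSpace A] (φ : A → ℝ) : Prop where
  t2 : T2Space A
  basis : ClopenBasis A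
  compact : ∀ r, IsCompact {a | φ a ≤ r}
  dense : ∀ x, ∀ O ∈ 𝓝 x, ∀ u v, φ x ≤ u → u < v → ∃ y ∈ O, u ≤ φ y ∧ φ y < v

section Lelek

variable {A B : Type*} [TopologicalSpace A] [TopologicalSpace B] {φ : A → ℝ} {ψ : B → ℝ}

theorem IsLelek.lowerSemicontinuous (h : IsLelek φ) : LowerSemicontinuous φ := by
  have := h.t2
  exact lowerSemicontinuous_iff_isClosed_preimage.2 fun r => (h.compact r).isClosed

theorem IsLelek.canMove {X : Type*} {φ : X → ℝ} (hψ : IsLelek ψ) {η : ℝ} (hη : 0 < η) :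
    CanMove φ ψ fun p q p' q' => |(ψ q' - φ p') - (ψ q - φ p)| ≤ η := by
  have := hψ.t2
  obtain ⟨D, hD, hb⟩ := hψ.basis
  intro p q p' V hV hpp _
  obtain ⟨y, hy, h1, h2, hyq⟩ : ∃ y ∈ interior V, ψ q + (φ p' - φ p) + η / 4 ≤ ψ y ∧
      ψ y < ψ q + (φ p' - φ p) + η / 2 ∧ y ≠ q := by
    obtain ⟨y, hy, h1, h2⟩ := hψ.dense q (interior V) (interior_mem_nhds.2 hV)
      (ψ q + (φ p' - φ p) + η / 4) (ψ q + (φ p' - φ p) + η / 2) (by linarith) (by linarith)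
    exact ⟨y, hy, h1, h2, by rintro rfl; linarith⟩
  have hl := hψ.lowerSemicontinuous y (ψ y - η / 4) (by linarith)
  obtain ⟨n, hn, hnO⟩ := hb y _ (Filter.inter_mem (Filter.inter_mem
    (isOpen_interior.mem_nhds hy) (isOpen_compl_singleton.mem_nhds hyq)) hl)
  obtain ⟨q', hq', hmin⟩ := exists_minimizer hψ.compact (hD n).isClosed ⟨y, hn⟩
  refine ⟨D n, fun y hy => interior_subset (hnO hy).1.1, hD n, fun h => (hnO h).1.2 rfl, q', hq',
    hmin, ?_⟩
  have h3 : ψ y - η / 4 < ψ q' := (hnO hq').2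
  have h4 := hmin y hn
  refine abs_le.2 ?_
  constructor <;> linarith

/-- A weight is continuous along sequences on which it is dominated by its limit value. -/
theorem tendsto_of_le_of_lowerSemicontinuous (hφ : LowerSemicontinuous φ) {p : ℕ → A} {a : A}
    (hp : Filter.Tendsto p .atTop (𝓝 a)) (hle : ∀ n, φ (p n) ≤ φ a) :
    Filter.Tendsto (fun n => φ (p n)) .atTop (𝓝 (φ a)) :=
  tendsto_order.2 ⟨fun r hr => hp.eventually (hφ a r hr),
    fun _ hr => Filter.Eventually.of_forall fun n => (hle n).trans_lt hr⟩

/-- Lelek weights are determined, up to small continuous perturbations, by their minima. -/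
theorem IsLelek.nearHomeo (hφ : IsLelek φ) (hψ : IsLelek ψ) {p₀ : A} {q₀ : B}
    (hp : ∀ a, φ p₀ ≤ φ a) (hq : ∀ b, ψ q₀ ≤ ψ b) {ε : ℝ} (hε : 0 < ε) :
    NearHomeo (|ψ q₀ - φ p₀| + ε) φ ψ := by
  have := hφ.t2
  have := hψ.t2
  set η : ℕ → ℝ := fun n => ε / 2 / 2 ^ n
  have hη : ∀ n, 0 < η n := fun n => by positivity
  have moves : ∀ {p q p' q'} n, Moves (fun (p : A) (q : B) p' q' =>
      |(ψ q' - φ p') - (ψ q - φ p)| ≤ η n) p q p' q' → |(ψ q' - φ p') - (ψ q - φ p)| ≤ η n := by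
    rintro p q p' q' n (⟨rfl, rfl⟩ | ⟨-, -, h⟩)
    · simpa using (hη n).le
    · exact h
  obtain ⟨h, p, q, h0, hmov, hpa, hqa, tp, tq, hloc⟩ := exists_homeo_of_canMove hφ.compact
    hψ.compact hφ.basis hψ.basis (E := fun n p q p' q' => |(ψ q' - φ p') - (ψ q - φ p)| ≤ η n)
    (fun n => hψ.canMove (hη n)) (fun n => by
      have := hφ.canMove (φ := ψ) (hη n)
      intro q p q' V hV h1 h2
      obtain ⟨V', hV', hc, hq, p', hp', hmin, hE⟩ := this q p q' V hV h1 h2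
      refine ⟨V', hV', hc, hq, p', hp', hmin, ?_⟩
      change |(ψ q' - φ p') - (ψ q - φ p)| ≤ η n
      rwa [← abs_neg, show -((ψ q' - φ p') - (ψ q - φ p)) = (φ p' - ψ q') - (φ p - ψ q) by ring])
    hp hq (by
      intro p q _ _ _ _ hmov
      have hc : CauchySeq fun n => ψ (q n) - φ (p n) := by
        refine cauchySeq_of_le_geometric_two (C := ε) fun n => ?_
        rw [dist_comm, Real.dist_eq]
        exact moves n (hmov n)
      obtain ⟨R, hR⟩ := hc.isBounded_range.exists_norm_le
      have hR' : ∀ n, |ψ (q n) - φ (p n)| ≤ R := fun n => hR _ ⟨n, rfl⟩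
      constructor
      · rintro ⟨r, hr⟩
        refine ⟨r + R, ?_⟩
        rintro _ ⟨n, rfl⟩
        have h1 := (abs_le.1 (hR' n)).2
        have h2 : φ (p n) ≤ r := hr ⟨n, rfl⟩
        change ψ (q n) ≤ r + R
        linarith
      · rintro ⟨r, hr⟩
        refine ⟨r + R, ?_⟩
        rintro _ ⟨n, rfl⟩
        have h1 := (abs_le.1 (hR' n)).1
        have h2 : ψ (q n) ≤ r := hr ⟨n, rfl⟩
        change φ (p n) ≤ r + R
        linarith)
  have tend : ∀ a, Filter.Tendsto (fun n => ψ (q a n) - φ (p a n)) .atTop (𝓝 (ψ (h a) - φ a)) :=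
    fun a => (tendsto_of_le_of_lowerSemicontinuous hψ.lowerSemicontinuous (tq a) (hqa a)).sub
      (tendsto_of_le_of_lowerSemicontinuous hφ.lowerSemicontinuous (tp a) (hpa a))
  have hdist : ∀ a n, dist (ψ (q a n) - φ (p a n)) (ψ (q a (n + 1)) - φ (p a (n + 1))) ≤
      ε / 2 / 2 ^ n := by
    intro a n
    rw [dist_comm, Real.dist_eq]
    exact moves n (hmov a n)
  refine ⟨h, fun a => ?_, ?_⟩
  · have h1 := dist_le_of_le_geometric_two_of_tendsto₀ (hdist a) (tend a)
    simp only [(h0 a).1, (h0 a).2] at h1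
    rw [dist_comm, Real.dist_eq] at h1
    have h2 := abs_sub_abs_le_abs_sub (ψ (h a) - φ a) (ψ q₀ - φ p₀)
    linarith
  · have hu : TendstoUniformly (fun n a => ψ (q a n) - φ (p a n)) (fun a => ψ (h a) - φ a)
        .atTop := by
      rw [Metric.tendstoUniformly_iff]
      intro δ hδ
      have ht : Filter.Tendsto (fun n : ℕ => ε / 2 ^ n) .atTop (𝓝 0) :=
        tendsto_const_nhds.div_atTop (tendsto_pow_atTop_atTop_of_one_lt one_lt_two)
      filter_upwards [ht.eventually_lt_const hδ] with n hn a
      rw [dist_comm]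
      exact (dist_le_of_le_geometric_two_of_tendsto (hdist a) (tend a) n).trans_lt hn
    refine hu.continuous (Filter.Frequently.of_forall fun n => ?_)
    refine continuous_iff_continuousAt.2 fun a => ?_
    refine (continuousAt_const (y := ψ (q a n) - φ (p a n))).congr ?_
    filter_upwards [hloc a n] with a' ha'
    rw [ha'.1, ha'.2]

end Lelek

/-! ### Truncations of binary sequences -/

/-- Replace all terms from index `d` on by `false`. -/
def trunc (d : ℕ) (x : ℕ → Bool) : ℕ → Bool := fun n => if n < d then x n else false

theorem trunc_eq_iff {d : ℕ} {x y : ℕ → Bool} :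
    trunc d x = trunc d y ↔ ∀ i < d, x i = y i := by
  constructor
  · intro h i hi
    have := congrFun h i
    simpa [trunc, hi] using this
  · intro h
    funext i
    by_cases hi : i < d
    · simp [trunc, hi, h i hi]
    · simp [trunc, hi]

theorem trunc_trunc {d d' : ℕ} (h : d ≤ d') (x : ℕ → Bool) : trunc d (trunc d' x) = trunc d x :=
  trunc_eq_iff.2 fun i hi => by simp [trunc, hi.trans_le h]

theorem trunc_trunc_of_ge {d d' : ℕ} (h : d ≤ d') (x : ℕ → Bool) :
    trunc d' (trunc d x) = trunc d x := by
  funext i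
  by_cases hi : i < d
  · simp [trunc, hi, hi.trans_le h]
  · simp [trunc, hi]

theorem trunc_eq_of_le {d d' : ℕ} (h : d ≤ d') {x y : ℕ → Bool} (hxy : trunc d' x = trunc d' y) :
    trunc d x = trunc d y := by
  rw [← trunc_trunc h x, hxy, trunc_trunc h]

theorem trunc_succ_eq_iff {d : ℕ} {x y : ℕ → Bool} :
    trunc (d + 1) x = trunc (d + 1) y ↔ trunc d x = trunc d y ∧ x d = y d := by
  simp only [trunc_eq_iff]
  constructor
  · exact fun h => ⟨fun i hi => h i (by omega), h d (by omega)⟩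
  · rintro ⟨h1, h2⟩ i hi
    rcases Nat.lt_succ_iff_lt_or_eq.1 hi with h | rfl
    · exact h1 i h
    · exact h2

theorem hasBasis_nhds_trunc (x : ℕ → Bool) {O : Set (ℕ → Bool)} (hO : O ∈ 𝓝 x) :
    ∃ d, ∀ y, trunc d y = trunc d x → y ∈ O := by
  rw [nhds_pi, Filter.mem_pi] at hO
  obtain ⟨I, hI, t, ht, hsub⟩ := hO
  obtain ⟨N, hN⟩ := hI.bddAbove
  refine ⟨N + 1, fun y hy => hsub fun i hi => ?_⟩
  rw [trunc_eq_iff.1 hy i (Nat.lt_succ_of_le (hN hi))]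
  exact mem_of_mem_nhds (ht i)

theorem isLocallyConstant_trunc (d : ℕ) : IsLocallyConstant (trunc d) := by
  refine (IsLocallyConstant.iff_eventually_eq _).2 fun x => ?_
  have : ∀ᶠ y in 𝓝 x, ∀ i < d, y i = x i :=
    (Filter.eventually_all_finite (finite_lt_nat d)).2 fun i _ =>
      (continuous_apply i).continuousAt.eventually ((isOpen_discrete {x i}).mem_nhds rfl)
  filter_upwards [this] with y hy
  exact trunc_eq_iff.2 hy

open scoped Classical in
/-- The set of truncations of the members of a finite set. -/
def tr (d : ℕ) (F : Finset (ℕ → Bool)) : Finset (ℕ → Bool) := F.image (trunc d)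

theorem mem_tr {d : ℕ} {F : Finset (ℕ → Bool)} {t : ℕ → Bool} :
    t ∈ tr d F ↔ ∃ x ∈ F, trunc d x = t := by
  classical simp [tr]

theorem tr_tr {d d' : ℕ} (h : d ≤ d') (F : Finset (ℕ → Bool)) : tr d (tr d' F) = tr d F := by
  classical
  rw [tr, tr, tr, Finset.image_image]
  exact Finset.image_congr fun x _ => trunc_trunc h x

theorem tr_eq_of_le {d d' : ℕ} (h : d ≤ d') {F G : Finset (ℕ → Bool)} (hFG : tr d' F = tr d' G) :
    tr d F = tr d G := by
  rw [← tr_tr h F, hFG, tr_tr h]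

theorem card_tr_le (d : ℕ) (F : Finset (ℕ → Bool)) : (tr d F).card ≤ F.card := by
  classical exact Finset.card_image_le

theorem card_tr_mono (F : Finset (ℕ → Bool)) : Monotone fun d => (tr d F).card := by
  intro d d' h
  change (tr d F).card ≤ (tr d' F).card
  rw [← tr_tr h]
  exact card_tr_le _ _

theorem eventually_injOn_trunc (F : Finset (ℕ → Bool)) :
    ∀ᶠ D in Filter.atTop, InjOn (trunc D) (F : Set (ℕ → Bool)) := by
  have : ∀ᶠ D in Filter.atTop, ∀ x ∈ F, ∀ y ∈ F, trunc D x = trunc D y → x = y := by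
    refine (Filter.eventually_all_finset F).2 fun x _ => (Filter.eventually_all_finset F).2
      fun y _ => ?_
    by_cases h : x = y
    · exact .of_forall fun _ _ => h
    · obtain ⟨n, hn⟩ := Function.ne_iff.1 h
      filter_upwards [Filter.eventually_gt_atTop n] with D hD hxy
      exact absurd (trunc_eq_iff.1 hxy n hD) hn
  filter_upwards [this] with D hD x hx y hy hxy
  exact hD x hx y hy hxy

theorem card_tr_eq_iff {d : ℕ} {F : Finset (ℕ → Bool)} :
    (tr d F).card = F.card ↔ InjOn (trunc d) (F : Set (ℕ → Bool)) := by
  classical exact Finset.card_image_iff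

/-! ### Masses of cells -/

open scoped Classical in
/-- The mass that a finite set `F` gives to the level `d` cell of `x`: the mass of a cell is
divided evenly among those of its two halves that meet `F`. -/
def mass (F : Finset (ℕ → Bool)) : ℕ → (ℕ → Bool) → ℝ
  | 0, _ => 1
  | d + 1, x => mass F d x * if ∃ y ∈ F, trunc d y = trunc d x ∧ y d ≠ x d then 1 / 2 else 1

theorem mass_pos (F : Finset (ℕ → Bool)) (d : ℕ) (x : ℕ → Bool) : 0 < mass F d x := by
  induction d with
  | zero => simp [mass]
  | succ d ih =>
    rw [mass]
    split_ifs <;> linarith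

theorem mass_congr {F G : Finset (ℕ → Bool)} {x y : ℕ → Bool} (d : ℕ) (h : tr d F = tr d G)
    (hxy : trunc d x = trunc d y) : mass F d x = mass G d y := by
  induction d with
  | zero => rfl
  | succ d ih =>
    have hxy' := trunc_succ_eq_iff.1 hxy
    have aux : ∀ {F G : Finset (ℕ → Bool)} {x y : ℕ → Bool}, tr (d + 1) F = tr (d + 1) G →
        trunc (d + 1) x = trunc (d + 1) y → (∃ z ∈ F, trunc d z = trunc d x ∧ z d ≠ x d) →
        ∃ z ∈ G, trunc d z = trunc d y ∧ z d ≠ y d := by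
      rintro F G x y h hxy ⟨z, hz, h1, h2⟩
      have : trunc (d + 1) z ∈ tr (d + 1) G := h ▸ mem_tr.2 ⟨z, hz, rfl⟩
      obtain ⟨w, hw, hwz⟩ := mem_tr.1 this
      obtain ⟨h3, h4⟩ := trunc_succ_eq_iff.1 hwz
      obtain ⟨h5, h6⟩ := trunc_succ_eq_iff.1 hxy
      exact ⟨w, hw, h3.trans (h1.trans h5), by rwa [h4, ← h6]⟩
    rw [mass, mass, ih (tr_eq_of_le d.le_succ h) hxy'.1]
    congr 2
    exact propext ⟨aux h hxy, aux h.symm hxy.symm⟩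

theorem sum_mass_succ {F : Finset (ℕ → Bool)} {x : ℕ → Bool} (hx : x ∈ F) (d : ℕ) :
    open scoped Classical in
    ∑ s ∈ tr (d + 1) F with trunc d s = trunc d x, mass F (d + 1) s = mass F d x := by
  classical
  by_cases h : ∃ y ∈ F, trunc d y = trunc d x ∧ y d ≠ x d
  · obtain ⟨y, hy, hyx, hne⟩ := h
    have hset : (tr (d + 1) F).filter (fun s => trunc d s = trunc d x) =
        {trunc (d + 1) x, trunc (d + 1) y} := by
      ext s
      simp only [Finset.mem_filter, mem_tr, Finset.mem_insert, Finset.mem_singleton]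
      constructor
      · rintro ⟨⟨z, hz, rfl⟩, hs⟩
        rw [trunc_trunc d.le_succ] at hs
        by_cases hzd : z d = x d
        · exact .inl (trunc_succ_eq_iff.2 ⟨hs, hzd⟩)
        · refine .inr (trunc_succ_eq_iff.2 ⟨hs.trans hyx.symm, ?_⟩)
          cases h1 : z d <;> cases h2 : x d <;> cases h3 : y d <;> simp_all
      · rintro (rfl | rfl)
        · exact ⟨⟨x, hx, rfl⟩, trunc_trunc d.le_succ x⟩
        · exact ⟨⟨y, hy, rfl⟩, (trunc_trunc d.le_succ y).trans hyx⟩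
    have hne' : trunc (d + 1) x ≠ trunc (d + 1) y := fun h =>
      hne (trunc_succ_eq_iff.1 h).2.symm
    rw [hset, Finset.sum_pair hne',
      mass_congr (d + 1) rfl (trunc_trunc_of_ge le_rfl x),
      mass_congr (d + 1) rfl (trunc_trunc_of_ge le_rfl y), mass, mass,
      if_pos ⟨y, hy, hyx, hne⟩, if_pos ⟨x, hx, hyx.symm, hne.symm⟩, mass_congr d rfl hyx]
    ring
  · have hset : (tr (d + 1) F).filter (fun s => trunc d s = trunc d x) = {trunc (d + 1) x} := by
      ext s
      simp only [Finset.mem_filter, mem_tr, Finset.mem_singleton]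
      constructor
      · rintro ⟨⟨z, hz, rfl⟩, hs⟩
        rw [trunc_trunc d.le_succ] at hs
        refine trunc_succ_eq_iff.2 ⟨hs, by_contra fun hzd => h ⟨z, hz, hs, hzd⟩⟩
      · rintro rfl
        exact ⟨⟨x, hx, rfl⟩, trunc_trunc d.le_succ x⟩
    rw [hset, Finset.sum_singleton, mass_congr (d + 1) rfl (trunc_trunc_of_ge le_rfl x), mass,
      if_neg h, mul_one]

/-- Masses push forward along truncation. -/
theorem sum_mass_mul_succ (F : Finset (ℕ → Bool)) (d : ℕ) (f : (ℕ → Bool) → ℝ) :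
    ∑ s ∈ tr (d + 1) F, mass F (d + 1) s * f (trunc d s) = ∑ t ∈ tr d F, mass F d t * f t := by
  classical
  rw [← Finset.sum_fiberwise_of_maps_to (s := tr (d + 1) F) (t := tr d F) (g := trunc d)]
  · refine Finset.sum_congr rfl fun t ht => ?_
    obtain ⟨x, hx, rfl⟩ := mem_tr.1 ht
    rw [mass_congr d rfl (trunc_trunc_of_ge le_rfl x), ← sum_mass_succ hx, Finset.sum_mul]
    refine Finset.sum_congr rfl fun s hs => ?_
    rw [(Finset.mem_filter.1 hs).2]
  · intro s hs
    obtain ⟨x, hx, rfl⟩ := mem_tr.1 hs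
    exact mem_tr.2 ⟨x, hx, (trunc_trunc d.le_succ x).symm⟩

theorem sum_mass_mul {F : Finset (ℕ → Bool)} {d D : ℕ} (h : d ≤ D) (f : (ℕ → Bool) → ℝ) :
    ∑ s ∈ tr D F, mass F D s * f (trunc d s) = ∑ t ∈ tr d F, mass F d t * f t := by
  induction D, h using Nat.le_induction with
  | base =>
    refine Finset.sum_congr rfl fun t ht => ?_
    obtain ⟨x, hx, rfl⟩ := mem_tr.1 ht
    rw [trunc_trunc_of_ge le_rfl]
  | succ D hD ih =>
    rw [← ih, ← sum_mass_mul_succ F D fun t => f (trunc d t)]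
    refine Finset.sum_congr rfl fun s _ => ?_
    rw [trunc_trunc hD]

theorem sum_mass {F : Finset (ℕ → Bool)} (hF : F.Nonempty) (d : ℕ) :
    ∑ s ∈ tr d F, mass F d s = 1 := by
  have h := sum_mass_mul (F := F) (Nat.zero_le d) fun _ => 1
  simp only [mul_one] at h
  rw [h]
  obtain ⟨x, hx⟩ := hF
  have : tr 0 F = {trunc 0 x} := by
    ext s
    rw [mem_tr, Finset.mem_singleton]
    constructor
    · rintro ⟨y, -, rfl⟩
      exact trunc_eq_iff.2 fun i hi => by omega
    · rintro rfl
      exact ⟨x, hx, rfl⟩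
  simp [this, mass]

theorem mass_stable {F : Finset (ℕ → Bool)} {D d : ℕ} (hD : InjOn (trunc D) (F : Set (ℕ → Bool)))
    (h : D ≤ d) {x : ℕ → Bool} (hx : x ∈ F) : mass F d x = mass F D x := by
  induction d, h using Nat.le_induction with
  | base => rfl
  | succ d hd ih =>
    rw [mass, ih, if_neg, mul_one]
    rintro ⟨y, hy, h1, h2⟩
    exact h2 (by rw [hD hy hx (trunc_eq_of_le hd h1)])

theorem le_mass (F : Finset (ℕ → Bool)) (d : ℕ) {x : ℕ → Bool} (hx : x ∈ F) :
    (1 / 2 : ℝ) ^ (tr d F).card ≤ mass F d x := by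
  classical
  induction d with
  | zero =>
    rw [mass]
    exact pow_le_one₀ (by norm_num) (by norm_num)
  | succ d ih =>
    rw [mass]
    split_ifs with h
    · have hlt : (tr d F).card < (tr (d + 1) F).card := by
        refine lt_of_le_of_ne (card_tr_mono F d.le_succ) fun heq => ?_
        obtain ⟨y, hy, h1, h2⟩ := h
        rw [← tr_tr d.le_succ F, card_tr_eq_iff] at heq
        have := heq (Finset.mem_coe.2 (mem_tr.2 ⟨y, hy, rfl⟩))
          (Finset.mem_coe.2 (mem_tr.2 ⟨x, hx, rfl⟩))
          (by rw [trunc_trunc d.le_succ, trunc_trunc d.le_succ, h1])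
        exact h2 (trunc_succ_eq_iff.1 this).2
      calc (1 / 2 : ℝ) ^ (tr (d + 1) F).card ≤ (1 / 2) ^ ((tr d F).card + 1) :=
            pow_le_pow_of_le_one (by norm_num) (by norm_num) hlt
        _ = (1 / 2) ^ (tr d F).card * (1 / 2) := pow_succ _ _
        _ ≤ _ := mul_le_mul_of_nonneg_right ih (by norm_num)
    · rw [mul_one]
      exact (pow_le_pow_of_le_one (by norm_num) (by norm_num) (card_tr_mono F d.le_succ)).trans ih

/-- The mass of a single point of `F`. -/
def ptMass (F : Finset (ℕ → Bool)) (x : ℕ → Bool) : ℝ :=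
  mass F (eventually_injOn_trunc F).exists.choose x

theorem ptMass_eq {F : Finset (ℕ → Bool)} {D : ℕ} (hD : InjOn (trunc D) (F : Set (ℕ → Bool)))
    {x : ℕ → Bool} (hx : x ∈ F) : ptMass F x = mass F D x := by
  have h := (eventually_injOn_trunc F).exists.choose_spec
  rw [ptMass, ← mass_stable h (le_max_left _ D) hx, mass_stable hD (le_max_right _ _) hx]

theorem ptMass_pos (F : Finset (ℕ → Bool)) (x : ℕ → Bool) : 0 < ptMass F x := mass_pos _ _ _

theorem le_ptMass (F : Finset (ℕ → Bool)) {x : ℕ → Bool} (hx : x ∈ F) :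
    (1 / 2 : ℝ) ^ F.card ≤ ptMass F x :=
  (pow_le_pow_of_le_one (by norm_num) (by norm_num) (card_tr_le _ F)).trans (le_mass F _ hx)

theorem sum_ptMass_mul (F : Finset (ℕ → Bool)) (d : ℕ) (f : (ℕ → Bool) → ℝ) :
    ∑ x ∈ F, ptMass F x * f (trunc d x) = ∑ t ∈ tr d F, mass F d t * f t := by
  classical
  obtain ⟨D, hD, hd⟩ := ((eventually_injOn_trunc F).and (Filter.eventually_ge_atTop d)).exists
  rw [← sum_mass_mul hd, tr, Finset.sum_image hD]
  refine Finset.sum_congr rfl fun x hx => ?_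
  rw [ptMass_eq hD hx, trunc_trunc hd, mass_congr D rfl (trunc_trunc_of_ge le_rfl x)]

theorem sum_ptMass {F : Finset (ℕ → Bool)} (hF : F.Nonempty) : ∑ x ∈ F, ptMass F x = 1 := by
  have := sum_ptMass_mul F 0 fun _ => 1
  simp only [mul_one] at this
  rw [this, sum_mass hF]

/-- The average of `φ` over a finite set. -/
def avg (φ : (ℕ → Bool) → ℝ) (F : Finset (ℕ → Bool)) : ℝ := ∑ x ∈ F, ptMass F x * φ x

/-- If `F` is separated at level `d` and `G` has the same truncation, then the difference of the
averages is computed by moving the points of `G` to those of `F`. -/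
theorem avg_sub_avg (φ : (ℕ → Bool) → ℝ) {F G : Finset (ℕ → Bool)} {d : ℕ}
    (hF : InjOn (trunc d) (F : Set (ℕ → Bool))) (hFG : tr d G = tr d F)
    {π : (ℕ → Bool) → ℕ → Bool} (hπ : ∀ y ∈ G, π y ∈ F ∧ trunc d (π y) = trunc d y) :
    avg φ G - avg φ F = ∑ y ∈ G, ptMass G y * (φ y - φ (π y)) := by
  classical
  obtain ⟨g, hg⟩ : ∃ g : (ℕ → Bool) → ℕ → Bool, ∀ x ∈ F, g (trunc d x) = x :=
    ⟨Function.invFunOn (trunc d) F, fun x hx => hF.leftInvOn_invFunOn hx⟩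
  have h1 : avg φ F = ∑ y ∈ G, ptMass G y * φ (π y) := by
    have e1 := sum_ptMass_mul F d fun t => φ (g t)
    have e2 := sum_ptMass_mul G d fun t => φ (g t)
    have e3 : ∑ t ∈ tr d F, mass F d t * φ (g t) = ∑ t ∈ tr d G, mass G d t * φ (g t) := by
      rw [hFG]
      exact Finset.sum_congr rfl fun t _ => by rw [mass_congr d hFG rfl]
    have e0 : avg φ F = ∑ x ∈ F, ptMass F x * φ (g (trunc d x)) :=
      Finset.sum_congr rfl fun x hx => by rw [hg x hx]
    rw [e0, e1, e3, ← e2]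
    refine Finset.sum_congr rfl fun y hy => ?_
    rw [← (hπ y hy).2, hg _ (hπ y hy).1]
  rw [h1, avg, ← Finset.sum_sub_distrib]
  exact Finset.sum_congr rfl fun y _ => by ring

/-! ### The topology of finite subsets of the Cantor set -/

/-- Finite subsets of the Cantor set carry the topology generated by their truncations. -/
instance : TopologicalSpace (Finset (ℕ → Bool)) := ⨅ d, TopologicalSpace.induced (tr d) ⊥

theorem isLocallyConstant_tr (d : ℕ) : IsLocallyConstant (tr d) := by
  intro s
  exact (iInf_le (fun d => TopologicalSpace.induced (tr d) ⊥) d) _ ⟨s, trivial, rfl⟩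

theorem exists_tr_subset (F : Finset (ℕ → Bool)) {O : Set (Finset (ℕ → Bool))} (hO : O ∈ 𝓝 F) :
    ∃ d, ∀ G, tr d G = tr d F → G ∈ O := by
  rw [nhds_iInf, Filter.mem_iInf] at hO
  obtain ⟨I, hI, V, hV, rfl⟩ := hO
  obtain ⟨N, hN⟩ := hI.bddAbove
  refine ⟨N, fun G hG => mem_iInter.2 fun i => ?_⟩
  have h := hV i
  rw [@nhds_induced _ _ ⊥, Filter.mem_comap] at h
  obtain ⟨t, ht, hsub⟩ := h
  refine hsub ?_
  rw [mem_preimage, tr_eq_of_le (hN i.2) hG]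
  let _ : TopologicalSpace (Finset (ℕ → Bool)) := ⊥
  exact mem_of_mem_nhds ht

theorem continuousAt_finset {Y : Type*} [TopologicalSpace Y] {f : Y → Finset (ℕ → Bool)} {y : Y}
    (h : ∀ d, ∀ᶠ z in 𝓝 y, tr d (f z) = tr d (f y)) : ContinuousAt f y := by
  intro O hO
  obtain ⟨d, hd⟩ := exists_tr_subset _ hO
  exact Filter.mem_of_superset (h d) fun z hz => hd _ hz

theorem eventually_tr {Y : Type*} [TopologicalSpace Y] {f : Y → Finset (ℕ → Bool)} {y : Y}
    (h : ContinuousAt f y) (d : ℕ) : ∀ᶠ z in 𝓝 y, tr d (f z) = tr d (f y) :=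
  h.eventually ((isLocallyConstant_tr d).eventually_eq _)

/-! ### Symmetric products -/

theorem hypFn_eventually {k : ℕ} {X : Type*} [TopologicalSpace X] (A : HypFn k X) {U : X → Set X}
    (hU : ∀ x ∈ A.1, IsOpen (U x) ∧ x ∈ U x) :
    ∀ᶠ B : HypFn k X in 𝓝 A, (∀ y ∈ B.1, ∃ x ∈ A.1, y ∈ U x) ∧ ∀ x ∈ A.1, ∃ y ∈ B.1, y ∈ U x := by
  have hpre : ∀ S : Set (Set X), IsOpen[VietorisTop inferInstance] S →
      IsOpen {B : HypFn k X | B.1 ∈ S} := fun S h => ⟨S, h, rfl⟩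
  have h1 : IsOpen {B : HypFn k X | B.1 ⊆ ⋃ x ∈ A.1, U x} := by
    have : IsOpen[VietorisTop inferInstance] {F : Set X | F ⊆ ⋃ x ∈ A.1, U x} := by
      refine TopologicalSpace.isOpen_generateFrom_of_mem
        (Or.inl ⟨⋃ x ∈ A.1, U x, isOpen_biUnion fun x hx => (hU x hx).1, ?_, rfl⟩)
      obtain ⟨x, hx⟩ := A.2.1
      exact ⟨x, mem_biUnion hx (hU x hx).2⟩
    exact hpre _ this
  have h2 : ∀ x ∈ A.1, IsOpen {B : HypFn k X | (B.1 ∩ U x).Nonempty} := by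
    intro x hx
    have : IsOpen[VietorisTop inferInstance] {F : Set X | (F ∩ U x).Nonempty} :=
      TopologicalSpace.isOpen_generateFrom_of_mem
        (Or.inr ⟨U x, (hU x hx).1, ⟨x, (hU x hx).2⟩, rfl⟩)
    exact hpre _ this
  have h3 : ∀ᶠ B : HypFn k X in 𝓝 A, ∀ x ∈ A.1, (B.1 ∩ U x).Nonempty :=
    (Filter.eventually_all_finite A.2.2.1).2 fun x hx =>
      (h2 x hx).mem_nhds ⟨x, hx, (hU x hx).2⟩
  filter_upwards [h3, h1.mem_nhds fun x hx => mem_biUnion hx (hU x hx).2] with B hB hB'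
  refine ⟨fun y hy => ?_, fun x hx => ?_⟩
  · simpa using hB' hy
  · obtain ⟨y, h⟩ := hB x hx
    exact ⟨y, h⟩

theorem continuous_hypFn {k : ℕ} {X Y : Type*} [TopologicalSpace X]
    [TopologicalSpace Y] {f : Y → HypFn k X}
    (h : ∀ y, ∀ U : X → Set X, (∀ x ∈ (f y).1, IsOpen (U x) ∧ x ∈ U x) →
      ∀ᶠ z in 𝓝 y, (∀ w ∈ (f z).1, ∃ x ∈ (f y).1, w ∈ U x) ∧
        ∀ x ∈ (f y).1, ∃ w ∈ (f z).1, w ∈ U x) : Continuous f := by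
  refine continuous_induced_rng.2 (continuous_generateFrom_iff.2 ?_)
  rintro S (⟨U, hU, -, rfl⟩ | ⟨U, hU, -, rfl⟩)
  · refine isOpen_iff_mem_nhds.2 fun y hy => ?_
    filter_upwards [h y (fun _ => U) fun x hx => ⟨hU, hy hx⟩] with z hz w hw
    exact (hz.1 w hw).elim fun _ h => h.2
  · refine isOpen_iff_mem_nhds.2 fun y hy => ?_
    obtain ⟨x, hx, hxU⟩ := hy
    classical
    filter_upwards [h y (fun z => if z = x then U else univ) fun z hz => by
      by_cases hzx : z = x
      · subst hzx; simpa using ⟨hU, hxU⟩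
      · simp [hzx]] with z hz
    obtain ⟨w, hw, hwU⟩ := hz.2 x hx
    exact ⟨w, hw, by simpa using hwU⟩

/-- The map of symmetric products induced by a map. -/
def hypFnMap {k : ℕ} {X Y : Type*} [TopologicalSpace X] [TopologicalSpace Y] (f : X → Y)
    (A : HypFn k X) : HypFn k Y :=
  ⟨f '' A.1, A.2.1.image f, A.2.2.1.image f, (ncard_image_le A.2.2.1).trans A.2.2.2⟩

theorem continuous_hypFnMap {k : ℕ} {X Y : Type*} [TopologicalSpace X] [TopologicalSpace Y]
    {f : X → Y} (hf : Continuous f) : Continuous (hypFnMap (k := k) f) := by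
  refine continuous_hypFn fun A U hU => ?_
  filter_upwards [hypFn_eventually A (U := fun x => f ⁻¹' U (f x)) fun x hx =>
    ⟨(hU _ (mem_image_of_mem f hx)).1.preimage hf, (hU _ (mem_image_of_mem f hx)).2⟩] with B hB
  constructor
  · rintro _ ⟨w, hw, rfl⟩
    obtain ⟨x, hx, h⟩ := hB.1 w hw
    exact ⟨f x, mem_image_of_mem f hx, h⟩
  · rintro _ ⟨x, hx, rfl⟩
    obtain ⟨w, hw, h⟩ := hB.2 x hx
    exact ⟨f w, mem_image_of_mem f hw, h⟩

/-- A homeomorphism induces a homeomorphism of symmetric products. -/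
theorem nonempty_hypFn_congr (k : ℕ) {X Y : Type*} [TopologicalSpace X] [TopologicalSpace Y]
    (e : X ≃ₜ Y) : Nonempty (HypFn k X ≃ₜ HypFn k Y) :=
  ⟨⟨⟨hypFnMap e, hypFnMap e.symm, fun A => Subtype.ext (by simp [hypFnMap, image_image]),
    fun A => Subtype.ext (by simp [hypFnMap, image_image])⟩,
    continuous_hypFnMap e.continuous, continuous_hypFnMap e.symm.continuous⟩⟩

/-- The nonempty subsets of `C` with at most `k` points. -/
def InFam (C : Set (ℕ → Bool)) (k : ℕ) (F : Finset (ℕ → Bool)) : Prop :=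
  F.Nonempty ∧ F.card ≤ k ∧ ∀ x ∈ F, x ∈ C

theorem abs_avg_sub_avg_lt {φ : (ℕ → Bool) → ℝ} {F G : Finset (ℕ → Bool)} {d : ℕ} {ε : ℝ}
    (hG : G.Nonempty) (hF : InjOn (trunc d) (F : Set (ℕ → Bool))) (hFG : tr d G = tr d F)
    (h : ∀ y ∈ G, ∃ x ∈ F, trunc d x = trunc d y ∧ |φ y - φ x| ≤ ε) :
    |avg φ G - avg φ F| ≤ ε := by
  choose! π hπ using h
  rw [avg_sub_avg φ hF hFG fun y hy => ⟨(hπ y hy).1, (hπ y hy).2.1⟩]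
  calc _ ≤ ∑ y ∈ G, |ptMass G y * (φ y - φ (π y))| := Finset.abs_sum_le_sum_abs _ _
    _ ≤ ∑ y ∈ G, ptMass G y * ε := Finset.sum_le_sum fun y hy => by
        rw [abs_mul, abs_of_pos (ptMass_pos G y)]
        exact mul_le_mul_of_nonneg_left (hπ y hy).2.2 (ptMass_pos G y).le
    _ = ε := by rw [← Finset.sum_mul, sum_ptMass hG, one_mul]

theorem abs_sub_lt_of_avg {φ : (ℕ → Bool) → ℝ} {F G : Finset (ℕ → Bool)} {d k : ℕ} {η : ℝ}
    (hη : 0 < η) (hG : G.Nonempty) (hGk : G.card ≤ k)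
    (hF : InjOn (trunc d) (F : Set (ℕ → Bool))) (hFG : tr d G = tr d F)
    (hl : ∀ y ∈ G, ∀ x ∈ F, trunc d y = trunc d x → φ x - η ≤ φ y)
    (h : avg φ G - avg φ F < η) {y x : ℕ → Bool} (hy : y ∈ G) (hx : x ∈ F)
    (hyx : trunc d y = trunc d x) : |φ y - φ x| < 2 * 2 ^ k * η := by
  have hex : ∀ y ∈ G, ∃ x ∈ F, trunc d x = trunc d y := fun y hy => by
    have : trunc d y ∈ tr d F := hFG ▸ mem_tr.2 ⟨y, hy, rfl⟩
    exact mem_tr.1 this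
  choose! π hπ using hex
  have e := avg_sub_avg φ hF hFG hπ
  have hxy : π y = x := hF (hπ y hy).1 hx ((hπ y hy).2.trans hyx)
  have e2 : ∑ y ∈ G, ptMass G y * (φ y - φ (π y) + η) = avg φ G - avg φ F + η := by
    rw [e]
    simp only [mul_add, Finset.sum_add_distrib]
    rw [← Finset.sum_mul, sum_ptMass hG, one_mul]
  have h1 : ptMass G y * (φ y - φ (π y) + η) ≤ avg φ G - avg φ F + η := by
    rw [← e2]
    refine Finset.single_le_sum (f := fun y => ptMass G y * (φ y - φ (π y) + η)) (fun z hz => ?_) hy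
    have := hl z hz _ (hπ z hz).1 (hπ z hz).2.symm
    exact mul_nonneg (ptMass_pos G z).le (by linarith)
  rw [hxy] at h1
  have h0 := hl y hy x hx hyx
  have h2 : (1 / 2 : ℝ) ^ k ≤ ptMass G y :=
    (pow_le_pow_of_le_one (by norm_num) (by norm_num) hGk).trans (le_ptMass G hy)
  have h3 : (1 / 2 : ℝ) ^ k * (φ y - φ x + η) < 2 * η := by
    have := mul_le_mul_of_nonneg_right h2 (by linarith : 0 ≤ φ y - φ x + η)
    linarith
  have h4 : φ y - φ x + η < 2 ^ k * (2 * η) := by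
    have := mul_lt_mul_of_pos_left h3 (by positivity : (0 : ℝ) < 2 ^ k)
    rwa [← mul_assoc, ← mul_pow, mul_one_div_cancel two_ne_zero, one_pow, one_mul] at this
  have h5 : (1 : ℝ) ≤ 2 ^ k := one_le_pow₀ (by norm_num)
  rw [abs_lt]
  constructor <;> nlinarith

theorem nonempty_hypFn_homeomorph {X : Type*} [TopologicalSpace X] (k : ℕ) {C : Set (ℕ → Bool)}
    {φ : (ℕ → Bool) → ℝ} (hlsc : LowerSemicontinuous fun x : C => φ x) {g : X → ℕ → Bool}
    (hg : Function.Injective g) (hC : range g = C) (hind : IsInducing fun x => (g x, φ (g x))) :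
    Nonempty (HypFn k X ≃ₜ Graph fun F : {F // InFam C k F} => avg φ F.1) := by
  classical
  have hgc : Continuous g := continuous_fst.comp hind.continuous
  have hφc : Continuous fun x => φ (g x) := continuous_snd.comp hind.continuous
  have hfwd : ∀ A : HypFn k X, InFam C k (A.2.2.1.toFinset.image g) := fun A => by
    refine ⟨by simpa using A.2.1, ?_, ?_⟩
    · refine Finset.card_image_le.trans ?_
      rw [← ncard_eq_toFinset_card A.1 A.2.2.1]
      exact A.2.2.2
    · intro x hx
      rw [← hC]
      obtain ⟨z, -, rfl⟩ := Finset.mem_image.1 hx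
      exact mem_range_self z
  have himg : ∀ F, InFam C k F → g '' (g ⁻¹' (F : Set (ℕ → Bool))) = F := fun F hF => by
    rw [image_preimage_eq_iff, hC]
    exact hF.2.2
  have hbwd : ∀ F, InFam C k F → (g ⁻¹' (F : Set (ℕ → Bool))).Nonempty ∧
      (g ⁻¹' (F : Set (ℕ → Bool))).Finite ∧ (g ⁻¹' (F : Set (ℕ → Bool))).ncard ≤ k := by
    intro F hF
    refine ⟨?_, F.finite_toSet.preimage hg.injOn, ?_⟩
    · have : (F : Set (ℕ → Bool)).Nonempty := hF.1
      rw [← himg F hF] at this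
      exact this.of_image
    · rw [← ncard_image_of_injective _ hg, himg F hF, ncard_coe_finset]
      exact hF.2.1
  let fw : HypFn k X → Graph fun F : {F // InFam C k F} => avg φ F.1 :=
    fun A => ⟨(⟨_, hfwd A⟩, avg φ (A.2.2.1.toFinset.image g)), rfl⟩
  let bw : (Graph fun F : {F // InFam C k F} => avg φ F.1) → HypFn k X :=
    fun p => ⟨g ⁻¹' (p.1.1.1 : Set (ℕ → Bool)), hbwd _ p.1.1.2⟩
  have htr : ∀ (A : HypFn k X) d, ∀ᶠ B : HypFn k X in 𝓝 A,
      tr d (B.2.2.1.toFinset.image g) = tr d (A.2.2.1.toFinset.image g) := by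
    intro A d
    filter_upwards [hypFn_eventually A (U := fun x => {z | trunc d (g z) = trunc d (g x)})
      fun x _ => ⟨((isLocallyConstant_trunc d).comp_continuous hgc).isOpen_fiber _, rfl⟩] with B hB
    ext t
    simp only [mem_tr, Finset.mem_image, Finite.mem_toFinset]
    constructor
    · rintro ⟨_, ⟨w, hw, rfl⟩, rfl⟩
      obtain ⟨x, hx, h⟩ := hB.1 w hw
      exact ⟨_, ⟨x, hx, rfl⟩, h.symm⟩
    · rintro ⟨_, ⟨x, hx, rfl⟩, rfl⟩
      obtain ⟨w, hw, h⟩ := hB.2 x hx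
      exact ⟨_, ⟨w, hw, rfl⟩, h⟩
  refine ⟨⟨⟨fw, bw, fun A => ?_, fun p => ?_⟩, ?_, ?_⟩⟩
  · refine Subtype.ext ?_
    simp [fw, bw, preimage_image_eq _ hg]
  · refine Graph.ext (Subtype.ext (Finset.coe_injective ?_))
    simpa [fw, bw] using himg _ p.1.1.2
  · refine Continuous.subtype_mk (.prodMk (Continuous.subtype_mk ?_ _) ?_) _
    · exact continuous_iff_continuousAt.2 fun A => continuousAt_finset (htr A)
    · refine continuous_iff_continuousAt.2 fun A => Metric.tendsto_nhds.2 fun ε hε => ?_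
      obtain ⟨d, hd⟩ := (eventually_injOn_trunc (A.2.2.1.toFinset.image g)).exists
      filter_upwards [htr A d,
        hypFn_eventually A (U := fun x => {z | trunc d (g z) = trunc d (g x)} ∩
        {z | |φ (g z) - φ (g x)| < ε / 2}) fun x _ =>
        ⟨(((isLocallyConstant_trunc d).comp_continuous hgc).isOpen_fiber _).inter
          (isOpen_lt (hφc.sub continuous_const).abs continuous_const), rfl, by
            simpa using hε⟩] with B hB hB'
      refine lt_of_le_of_lt (abs_avg_sub_avg_lt (hfwd B).1 hd hB ?_) (half_lt_self hε)
      intro y hy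
      obtain ⟨w, hw, rfl⟩ := Finset.mem_image.1 hy
      obtain ⟨x, hx, h1, h2⟩ := hB'.1 w (by simpa using hw)
      exact ⟨g x, Finset.mem_image_of_mem g (by simpa using hx), h1.symm, (le_of_lt h2)⟩
  · refine continuous_hypFn fun p U hU => ?_
    obtain ⟨⟨⟨F, hF⟩, r⟩, hr⟩ := p
    have hr : r = avg φ F := hr
    subst hr
    have hnear : ∀ x ∈ F, ∃ d : ℕ, ∃ η > 0, ∀ z, trunc d (g z) = trunc d x →
        |φ (g z) - φ x| < η → ∀ w, g w = x → z ∈ U w := by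
      intro x hx
      obtain ⟨w, rfl⟩ : x ∈ range g := hC ▸ hF.2.2 x hx
      have hmem := (hU w hx).1.mem_nhds (hU w hx).2
      rw [hind.nhds_eq_comap, Filter.mem_comap] at hmem
      obtain ⟨t, ht, hsub⟩ := hmem
      rw [nhds_prod_eq] at ht
      obtain ⟨t1, ht1, t2, ht2, hts⟩ := Filter.mem_prod_iff.1 ht
      obtain ⟨d, hd⟩ := hasBasis_nhds_trunc _ ht1
      obtain ⟨η, hη, hball⟩ := Metric.mem_nhds_iff.1 ht2
      refine ⟨d, η, hη, fun z hz1 hz2 w' hw' => ?_⟩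
      rw [hg hw']
      exact hsub (hts ⟨hd _ hz1, hball hz2⟩)
    choose! d η hη hU' using hnear
    obtain ⟨η₀, hη₀, hη₀'⟩ : ∃ η₀ > 0, ∀ x ∈ F, 2 * 2 ^ k * η₀ ≤ η x := by
      obtain ⟨x₀, hx₀, hmin⟩ := F.exists_min_image η hF.1
      refine ⟨η x₀ / (2 * 2 ^ k), div_pos (hη x₀ hx₀) (by positivity), fun x hx => ?_⟩
      rw [mul_div_cancel₀ _ (by positivity)]
      exact hmin x hx
    have hlow : ∀ x ∈ F, ∃ D : ℕ, ∀ y ∈ C, trunc D y = trunc D x → φ x - η₀ ≤ φ y := by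
      intro x hx
      have h := hlsc ⟨x, hF.2.2 x hx⟩ (φ x - η₀) (by simpa using hη₀)
      rw [nhds_subtype_eq_comap, Filter.eventually_comap] at h
      obtain ⟨D, hD⟩ := hasBasis_nhds_trunc x h
      exact ⟨D, fun y hy hyx => (hD y hyx ⟨y, hy⟩ rfl).le⟩
    choose! D hD using hlow
    obtain ⟨N, hN, hNd, hND⟩ := ((eventually_injOn_trunc F).and
      ((((Filter.eventually_all_finset F).2 fun x _ => Filter.eventually_ge_atTop (d x))).and
      ((Filter.eventually_all_finset F).2 fun x _ => Filter.eventually_ge_atTop (D x)))).exists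
    have hc1 := eventually_tr ((continuous_subtype_val.comp (continuous_graph_fst
      fun F : {F // InFam C k F} => avg φ F.1)).continuousAt (x := ⟨(⟨F, hF⟩, avg φ F), hr⟩)) N
    have hc2 := Metric.tendsto_nhds.1 ((continuous_graph_weight
      fun F : {F // InFam C k F} => avg φ F.1).tendsto ⟨(⟨F, hF⟩, avg φ F), hr⟩) η₀ hη₀
    filter_upwards [hc1, hc2] with q hq1 hq2
    have hq1 : tr N q.1.1.1 = tr N F := hq1
    have hq2 : |avg φ q.1.1.1 - avg φ F| < η₀ := hq2
    have hmain : ∀ z, g z ∈ q.1.1.1 → ∀ w, g w ∈ F → trunc N (g z) = trunc N (g w) → z ∈ U w := by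
      intro z hz w hw hzw
      refine hU' _ hw z (trunc_eq_of_le (hNd _ hw) hzw) ?_ w rfl
      refine lt_of_lt_of_le (abs_sub_lt_of_avg hη₀ q.1.1.2.1 q.1.1.2.2.1 hN hq1 ?_
        (abs_lt.1 hq2).2 hz hw hzw) (hη₀' _ hw)
      intro y hy x hx hyx
      exact hD x hx y (q.1.1.2.2.2 y hy) (trunc_eq_of_le (hND _ hx) hyx)
    constructor
    · intro z hz
      have : trunc N (g z) ∈ tr N F := hq1 ▸ mem_tr.2 ⟨_, hz, rfl⟩
      obtain ⟨x, hx, hxz⟩ := mem_tr.1 this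
      obtain ⟨w, rfl⟩ : x ∈ range g := hC ▸ hF.2.2 x hx
      exact ⟨w, hx, hmain z hz w hx hxz.symm⟩
    · intro w hw
      have : trunc N (g w) ∈ tr N q.1.1.1 := hq1 ▸ mem_tr.2 ⟨_, hw, rfl⟩
      obtain ⟨x, hx, hxw⟩ := mem_tr.1 this
      obtain ⟨z, rfl⟩ : x ∈ range g := hC ▸ q.1.1.2.2.2 x hx
      exact ⟨z, hx, hmain z hx w hw hxw⟩

/-! ### Auxiliary homeomorphisms -/

/-- Splitting off the first coordinate. -/
def finSuccHomeo (n : ℕ) (X : Type*) [TopologicalSpace X] :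
    (Fin (n + 1) → X) ≃ₜ X × (Fin n → X) where
  toFun x := (x 0, fun i => x i.succ)
  invFun p := Fin.cons p.1 p.2
  left_inv x := by
    funext i
    refine Fin.cases rfl (fun i => rfl) i
  right_inv p := rfl
  continuous_toFun := by fun_prop
  continuous_invFun := by
    refine continuous_pi fun i => ?_
    refine Fin.cases ?_ (fun i => ?_) i
    · simpa using continuous_fst
    · exact (continuous_apply i).comp continuous_snd

/-- A subtype of a subtype is a subtype. -/
def subtypeSubtypeHomeo {A : Type*} [TopologicalSpace A] {p r : A → Prop} {q : {a // p a} → Prop}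
    (h : ∀ a, r a ↔ ∃ ha : p a, q ⟨a, ha⟩) : {x : {a // p a} // q x} ≃ₜ {a // r a} where
  toFun x := ⟨x.1.1, (h _).2 ⟨x.1.2, x.2⟩⟩
  invFun a := ⟨⟨a.1, ((h _).1 a.2).1⟩, ((h _).1 a.2).2⟩
  left_inv _ := rfl
  right_inv _ := rfl
  continuous_toFun := by fun_prop
  continuous_invFun := by fun_prop

theorem NearHomeo.subtype {A : Type*} [TopologicalSpace A] {p r : A → Prop}
    {q : {a // p a} → Prop} (φ : A → ℝ) (h : ∀ a, r a ↔ ∃ ha : p a, q ⟨a, ha⟩) :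
    NearHomeo 0 (fun x : {x : {a // p a} // q x} => φ x.1.1) (fun a : {a // r a} => φ a.1) :=
  .of_homeo (subtypeSubtypeHomeo h) fun _ => rfl

theorem NearHomeo.of_isEmpty {A B : Type*} [TopologicalSpace A] [TopologicalSpace B] [IsEmpty A]
    [IsEmpty B] (φ : A → ℝ) (ψ : B → ℝ) (ε : ℝ) : NearHomeo ε φ ψ :=
  ⟨.empty, fun a => isEmptyElim a, continuous_of_const fun a => isEmptyElim a⟩

theorem NearHomeo.pi {ι : Type*} [Fintype ι] {A B : ι → Type*} [∀ i, TopologicalSpace (A i)]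
    [∀ i, TopologicalSpace (B i)] {φ : ∀ i, A i → ℝ} {ψ : ∀ i, B i → ℝ} {ε : ι → ℝ}
    (h : ∀ i, NearHomeo (ε i) (φ i) (ψ i)) :
    NearHomeo (∑ i, ε i) (fun x : ∀ i, A i => ∑ i, φ i (x i))
      (fun y : ∀ i, B i => ∑ i, ψ i (y i)) := by
  choose e he hc using h
  refine ⟨.piCongrRight e, fun x => ?_, ?_⟩
  · change |∑ i, ψ i (e i (x i)) - ∑ i, φ i (x i)| ≤ _
    rw [← Finset.sum_sub_distrib]
    exact (Finset.abs_sum_le_sum_abs _ _).trans (Finset.sum_le_sum fun i _ => he i _)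
  · change Continuous fun x : ∀ i, A i => ∑ i, ψ i (e i (x i)) - ∑ i, φ i (x i)
    simp only [← Finset.sum_sub_distrib]
    exact continuous_finsetSum _ fun i _ => (hc i).comp (continuous_apply i)

theorem NearHomeo.prod_right {A B : Type*} [TopologicalSpace A] [TopologicalSpace B] {ε : ℝ}
    {φ : A → ℝ} {ψ : B → ℝ} (h : NearHomeo ε φ ψ) (K : Type*) [TopologicalSpace K] :
    NearHomeo ε (fun p : A × K => φ p.1) (fun p : B × K => ψ p.1) := by
  simpa using h.prod (NearHomeo.refl fun _ : K => (0 : ℝ))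

/-- A weight on a subset of the Cantor set that absorbs sums, countable compact factors and the
passage to cells, up to arbitrarily small errors. -/
structure GoodModel (C : Set (ℕ → Bool)) (φ : (ℕ → Bool) → ℝ) (e : ℕ → ℝ) : Prop where
  nonempty : C.Nonempty
  lsc : LowerSemicontinuous fun x : C => φ x
  add : ∀ α β ε : ℝ, 0 < α → 0 < β → 0 < ε →
    NearHomeo ε (fun p : C × C => α * φ p.1 + β * φ p.2) (fun x : C => (α + β) * φ x)
  prodK : ∀ (K : Type) [TopologicalSpace K] [CompactSpace K] [TopologicalSpace.MetrizableSpace K]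
    [Countable K] [Nonempty K] (ε : ℝ), 0 < ε →
    NearHomeo ε (fun p : C × K => φ p.1) (fun x : C => φ x)
  cell : ∀ (d : ℕ) (x : ℕ → Bool) (ε : ℝ), 0 < ε →
    NearHomeo ε (fun y : {y // y ∈ C ∧ trunc d y = trunc d x} => φ y)
      (fun y : C => φ y + φ (trunc d x))
  gap : ∀ d x, |φ (trunc (d + 1) x) - φ (trunc d x)| ≤ e d
  e_pos : ∀ d, 0 < e d
  e_anti : Antitone e
  e_lim : Filter.Tendsto e Filter.atTop (𝓝 0)

namespace GoodModel

variable {C : Set (ℕ → Bool)} {φ : (ℕ → Bool) → ℝ} {e : ℕ → ℝ}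

theorem pi_add (H : GoodModel C φ e) (n : ℕ) (w : Fin (n + 1) → ℝ) (hw : ∀ i, 0 < w i) {ε : ℝ}
    (hε : 0 < ε) : NearHomeo ε (fun x : Fin (n + 1) → C => ∑ i, w i * φ (x i))
      (fun x : C => (∑ i, w i) * φ x) := by
  induction n generalizing ε with
  | zero =>
    exact (NearHomeo.of_homeo (Homeomorph.funUnique (Fin 1) C) fun x => by simp).mono hε.le
  | succ n ih =>
    have h1 : NearHomeo 0 (fun x : Fin (n + 2) → C => ∑ i, w i * φ (x i))
        (fun p : C × (Fin (n + 1) → C) => w 0 * φ p.1 + ∑ i, w i.succ * φ (p.2 i)) :=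
      .of_homeo (finSuccHomeo (n + 1) C) fun x => by
        exact (Fin.sum_univ_succ fun i => w i * φ (x i)).symm
    have h2 := (NearHomeo.refl fun x : C => w 0 * φ x).prod
      (ih (fun i => w i.succ) (fun i => hw _) (half_pos hε))
    have h3 := H.add (w 0) (∑ i : Fin (n + 1), w i.succ) (ε / 2) (hw 0)
      (Finset.sum_pos (fun i _ => hw _) Finset.univ_nonempty) (half_pos hε)
    rw [← Fin.sum_univ_succ] at h3
    exact ((h1.trans h2).trans h3).mono (by linarith)

theorem cell_nonempty (H : GoodModel C φ e) (d : ℕ) (x : ℕ → Bool) :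
    ∃ y ∈ C, trunc d y = trunc d x := by
  obtain ⟨h, -⟩ := H.cell d x 1 one_pos
  obtain ⟨z, hz⟩ := H.nonempty
  exact ⟨_, (h.symm ⟨z, hz⟩).2⟩

end GoodModel

/-- The average of `φ` over the truncations of the points of a finite set. -/
def cellAvg (φ : (ℕ → Bool) → ℝ) (d : ℕ) (F : Finset (ℕ → Bool)) : ℝ :=
  ∑ t ∈ tr d F, mass F d t * φ t

theorem cellAvg_congr (φ : (ℕ → Bool) → ℝ) {d : ℕ} {F G : Finset (ℕ → Bool)}
    (h : tr d F = tr d G) : cellAvg φ d F = cellAvg φ d G := by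
  rw [cellAvg, cellAvg, h]
  exact Finset.sum_congr rfl fun t _ => by rw [mass_congr d h rfl]

theorem abs_cellAvg_succ_sub_le {C : Set (ℕ → Bool)} {φ : (ℕ → Bool) → ℝ} {e : ℕ → ℝ}
    (H : GoodModel C φ e) {F : Finset (ℕ → Bool)} (hF : F.Nonempty) (d : ℕ) :
    |cellAvg φ (d + 1) F - cellAvg φ d F| ≤ e d := by
  rw [cellAvg, cellAvg, ← sum_mass_mul_succ F d, ← Finset.sum_sub_distrib]
  calc _ ≤ ∑ s ∈ tr (d + 1) F, |mass F (d + 1) s * φ s - mass F (d + 1) s * φ (trunc d s)| :=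
        Finset.abs_sum_le_sum_abs _ _
    _ ≤ ∑ s ∈ tr (d + 1) F, mass F (d + 1) s * e d := Finset.sum_le_sum fun s hs => by
        obtain ⟨x, hx, rfl⟩ := mem_tr.1 hs
        rw [← mul_sub, abs_mul, abs_of_pos (mass_pos _ _ _), trunc_trunc d.le_succ]
        exact mul_le_mul_of_nonneg_left (H.gap d x) (mass_pos _ _ _).le
    _ = e d := by rw [← Finset.sum_mul, sum_mass hF, one_mul]

/-- The members of the family whose truncation is that of `F₀` and which have one point in each
cell. -/
def IsBase (C : Set (ℕ → Bool)) (k d : ℕ) (F₀ F : Finset (ℕ → Bool)) : Prop :=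
  InFam C k F ∧ tr d F = tr d F₀ ∧ F.card = (tr d F₀).card

theorem IsBase.injOn {C : Set (ℕ → Bool)} {k d : ℕ} {F₀ F : Finset (ℕ → Bool)}
    (h : IsBase C k d F₀ F) : InjOn (trunc d) (F : Set (ℕ → Bool)) :=
  card_tr_eq_iff.1 (by rw [h.2.1, h.2.2])

theorem nearHomeo_base {C : Set (ℕ → Bool)} {φ : (ℕ → Bool) → ℝ} {e : ℕ → ℝ}
    (H : GoodModel C φ e) {k : ℕ} {F₀ : Finset (ℕ → Bool)} (h₀ : InFam C k F₀) (d : ℕ) {ε : ℝ}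
    (hε : 0 < ε) : NearHomeo ε (fun F : {F // IsBase C k d F₀ F} => avg φ F.1)
      (fun x : C => φ x + cellAvg φ d F₀) := by
  classical
  have hne : (tr d F₀).Nonempty := h₀.1.image _
  obtain ⟨n, hn⟩ : ∃ n, (tr d F₀).card = n + 1 := ⟨_, (Nat.succ_pred_eq_of_pos hne.card_pos).symm⟩
  let τ : Fin (n + 1) ≃ tr d F₀ := ((tr d F₀).equivFinOfCardEq hn).symm
  let t : Fin (n + 1) → ℕ → Bool := fun i => (τ i).1
  have ht : ∀ i, t i ∈ tr d F₀ := fun i => (τ i).2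
  have htt : ∀ i, trunc d (t i) = t i := fun i => by
    obtain ⟨x, -, hx⟩ := mem_tr.1 (ht i)
    rw [← hx, trunc_trunc_of_ge le_rfl]
  have htinj : Function.Injective t := Subtype.val_injective.comp τ.injective
  have htsurj : ∀ s ∈ tr d F₀, ∃ i, t i = s := fun s hs => ⟨τ.symm ⟨s, hs⟩, by simp [t]⟩
  let Cell : Fin (n + 1) → Type := fun i => {y // y ∈ C ∧ trunc d y = trunc d (t i)}
  have hsum : ∀ f : (ℕ → Bool) → ℝ, ∑ s ∈ tr d F₀, f s = ∑ i, f (t i) := fun f => by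
    rw [← Finset.sum_coe_sort, ← τ.sum_comp]
  have hpick : ∀ (F : {F // IsBase C k d F₀ F}) (i), ∃ x ∈ F.1, trunc d x = t i := fun F i => by
    have := ht i
    rw [← F.2.2.1] at this
    exact mem_tr.1 this
  choose pick hpm hpt using hpick
  let fw : {F // IsBase C k d F₀ F} → ∀ i, Cell i := fun F i =>
    ⟨pick F i, F.2.1.2.2 _ (hpm F i), (hpt F i).trans (htt i).symm⟩
  have hbinj : ∀ x : ∀ i, Cell i, Function.Injective fun i => (x i).1 := fun x i j hij => by
    refine htinj ?_
    have h1 : trunc d (x i).1 = t i := (x i).2.2.trans (htt i)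
    have h2 : trunc d (x j).1 = t j := (x j).2.2.trans (htt j)
    exact h1.symm.trans ((congrArg (trunc d) hij).trans h2)
  have hb : ∀ x : ∀ i, Cell i, IsBase C k d F₀ (Finset.univ.image fun i => (x i).1) := by
    intro x
    have hcard : (Finset.univ.image fun i => (x i).1).card = (tr d F₀).card := by
      rw [Finset.card_image_of_injective _ (hbinj x), hn, Finset.card_univ, Fintype.card_fin]
    refine ⟨⟨Finset.univ_nonempty.image _, ?_, ?_⟩, ?_, hcard⟩
    · rw [hcard]
      exact (card_tr_le d F₀).trans h₀.2.1
    · intro y hy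
      obtain ⟨i, -, rfl⟩ := Finset.mem_image.1 hy
      exact (x i).2.1
    · ext s
      simp only [mem_tr, Finset.mem_image, Finset.mem_univ, true_and]
      constructor
      · rintro ⟨_, ⟨i, rfl⟩, rfl⟩
        rw [(x i).2.2, htt]
        exact mem_tr.1 (ht i)
      · intro h
        obtain ⟨i, rfl⟩ := htsurj s (mem_tr.2 h)
        exact ⟨_, ⟨i, rfl⟩, (x i).2.2.trans (htt i)⟩
  have himg : ∀ F : {F // IsBase C k d F₀ F}, Finset.univ.image (pick F) = F.1 := fun F => by
    refine Finset.eq_of_subset_of_card_le ?_ ?_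
    · intro y hy
      obtain ⟨i, -, rfl⟩ := Finset.mem_image.1 hy
      exact hpm F i
    · exact (F.2.2.2.trans (hb (fw F)).2.2.symm).le
  let h : {F // IsBase C k d F₀ F} ≃ₜ ∀ i, Cell i :=
    { toFun := fw
      invFun := fun x => ⟨_, hb x⟩
      left_inv := fun F => Subtype.ext (himg F)
      right_inv := fun x => by
        funext i
        refine Subtype.ext ((hb x).injOn (hpm ⟨_, hb x⟩ i)
          (Finset.mem_coe.2 (Finset.mem_image_of_mem _ (Finset.mem_univ i))) ?_)
        rw [(x i).2.2, htt]
        exact hpt _ i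
      continuous_toFun := by
        refine continuous_pi fun i => Continuous.subtype_mk ?_ _
        refine continuous_iff_continuousAt.2 fun F O hO => ?_
        obtain ⟨D, hD⟩ := hasBasis_nhds_trunc _ hO
        have h1 := eventually_tr (continuous_subtype_val.continuousAt (x := F)) (max d D)
        refine Filter.mem_map.2 (Filter.mem_of_superset h1 fun G hG => hD _ ?_)
        have hG : tr (max d D) G.1 = tr (max d D) F.1 := hG
        have : trunc (max d D) (pick G i) ∈ tr (max d D) F.1 := hG ▸ mem_tr.2 ⟨_, hpm G i, rfl⟩
        obtain ⟨y, hy, hyG⟩ := mem_tr.1 this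
        have hyF : y = pick F i := F.2.injOn hy (hpm F i) (by
          rw [hpt, ← hpt G, trunc_eq_of_le (le_max_left d D) hyG])
        rw [← hyF]
        exact trunc_eq_of_le (le_max_right d D) hyG.symm
      continuous_invFun := by
        refine Continuous.subtype_mk ?_ _
        refine continuous_iff_continuousAt.2 fun x => continuousAt_finset fun D => ?_
        have h1 : ∀ᶠ z in 𝓝 x, ∀ i, trunc D (z i).1 = trunc D (x i).1 :=
          Filter.eventually_all.2 fun i =>
            ((isLocallyConstant_trunc D).comp_continuous
              (continuous_subtype_val.comp (continuous_apply i))).eventually_eq x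
        filter_upwards [h1] with z hz
        rw [tr, tr, Finset.image_image, Finset.image_image]
        exact Finset.image_congr fun i _ => hz i }
  have e1 : NearHomeo 0 (fun F : {F // IsBase C k d F₀ F} => avg φ F.1)
      (fun x : ∀ i, Cell i => ∑ i, mass F₀ d (t i) * φ (x i).1) := by
    refine .of_homeo h fun F => ?_
    change ∑ i, mass F₀ d (t i) * φ (pick F i) = avg φ F.1
    have e2 : avg φ F.1 = ∑ x ∈ Finset.univ.image (pick F), ptMass F.1 x * φ x := by
      rw [himg F, avg]
    rw [e2, Finset.sum_image (hbinj (fw F)).injOn]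
    refine Finset.sum_congr rfl fun i _ => ?_
    rw [ptMass_eq F.2.injOn (hpm F i), mass_congr d F.2.2.1 ((hpt F i).trans (htt i).symm)]
  have hw : ∑ i, mass F₀ d (t i) = 1 := by rw [← hsum fun s => mass F₀ d s, sum_mass h₀.1]
  have e2 := NearHomeo.pi fun i => (H.cell d (t i) (ε / 2) (half_pos hε)).mul_const
    (mass_pos F₀ d (t i)).le
  rw [← Finset.sum_mul, hw, one_mul] at e2
  have e3 := (H.pi_add n (fun i => mass F₀ d (t i)) (fun i => mass_pos _ _ _)
    (half_pos hε)).add_const (cellAvg φ d F₀)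
  simp only [hw, one_mul] at e3
  have e4 : (fun y : Fin (n + 1) → C => ∑ i, mass F₀ d (t i) * (φ (y i) + φ (trunc d (t i)))) =
      fun y => ∑ i, mass F₀ d (t i) * φ (y i) + cellAvg φ d F₀ := by
    funext y
    rw [cellAvg, hsum, ← Finset.sum_add_distrib]
    exact Finset.sum_congr rfl fun i _ => by rw [htt, mul_add]
  rw [e4] at e2
  exact ((e1.trans e2).trans e3).mono (by linarith)

section Assemble

variable {C : Set (ℕ → Bool)} {φ : (ℕ → Bool) → ℝ} {k d : ℕ} {F₀ : Finset (ℕ → Bool)}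

/-- The members of the family whose truncation is that of `F₀`. -/
def InCell (C : Set (ℕ → Bool)) (k d : ℕ) (F₀ F : Finset (ℕ → Bool)) : Prop :=
  InFam C k F ∧ tr d F = tr d F₀

/-- The members of the cell of `F₀` for which some cell first splits at level `d + j`. -/
def SplitsAt (C : Set (ℕ → Bool)) (k d : ℕ) (F₀ : Finset (ℕ → Bool)) (j : ℕ)
    (F : Finset (ℕ → Bool)) : Prop :=
  InCell C k d F₀ F ∧ (tr (d + j) F).card = (tr d F₀).card ∧
    (tr d F₀).card < (tr (d + j + 1) F).card

theorem IsBase.inCell {F : Finset (ℕ → Bool)} (h : IsBase C k d F₀ F) : InCell C k d F₀ F :=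
  ⟨h.1, h.2.1⟩

theorem InCell.isBase_or_splitsAt {F : Finset (ℕ → Bool)} (h : InCell C k d F₀ F) :
    IsBase C k d F₀ F ∨ ∃ j, SplitsAt C k d F₀ j F := by
  by_cases hj : ∃ j, (tr d F₀).card < (tr (d + j + 1) F).card
  · right
    classical
    refine ⟨Nat.find hj, h, le_antisymm ?_ ?_, Nat.find_spec hj⟩
    · rcases hn : Nat.find hj with _ | m
      · rw [add_zero, h.2]
      · exact not_lt.1 (Nat.find_min hj (m := m) (by omega))
    · exact (congrArg Finset.card h.2).symm.le.trans (card_tr_mono F (Nat.le_add_right _ _))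
  · left
    push Not at hj
    refine ⟨h.1, h.2, le_antisymm ?_ ?_⟩
    · obtain ⟨D, hD⟩ := (eventually_injOn_trunc F).exists
      rw [← card_tr_eq_iff.2 hD]
      exact (card_tr_mono F (by omega : D ≤ d + D + 1)).trans (hj D)
    · rw [← h.2]
      exact card_tr_le d F

theorem SplitsAt.lt {F G : Finset (ℕ → Bool)} {i : ℕ} (hF : SplitsAt C k d F₀ i F)
    {D : ℕ} (hG : (tr D G).card = (tr d F₀).card) (h : tr D F = tr D G) : D ≤ d + i := by
  by_contra! hlt
  have := card_tr_mono F (Nat.succ_le_of_lt hlt)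
  have h2 := hF.2.2
  simp only [h, hG] at this
  exact absurd (h2.trans_le this) (lt_irrefl _)

theorem SplitsAt.unique {F : Finset (ℕ → Bool)} {i j : ℕ} (hi : SplitsAt C k d F₀ i F)
    (hj : SplitsAt C k d F₀ j F) : i = j := by
  have h1 := hi.lt hj.2.1 rfl
  have h2 := hj.lt hi.2.1 rfl
  omega

theorem SplitsAt.not_isBase {F : Finset (ℕ → Bool)} {i : ℕ} (hi : SplitsAt C k d F₀ i F) :
    ¬ IsBase C k d F₀ F := fun h => by
  have := hi.2.2.trans_le (card_tr_le _ F)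
  rw [h.2.2] at this
  exact lt_irrefl _ this

theorem nearHomeo_assemble {ε : ℕ → ℝ} {E : ℝ} (hE : ∀ j, ε j ≤ E) (hE₀ : 0 ≤ E)
    (hlim : Filter.Tendsto ε Filter.atTop (𝓝 0))
    (H : ∀ j, ∃ h : {F // SplitsAt C k d F₀ j F} ≃ₜ {F // IsBase C k d F₀ F},
      (∀ F, tr (d + j) (h F).1 = tr (d + j) F.1) ∧ (∀ F, |avg φ (h F).1 - avg φ F.1| ≤ ε j) ∧
        Continuous fun F => avg φ (h F).1 - avg φ F.1) :
    NearHomeo E (fun p : {F // IsBase C k d F₀ F} × ℕ∞ => avg φ p.1.1)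
      (fun F : {F // InCell C k d F₀ F} => avg φ F.1) := by
  choose h htr hle hcont using H
  let f₀ : {F // IsBase C k d F₀ F} → ℕ∞ → Finset (ℕ → Bool) := fun b n =>
    match n with
    | ⊤ => b.1
    | (j : ℕ) => ((h j).symm b).1
  have f₀_top : ∀ b, f₀ b ⊤ = b.1 := fun b => rfl
  have f₀_nat : ∀ b (j : ℕ), f₀ b j = ((h j).symm b).1 := fun b j => rfl
  have hf₀ : ∀ b n, InCell C k d F₀ (f₀ b n) := by
    intro b n
    induction n using ENat.recTopCoe with
    | top => exact b.2.inCell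
    | coe j => exact ((h j).symm b).2.1
  have htr₀ : ∀ b n (D : ℕ), (D : ℕ∞) ≤ n → tr D (f₀ b n) = tr D b.1 := by
    intro b n D hD
    induction n using ENat.recTopCoe with
    | top => rfl
    | coe j =>
      have := htr j ((h j).symm b)
      rw [Homeomorph.apply_symm_apply] at this
      rw [f₀_nat, tr_eq_of_le ((Nat.cast_le.1 hD).trans (Nat.le_add_left j d)) this]
  have hdiff : ∀ b (j : ℕ), |avg φ (f₀ b j) - avg φ b.1| ≤ ε j := by
    intro b j
    have := hle j ((h j).symm b)
    rwa [Homeomorph.apply_symm_apply, abs_sub_comm] at this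
  let f : {F // IsBase C k d F₀ F} × ℕ∞ → {F // InCell C k d F₀ F} := fun p => ⟨f₀ p.1 p.2, hf₀ _ _⟩
  have hinj : Function.Injective f := by
    rintro ⟨b, n⟩ ⟨b', n'⟩ heq
    have heq : f₀ b n = f₀ b' n' := congrArg Subtype.val heq
    induction n using ENat.recTopCoe with
    | top =>
      induction n' using ENat.recTopCoe with
      | top => exact Prod.ext (Subtype.ext heq) rfl
      | coe j' =>
        have := ((h j').symm b').2.not_isBase
        rw [← f₀_nat, ← heq] at this
        exact absurd b.2 this
    | coe j =>
      induction n' using ENat.recTopCoe with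
      | top =>
        have := ((h j).symm b).2.not_isBase
        rw [← f₀_nat, heq] at this
        exact absurd b'.2 this
      | coe j' =>
        have h1 := ((h j).symm b).2
        rw [← f₀_nat, heq, f₀_nat] at h1
        obtain rfl := h1.unique ((h j').symm b').2
        exact Prod.ext ((h j).symm.injective (Subtype.ext heq)) rfl
  have hsurj : Function.Surjective f := by
    rintro ⟨F, hF⟩
    rcases hF.isBase_or_splitsAt with hb | ⟨j, hj⟩
    · exact ⟨(⟨F, hb⟩, ⊤), rfl⟩
    · exact ⟨(h j ⟨F, hj⟩, j), Subtype.ext (by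
        change f₀ (h j ⟨F, hj⟩) j = F
        rw [f₀_nat, Homeomorph.symm_apply_apply])⟩
  have hnear : ∀ (j : ℕ) (b : {F // IsBase C k d F₀ F}),
      {p : {F // IsBase C k d F₀ F} × ℕ∞ | p.2 = j} ∈ 𝓝 (b, (j : ℕ∞)) := fun j b =>
    continuous_snd.continuousAt.preimage_mem_nhds
      ((ENat.isOpen_singleton (ENat.natCast_ne_top j)).mem_nhds (mem_singleton (j : ℕ∞)))
  have hlarge : ∀ (J : ℕ) (b : {F // IsBase C k d F₀ F}),
      ∀ᶠ p : {F // IsBase C k d F₀ F} × ℕ∞ in 𝓝 (b, ⊤), (J : ℕ∞) < p.2 := fun J b =>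
    continuous_snd.continuousAt.eventually (ENat.tendsto_nhds_top_iff_natCast_lt.1
      (Filter.tendsto_id (α := ℕ∞)) J)
  have hfc : Continuous f := by
    refine Continuous.subtype_mk ?_ _
    refine continuous_iff_continuousAt.2 ?_
    rintro ⟨b, n⟩
    induction n using ENat.recTopCoe with
    | top =>
      refine continuousAt_finset fun D => ?_
      filter_upwards [hlarge D b, eventually_tr ((continuous_subtype_val.comp
        continuous_fst).continuousAt (x := (b, (⊤ : ℕ∞)))) D] with p hp hp'
      exact (htr₀ _ _ _ hp.le).trans hp'
    | coe j =>
      have : ContinuousAt (fun p : {F // IsBase C k d F₀ F} × ℕ∞ => ((h j).symm p.1).1)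
          (b, (j : ℕ∞)) :=
        (continuous_subtype_val.comp ((h j).symm.continuous.comp continuous_fst)).continuousAt
      refine this.congr ?_
      filter_upwards [hnear j b] with p hp
      have hp : p.2 = j := hp
      rw [hp]
  let g : {F // IsBase C k d F₀ F} × ℕ∞ ≃ {F // InCell C k d F₀ F} :=
    Equiv.ofBijective f ⟨hinj, hsurj⟩
  have hgc : Continuous g.symm := by
    refine continuous_iff_continuousAt.2 fun F => ?_
    obtain ⟨⟨b, n⟩, rfl⟩ := g.surjective F
    induction n using ENat.recTopCoe with
    | top =>
      have key : ∀ D : ℕ, ∀ᶠ G in 𝓝 (g (b, ⊤)), (D : ℕ∞) ≤ (g.symm G).2 ∧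
          tr D (g.symm G).1.1 = tr D b.1 := by
        intro D
        filter_upwards [eventually_tr (continuous_subtype_val.continuousAt (x := g (b, ⊤))) (d + D)]
          with G hG
        obtain ⟨⟨b', n'⟩, rfl⟩ := g.surjective G
        rw [g.symm_apply_apply]
        have hG : tr (d + D) (f₀ b' n') = tr (d + D) b.1 := hG
        have hDn : (D : ℕ∞) ≤ n' := by
          induction n' using ENat.recTopCoe with
          | top => exact le_top
          | coe j =>
            have hcard : (tr (d + D) b.1).card = (tr d F₀).card := by
              refine le_antisymm ((card_tr_le _ _).trans b.2.2.2.le) ?_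
              rw [← b.2.2.1]
              exact card_tr_mono b.1 (Nat.le_add_right _ _)
            have := ((h j).symm b').2.lt hcard hG
            exact Nat.cast_le.2 (by omega)
        exact ⟨hDn, (htr₀ _ _ _ hDn).symm.trans (tr_eq_of_le (Nat.le_add_left D d) hG)⟩
      have h0 : g.symm (g (b, ⊤)) = (b, ⊤) := g.symm_apply_apply _
      refine ContinuousAt.prodMk (f := fun G => (g.symm G).1) (g := fun G => (g.symm G).2) ?_ ?_
      · refine IsInducing.subtypeVal.continuousAt_iff.2 (continuousAt_finset fun D => ?_)
        filter_upwards [key D] with G hG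
        change tr D (g.symm G).1.1 = tr D (g.symm (g (b, ⊤))).1.1
        rw [hG.2, h0]
      · rw [ContinuousAt, h0]
        refine ENat.tendsto_nhds_top_iff_natCast_lt.2 fun J => ?_
        filter_upwards [key (J + 1)] with G hG
        exact lt_of_lt_of_le (Nat.cast_lt.2 J.lt_succ_self) hG.1
    | coe j =>
      have hopen : {G : {F // InCell C k d F₀ F} | SplitsAt C k d F₀ j G.1} ∈
          𝓝 (g (b, (j : ℕ∞))) := by
        filter_upwards [eventually_tr (continuous_subtype_val.continuousAt (x := g (b, (j : ℕ∞))))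
          (d + j), eventually_tr (continuous_subtype_val.continuousAt (x := g (b, (j : ℕ∞))))
          (d + j + 1)] with G h1 h2
        refine ⟨G.2, ?_, ?_⟩
        · rw [h1]
          exact ((h j).symm b).2.2.1
        · rw [h2]
          exact ((h j).symm b).2.2.2
      have hc : ContinuousOn g.symm {G : {F // InCell C k d F₀ F} | SplitsAt C k d F₀ j G.1} := by
        rw [continuousOn_iff_continuous_domRestrict]
        have : Continuous fun G : {G : {F // InCell C k d F₀ F} | SplitsAt C k d F₀ j G.1} =>
            (h j ⟨G.1.1, G.2⟩, (j : ℕ∞)) := by fun_prop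
        refine this.congr fun G => ?_
        change _ = g.symm G.1
        rw [Equiv.eq_symm_apply]
        refine Subtype.ext ?_
        change f₀ (h j ⟨G.1.1, G.2⟩) j = G.1.1
        rw [f₀_nat, Homeomorph.symm_apply_apply]
      exact hc.continuousAt hopen
  refine ⟨⟨g, hfc, hgc⟩, fun p => ?_, ?_⟩
  · obtain ⟨b, n⟩ := p
    change |avg φ (f₀ b n) - avg φ b.1| ≤ E
    induction n using ENat.recTopCoe with
    | top => simpa [f₀_top] using hE₀
    | coe j => exact (hdiff b j).trans (hE j)
  · change Continuous fun p : {F // IsBase C k d F₀ F} × ℕ∞ => avg φ (f₀ p.1 p.2) - avg φ p.1.1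
    refine continuous_iff_continuousAt.2 ?_
    rintro ⟨b, n⟩
    induction n using ENat.recTopCoe with
    | top =>
      refine Metric.tendsto_nhds.2 fun δ hδ => ?_
      obtain ⟨J, hJ⟩ := Filter.eventually_atTop.1 (hlim.eventually (gt_mem_nhds hδ))
      filter_upwards [hlarge J b] with p hp
      obtain ⟨b', n'⟩ := p
      rw [f₀_top, sub_self, Real.dist_eq, sub_zero]
      induction n' using ENat.recTopCoe with
      | top => simpa [f₀_top] using hδ
      | coe j => exact (hdiff b' j).trans_lt (hJ j (Nat.cast_lt.1 hp).le)
    | coe j =>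
      have : ContinuousAt (fun p : {F // IsBase C k d F₀ F} × ℕ∞ =>
          -(avg φ (h j ((h j).symm p.1)).1 - avg φ ((h j).symm p.1).1)) (b, (j : ℕ∞)) :=
        ((hcont j).comp ((h j).symm.continuous.comp continuous_fst)).neg.continuousAt
      refine this.congr ?_
      filter_upwards [hnear j b] with p hp
      have hp : p.2 = j := hp
      rw [hp, f₀_nat, Homeomorph.apply_symm_apply, neg_sub]

end Assemble

section Recursion

variable {C : Set (ℕ → Bool)} {φ : (ℕ → Bool) → ℝ} {e : ℕ → ℝ} {k d : ℕ}
  {F₀ : Finset (ℕ → Bool)}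

theorem exists_tr_succ_card_lt (H : GoodModel C φ e) (h₀ : InFam C k F₀)
    (hlt : (tr d F₀).card < k) :
    ∃ G, InFam C k G ∧ tr d G = tr d F₀ ∧ (tr d F₀).card < (tr (d + 1) G).card := by
  classical
  obtain ⟨F, hF⟩ : ∃ F, IsBase C k d F₀ F := by
    obtain ⟨h, -⟩ := nearHomeo_base H h₀ d one_pos
    obtain ⟨z, hz⟩ := H.nonempty
    exact ⟨_, (h.symm ⟨z, hz⟩).2⟩
  obtain ⟨x, hx⟩ := hF.1.1
  obtain ⟨y, hyC, hy⟩ := H.cell_nonempty (d + 1) (Function.update x d (!x d))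
  have hy1 := trunc_succ_eq_iff.1 hy
  have hyx : trunc d y = trunc d x := by
    rw [hy1.1]
    exact trunc_eq_iff.2 fun i hi => Function.update_of_ne hi.ne _ _
  have hyd : y d = !x d := by simpa using hy1.2
  have himg : ∀ n, tr n (insert y F) = insert (trunc n y) (tr n F) := fun n =>
    Finset.image_insert _ _ _
  refine ⟨insert y F, ⟨⟨y, Finset.mem_insert_self _ _⟩, ?_, ?_⟩, ?_, ?_⟩
  · have := Finset.card_insert_le y F
    rw [hF.2.2] at this
    omega
  · intro z hz
    rcases Finset.mem_insert.1 hz with rfl | hz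
    · exact hyC
    · exact hF.1.2.2 z hz
  · rw [himg, ← hF.2.1]
    exact Finset.insert_eq_of_mem (mem_tr.2 ⟨x, hx, hyx.symm⟩)
  · rw [himg, Finset.card_insert_of_notMem, ← hF.2.1]
    · exact Nat.lt_succ_of_le (card_tr_mono F d.le_succ)
    · intro hmem
      obtain ⟨z, hz, hzy⟩ := mem_tr.1 hmem
      have h1 := trunc_succ_eq_iff.1 hzy
      have hzx : z = x := hF.injOn hz hx (h1.1.trans hyx)
      have h2 := h1.2
      rw [hzx, hyd] at h2
      simp at h2

theorem finite_tr_succ (σ : Finset (ℕ → Bool)) (d : ℕ) :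
    {τ | ∃ F, tr d F = σ ∧ tr (d + 1) F = τ}.Finite := by
  classical
  refine ((σ ∪ σ.image fun t => Function.update t d true).powerset.finite_toSet).subset ?_
  rintro τ ⟨F, hF, rfl⟩
  refine Finset.mem_coe.2 (Finset.mem_powerset.2 fun s hs => ?_)
  obtain ⟨x, hx, rfl⟩ := mem_tr.1 hs
  have hmem : trunc d x ∈ σ := hF ▸ mem_tr.2 ⟨x, hx, rfl⟩
  cases hxd : x d with
  | false =>
    refine Finset.mem_union_left _ ?_
    convert hmem using 1
    funext i
    rcases lt_trichotomy i d with h | rfl | h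
    · simp [trunc, h, h.trans d.lt_succ_self]
    · simp [trunc, hxd]
    · simp [trunc, h.not_gt, (Nat.succ_le_of_lt h).not_gt]
  | true =>
    refine Finset.mem_union_right _ (Finset.mem_image.2 ⟨_, hmem, ?_⟩)
    funext i
    rcases lt_trichotomy i d with h | rfl | h
    · simp [trunc, h, h.trans d.lt_succ_self, Function.update_of_ne h.ne]
    · simp [trunc, hxd]
    · simp [trunc, h.not_gt, (Nat.succ_le_of_lt h).not_gt, Function.update_of_ne h.ne']

theorem nearHomeo_splitsAt_zero (H : GoodModel C φ e) (h₀ : InFam C k F₀)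
    (hlt : (tr d F₀).card < k) {M : ℝ} (hM : 0 ≤ M)
    (ih : ∀ G, InFam C k G → (tr d F₀).card < (tr (d + 1) G).card →
      NearHomeo (M * e (d + 1)) (fun F : {F // InCell C k (d + 1) G F} => avg φ F.1)
        (fun x : C => φ x + cellAvg φ (d + 1) G)) :
    NearHomeo ((M + 2) * e d) (fun F : {F // SplitsAt C k d F₀ 0 F} => avg φ F.1)
      (fun x : C => φ x + cellAvg φ d F₀) := by
  let T : Set (Finset (ℕ → Bool)) := {τ | ∃ F, SplitsAt C k d F₀ 0 F ∧ tr (d + 1) F = τ}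
  have hT : T.Finite := (finite_tr_succ (tr d F₀) d).subset fun τ ⟨F, hF, hτ⟩ => ⟨F, hF.1.2, hτ⟩
  have hsplit : ∀ G, InFam C k G → tr d G = tr d F₀ → (tr d F₀).card < (tr (d + 1) G).card →
      SplitsAt C k d F₀ 0 G := fun G h1 h2 h3 => ⟨⟨h1, h2⟩, congrArg Finset.card h2, h3⟩
  obtain ⟨n, ⟨τ⟩⟩ : ∃ n, Nonempty (T ≃ Fin n) := by
    have : Finite T := hT
    exact Finite.exists_equiv_fin T
  have hn : Nonempty (Fin n) := by
    obtain ⟨G, h1, h2, h3⟩ := exists_tr_succ_card_lt H h₀ hlt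
    exact ⟨τ ⟨_, G, hsplit G h1 h2 h3, rfl⟩⟩
  let p : {F // SplitsAt C k d F₀ 0 F} → Fin n := fun F => τ ⟨tr (d + 1) F.1, F.1, F.2, rfl⟩
  have hp : IsLocallyConstant p := by
    refine (IsLocallyConstant.iff_eventually_eq _).2 fun F => ?_
    filter_upwards [eventually_tr (continuous_subtype_val.continuousAt (x := F)) (d + 1)] with G hG
    exact congrArg τ (Subtype.ext hG)
  have hq : IsLocallyConstant (Prod.snd : C × Fin n → Fin n) :=
    (IsLocallyConstant.iff_continuous _).2 continuous_snd
  have h1 : NearHomeo (M * e (d + 1) + e d)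
      (fun F : {F // SplitsAt C k d F₀ 0 F} => avg φ F.1)
      (fun x : C × Fin n => φ x.1 + cellAvg φ d F₀) := by
    refine NearHomeo.glue hp hq fun i => ?_
    obtain ⟨G, hG, hGi⟩ := (τ.symm i).2
    have e1 := NearHomeo.subtype (r := InCell C k (d + 1) G) (q := fun F => p F = i) (avg φ)
      fun F => by
        constructor
        · intro hF
          have hd : tr d F = tr d F₀ := (tr_eq_of_le d.le_succ hF.2).trans hG.1.2
          refine ⟨hsplit F hF.1 hd ?_, ?_⟩
          · rw [hF.2]
            exact hG.2.2
          · change τ _ = i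
            rw [← Equiv.eq_symm_apply]
            exact Subtype.ext (hF.2.trans hGi)
        · rintro ⟨hF, hpF⟩
          refine ⟨hF.1.1, ?_⟩
          have hpF : τ ⟨tr (d + 1) F, F, hF, rfl⟩ = i := hpF
          rw [← Equiv.eq_symm_apply] at hpF
          exact (congrArg Subtype.val hpF).trans hGi.symm
    have e2 := ih G hG.1.1 hG.2.2
    have e3 : NearHomeo (e d) (fun x : C => φ x + cellAvg φ (d + 1) G)
        (fun x : C => φ x + cellAvg φ d F₀) := by
      refine NearHomeo.shift _ ?_
      rw [← cellAvg_congr φ hG.1.2, abs_sub_comm]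
      exact abs_cellAvg_succ_sub_le H hG.1.1.1 d
    have e4 : NearHomeo 0 (fun x : C => φ x + cellAvg φ d F₀)
        (fun x : {x : C × Fin n // x.2 = i} => φ x.1.1 + cellAvg φ d F₀) := by
      refine .of_homeo ⟨⟨fun x => ⟨(x, i), rfl⟩, fun x => x.1.1, fun x => rfl, ?_⟩, ?_, ?_⟩
        fun x => rfl
      · rintro ⟨⟨x, j⟩, rfl⟩
        rfl
      · exact Continuous.subtype_mk (by fun_prop) _
      · exact continuous_fst.comp continuous_subtype_val
    exact (((e1.trans e2).trans e3).trans e4).mono (by linarith)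
  refine (h1.trans ((H.prodK (Fin n) (e d) (H.e_pos d)).add_const (cellAvg φ d F₀))).mono ?_
  have := mul_le_mul_of_nonneg_left (H.e_anti d.le_succ) hM
  simp only [Nat.succ_eq_add_one] at this
  linarith

theorem nearHomeo_inCell_of_le (H : GoodModel C φ e) (h₀ : InFam C k F₀)
    (hle : k ≤ (tr d F₀).card) :
    NearHomeo (e d) (fun F : {F // InCell C k d F₀ F} => avg φ F.1)
      (fun x : C => φ x + cellAvg φ d F₀) := by
  have : InCell C k d F₀ = IsBase C k d F₀ := by
    funext F
    refine propext ⟨fun h => ⟨h.1, h.2, le_antisymm (h.1.2.1.trans hle) ?_⟩, fun h => h.inCell⟩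
    rw [← h.2]
    exact card_tr_le d F
  rw [this]
  exact nearHomeo_base H h₀ d (H.e_pos d)

theorem exists_nearHomeo_inCell (H : GoodModel C φ e) (k N : ℕ) :
    ∃ M : ℝ, 0 ≤ M ∧ ∀ d F₀, InFam C k F₀ → k ≤ (tr d F₀).card + N →
      NearHomeo (M * e d) (fun F : {F // InCell C k d F₀ F} => avg φ F.1)
        (fun x : C => φ x + cellAvg φ d F₀) := by
  induction N with
  | zero =>
    refine ⟨1, zero_le_one, fun d F₀ h₀ hle => ?_⟩
    rw [one_mul]
    exact nearHomeo_inCell_of_le H h₀ hle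
  | succ N ih =>
    obtain ⟨M, hM, ih⟩ := ih
    refine ⟨M + 5, by linarith, fun d F₀ h₀ hle => ?_⟩
    by_cases hlt : (tr d F₀).card < k
    swap
    · have := H.e_pos d
      exact (nearHomeo_inCell_of_le H h₀ (not_lt.1 hlt)).mono (by nlinarith)
    have hsplit : ∀ j, ∃ h : {F // SplitsAt C k d F₀ j F} ≃ₜ {F // IsBase C k d F₀ F},
        (∀ F, tr (d + j) (h F).1 = tr (d + j) F.1) ∧
        (∀ F, |avg φ (h F).1 - avg φ F.1| ≤ (M + 3) * e (d + j)) ∧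
        Continuous fun F => avg φ (h F).1 - avg φ F.1 := by
      intro j
      refine NearHomeo.exists_glue (φ := fun F : {F // SplitsAt C k d F₀ j F} => avg φ F.1)
        (ψ := fun F : {F // IsBase C k d F₀ F} => avg φ F.1)
        (p := fun F : {F // SplitsAt C k d F₀ j F} => tr (d + j) F.1)
        (q := fun F : {F // IsBase C k d F₀ F} => tr (d + j) F.1)
        ((isLocallyConstant_tr _).comp_continuous continuous_subtype_val)
        ((isLocallyConstant_tr _).comp_continuous continuous_subtype_val) fun σ => ?_
      have hdj : d ≤ d + j := Nat.le_add_right d j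
      by_cases hσ : ∃ G, InCell C k d F₀ G ∧ (tr (d + j) G).card = (tr d F₀).card ∧
          tr (d + j) G = σ
      · obtain ⟨G, hG, hGc, rfl⟩ := hσ
        have e1 := NearHomeo.subtype (p := SplitsAt C k d F₀ j) (r := SplitsAt C k (d + j) G 0)
          (q := fun F => tr (d + j) F.1 = tr (d + j) G) (avg φ) fun F => by
            constructor
            · intro hF
              refine ⟨⟨⟨hF.1.1, (tr_eq_of_le hdj hF.1.2).trans hG.2⟩, ?_, ?_⟩, hF.1.2⟩
              · rw [hF.1.2, hGc]
              · rw [← hGc]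
                exact hF.2.2
            · rintro ⟨hF, hFG⟩
              refine ⟨⟨hF.1.1, hFG⟩, congrArg Finset.card hFG, ?_⟩
              rw [hGc]
              exact hF.2.2
        have e2 := NearHomeo.subtype (p := IsBase C k d F₀) (r := IsBase C k (d + j) G)
          (q := fun F => tr (d + j) F.1 = tr (d + j) G) (avg φ) fun F => by
            constructor
            · intro hF
              exact ⟨⟨hF.1, (tr_eq_of_le hdj hF.2.1).trans hG.2, hF.2.2.trans hGc⟩, hF.2.1⟩
            · rintro ⟨hF, hFG⟩
              exact ⟨hF.1, hFG, hF.2.2.trans hGc.symm⟩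
        have e3 := nearHomeo_splitsAt_zero (d := d + j) H hG.1 (hGc ▸ hlt) hM fun G' hG' hc =>
          ih (d + j + 1) G' hG' (by omega)
        have e4 := nearHomeo_base H hG.1 (d + j) (H.e_pos (d + j))
        exact (((e1.trans e3).trans e4.symm).trans e2.symm).mono (by linarith)
      · have i1 : IsEmpty {F : {F // SplitsAt C k d F₀ j F} // tr (d + j) F.1 = σ} :=
          ⟨fun F => hσ ⟨F.1.1, F.1.2.1, F.1.2.2.1, F.2⟩⟩
        have i2 : IsEmpty {F : {F // IsBase C k d F₀ F} // tr (d + j) F.1 = σ} := by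
          refine ⟨fun F => hσ ⟨F.1.1, F.1.2.inCell, le_antisymm ?_ ?_, F.2⟩⟩
          · exact (card_tr_le _ _).trans F.1.2.2.2.le
          · rw [← F.1.2.2.1]
            exact card_tr_mono _ hdj
        exact NearHomeo.of_isEmpty _ _ _
    have h1 := nearHomeo_assemble (ε := fun j => (M + 3) * e (d + j)) (E := (M + 3) * e d)
      (fun j => mul_le_mul_of_nonneg_left (H.e_anti (Nat.le_add_right d j)) (by linarith))
      (mul_nonneg (by linarith) (H.e_pos d).le) (by
        have : Filter.Tendsto (fun j => e (d + j)) Filter.atTop (𝓝 0) := by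
          simpa [add_comm] using (Filter.tendsto_add_atTop_iff_nat d).2 H.e_lim
        simpa using this.const_mul (M + 3)) hsplit
    have h2 := (nearHomeo_base H h₀ d (H.e_pos d)).prod_right ℕ∞
    have h3 := (H.prodK ℕ∞ (e d) (H.e_pos d)).add_const (cellAvg φ d F₀)
    exact ((h1.symm.trans h2).trans h3).mono (by linarith)

theorem GoodModel.nonempty_graph_avg (H : GoodModel C φ e) (hk : 1 ≤ k) :
    Nonempty ((Graph fun F : {F // InFam C k F} => avg φ F.1) ≃ₜ Graph fun x : C => φ x) := by
  obtain ⟨x, hx⟩ := H.nonempty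
  have h₀ : InFam C k {x} := ⟨⟨x, by simp⟩, by simpa using hk, by simpa using hx⟩
  have hF : InFam C k = InCell C k 0 {x} := by
    funext F
    refine propext ⟨fun h => ⟨h, ?_⟩, fun h => h.1⟩
    ext s
    simp only [mem_tr, Finset.mem_singleton, exists_eq_left]
    have ht : ∀ y, trunc 0 y = trunc 0 x := fun y => trunc_eq_iff.2 fun i hi => by omega
    constructor
    · rintro ⟨y, -, rfl⟩
      exact (ht y).symm
    · rintro rfl
      obtain ⟨y, hy⟩ := h.1
      exact ⟨y, hy, ht y⟩
  rw [hF]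
  obtain ⟨M, -, hM⟩ := exists_nearHomeo_inCell H k k
  have h1 := hM 0 {x} h₀ (Nat.le_add_left _ _)
  have h2 := NearHomeo.shift (fun x : C => φ x) (c := cellAvg φ 0 {x}) (c' := 0) le_rfl
  simp only [add_zero] at h2
  exact (h1.trans h2).graph

theorem GoodModel.nonempty_pi_graph (H : GoodModel C φ e) (n : ℕ) :
    Nonempty ((Fin (n + 1) → Graph fun x : C => φ x) ≃ₜ Graph fun x : C => φ x) := by
  induction n with
  | zero => exact ⟨Homeomorph.funUnique (Fin 1) _⟩
  | succ n ih =>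
    obtain ⟨h1⟩ := ih
    obtain ⟨h2⟩ := graph_prod H.lsc H.lsc
    have h3 := H.add 1 1 1 one_pos one_pos one_pos
    simp only [one_mul] at h3
    obtain ⟨h4⟩ := h3.graph
    obtain ⟨h5⟩ := graph_const_mul (fun x : C => φ x) (c := 1 + 1) (by norm_num)
    exact ⟨(finSuccHomeo (n + 1) _).trans
      ((((Homeomorph.refl _).prodCongr h1).trans h2).trans (h4.trans h5))⟩

/-- Powers and symmetric products of the space determined by a good model agree. -/
theorem GoodModel.nonempty_pi_homeomorph_hypFn (H : GoodModel C φ e) (hk : 1 ≤ k) {X : Type*}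
    [TopologicalSpace X] (hX : Nonempty (X ≃ₜ Graph fun x : C => φ x)) :
    Nonempty ((Fin k → X) ≃ₜ HypFn k X) := by
  obtain ⟨h⟩ := hX
  obtain ⟨n, rfl⟩ : ∃ n, k = n + 1 := ⟨k - 1, by omega⟩
  obtain ⟨h1⟩ := H.nonempty_pi_graph n
  obtain ⟨h2⟩ := H.nonempty_graph_avg hk
  obtain ⟨h3⟩ := nonempty_hypFn_homeomorph (n + 1) (C := C) (φ := φ) H.lsc
    (g := fun p : Graph fun x : C => φ x => (p.1.1 : ℕ → Bool))
    (fun p q hpq => Graph.ext (Subtype.ext hpq))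
    (by
      ext x
      constructor
      · rintro ⟨p, rfl⟩
        exact p.1.1.2
      · intro hx
        exact ⟨⟨(⟨x, hx⟩, φ x), rfl⟩, rfl⟩)
    (by
      have : IsInducing fun p : Graph fun x : C => φ x => ((p.1.1 : ℕ → Bool), p.1.2) :=
        (IsInducing.subtypeVal.prodMap IsInducing.id).comp IsInducing.subtypeVal
      convert this using 2 with p
      exact Prod.ext rfl p.2.symm)
  obtain ⟨h4⟩ := nonempty_hypFn_congr (n + 1) h
  exact ⟨((Homeomorph.piCongrRight fun _ => h).trans h1).trans
    ((h4.trans h3).trans h2).symm⟩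

end Recursion

/-! ### Spaces of summable sequences -/

/-- Sequences in `P` along which the weights `c i` are summable. -/
def RowSum {P : Type*} (c : ℕ → P → ℝ) : Type _ := {x : ℕ → P // Summable fun i => c i (x i)}

instance {P : Type*} [TopologicalSpace P] (c : ℕ → P → ℝ) : TopologicalSpace (RowSum c) :=
  inferInstanceAs (TopologicalSpace {x : ℕ → P // Summable fun i => c i (x i)})

/-- The total weight of a sequence. -/
def rowWeight {P : Type*} (c : ℕ → P → ℝ) (x : RowSum c) : ℝ := ∑' i, c i (x.1 i)

theorem continuous_rowSum_apply {P : Type*} [TopologicalSpace P] (c : ℕ → P → ℝ) (i : ℕ) :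
    Continuous fun x : RowSum c => x.1 i :=
  (continuous_apply i).comp continuous_subtype_val

theorem continuous_rowSum_mk {P A : Type*} [TopologicalSpace P] [TopologicalSpace A]
    {c : ℕ → P → ℝ} {f : A → ℕ → P} (hf : ∀ i, Continuous fun a => f a i)
    (hs : ∀ a, Summable fun i => c i (f a i)) : Continuous fun a => (⟨f a, hs a⟩ : RowSum c) :=
  Continuous.subtype_mk (continuous_pi hf) _

theorem lowerSemicontinuous_rowWeight {P : Type*} [TopologicalSpace P] {c : ℕ → P → ℝ}
    (h0 : ∀ i p, 0 ≤ c i p) (hc : ∀ i, LowerSemicontinuous (c i)) :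
    LowerSemicontinuous (rowWeight c) := by
  intro x y hy
  have hy' : y < rowWeight c x := hy
  obtain ⟨N, hN⟩ := (x.2.hasSum.tendsto_sum_nat.eventually_const_lt hy').exists
  have hl : LowerSemicontinuous fun z : RowSum c => ∑ i ∈ Finset.range N, c i (z.1 i) :=
    lowerSemicontinuous_sum fun i _ => (hc i).comp (continuous_rowSum_apply c i)
  filter_upwards [hl x y hN] with z hz
  exact hz.trans_le (z.2.sum_le_tsum _ fun i _ => h0 i _)

theorem norm_sq_eq_tsum (x : lp (fun _ : ℕ => ℝ) 2) :
    HasSum (fun i => x.val i ^ 2) (‖x‖ ^ 2) := by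
  have h := lp.hasSum_inner (𝕜 := ℝ) x x
  rw [real_inner_self_eq_norm_sq] at h
  refine h.congr_fun ?_
  intro i
  simp [pow_two]

theorem memlp_two_of_summable {x : ℕ → ℝ} (hx : Summable fun i => x i ^ 2) :
    Memℓp (E := fun _ : ℕ => ℝ) x 2 := by
  refine memℓp_gen ?_
  simpa using hx

theorem continuous_lp_apply (i : ℕ) : Continuous fun x : lp (fun _ : ℕ => ℝ) 2 => x.val i := by
  refine LipschitzWith.continuous (K := 1) (LipschitzWith.of_dist_le_mul fun x y => ?_)
  rw [NNReal.coe_one, one_mul, dist_eq_norm, dist_eq_norm]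
  exact lp.norm_apply_le_norm (E := fun _ : ℕ => ℝ) two_ne_zero (x - y) i

/-- Norm convergence in `ℓ²` is coordinatewise convergence together with convergence of norms. -/
theorem continuous_lp_mk {A : Type*} [TopologicalSpace A] {f : A → lp (fun _ : ℕ => ℝ) 2}
    (hf : ∀ i, Continuous fun a => (f a).val i) (hn : Continuous fun a => ‖f a‖ ^ 2) :
    Continuous f := by
  refine continuous_iff_continuousAt.2 fun b => Metric.tendsto_nhds.2 fun ε hε => ?_
  have hb := norm_sq_eq_tsum (f b)
  have hlim := hb.tendsto_sum_nat
  have : ‖f b‖ ^ 2 - ε ^ 2 / 4 < ‖f b‖ ^ 2 := by have := sq_pos_of_pos hε; linarith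
  obtain ⟨N, hN⟩ := (hlim.eventually_const_lt this).exists
  have hT : Continuous fun a => ∑ i ∈ Finset.range N, ((f a).val i - (f b).val i) ^ 2
      + 2 * (‖f a‖ ^ 2 - ∑ i ∈ Finset.range N, (f a).val i ^ 2)
      + 2 * (‖f b‖ ^ 2 - ∑ i ∈ Finset.range N, (f b).val i ^ 2) := by
    have h1 : Continuous fun a => ∑ i ∈ Finset.range N, ((f a).val i - (f b).val i) ^ 2 :=
      continuous_finsetSum _ fun i _ => ((hf i).sub continuous_const).pow 2
    have h2 : Continuous fun a => ∑ i ∈ Finset.range N, (f a).val i ^ 2 :=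
      continuous_finsetSum _ fun i _ => (hf i).pow 2
    exact (h1.add ((hn.sub h2).const_mul 2)).add continuous_const
  have hlt := hT.continuousAt (x := b) |>.eventually_lt_const (u := ε ^ 2) (by
    simp only [sub_self]; norm_num; linarith)
  filter_upwards [hlt] with a ha
  rw [dist_eq_norm]
  refine lt_of_pow_lt_pow_left₀ 2 hε.le (lt_of_le_of_lt ?_ ha)
  have hd := norm_sq_eq_tsum (f a - f b)
  have hA := norm_sq_eq_tsum (f a)
  rw [← hd.tsum_eq, ← hd.summable.sum_add_tsum_nat_add N]
  have eA : ‖f a‖ ^ 2 - ∑ i ∈ Finset.range N, (f a).val i ^ 2 = ∑' i, (f a).val (i + N) ^ 2 := by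
    rw [← hA.tsum_eq, ← hA.summable.sum_add_tsum_nat_add N]; ring
  have eB : ‖f b‖ ^ 2 - ∑ i ∈ Finset.range N, (f b).val i ^ 2 = ∑' i, (f b).val (i + N) ^ 2 := by
    rw [← hb.tsum_eq, ← hb.summable.sum_add_tsum_nat_add N]; ring
  have sA := (summable_nat_add_iff (f := fun i => (f a).val i ^ 2) N).2 hA.summable
  have sB := (summable_nat_add_iff (f := fun i => (f b).val i ^ 2) N).2 hb.summable
  have sD := (summable_nat_add_iff (f := fun i => (f a - f b).val i ^ 2) N).2 hd.summable
  rw [eA, eB, add_assoc]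
  refine add_le_add le_rfl ?_
  rw [← tsum_mul_left, ← tsum_mul_left, ← (sA.mul_left 2).tsum_add (sB.mul_left 2)]
  refine sD.tsum_le_tsum (fun i => ?_) ((sA.mul_left 2).add (sB.mul_left 2))
  change ((f a).val (i + N) - (f b).val (i + N)) ^ 2 ≤ _
  nlinarith [sq_nonneg ((f a).val (i + N) + (f b).val (i + N))]

/-- The points of `ℓ²` with coordinates in an embedded copy of `P`, as the graph of a weight. -/
theorem nonempty_homeomorph_graph_rowWeight {P : Type*} [TopologicalSpace P] {ρ : P → ℝ}
    (hρ : IsEmbedding ρ) {q : ℝ → Prop} (hq : ∀ t, q t ↔ t ∈ range ρ) :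
    Nonempty ({x : lp (fun _ : ℕ => ℝ) 2 // ∀ n, q (x.val n)} ≃ₜ
      Graph (rowWeight fun (_ : ℕ) p => ρ p ^ 2)) := by
  set c : ℕ → P → ℝ := fun _ p => ρ p ^ 2 with hc
  have hex : ∀ x : {x : lp (fun _ : ℕ => ℝ) 2 // ∀ n, q (x.val n)}, ∀ n, ∃ p, ρ p = x.1.val n :=
    fun x n => (hq _).1 (x.2 n)
  choose g hg using hex
  have hs : ∀ x, HasSum (fun i => c i (g x i)) (‖x.1‖ ^ 2) := fun x => by
    refine (norm_sq_eq_tsum x.1).congr_fun fun i => ?_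
    simp only [hc, hg]
  have hm : ∀ y : RowSum c, Memℓp (E := fun _ : ℕ => ℝ) (fun i => ρ (y.1 i)) 2 :=
    fun y => memlp_two_of_summable y.2
  have hnorm : ∀ y : RowSum c, ‖(⟨fun i => ρ (y.1 i), hm y⟩ : lp (fun _ : ℕ => ℝ) 2)‖ ^ 2
      = rowWeight c y := fun y =>
    (norm_sq_eq_tsum (⟨fun i => ρ (y.1 i), hm y⟩ : lp (fun _ : ℕ => ℝ) 2)).tsum_eq.symm
  have hgc : ∀ i, Continuous fun x => g x i := fun i => by
    rw [hρ.continuous_iff]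
    exact ((continuous_lp_apply i).comp continuous_subtype_val).congr fun x => (hg x i).symm
  refine ⟨⟨⟨fun x => ⟨(⟨g x, (hs x).summable⟩, ‖x.1‖ ^ 2), (hs x).tsum_eq.symm⟩,
    fun y => ⟨⟨fun i => ρ (y.1.1.1 i), hm y.1.1⟩, fun n => (hq _).2 ⟨_, rfl⟩⟩,
    fun x => ?_, fun y => ?_⟩, ?_, ?_⟩⟩
  · refine Subtype.ext (Subtype.ext (funext fun i => ?_))
    exact hg x i
  · refine Graph.ext (Subtype.ext (funext fun i => ?_))
    exact hρ.injective (hg _ i)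
  · exact Continuous.subtype_mk (.prodMk (continuous_rowSum_mk hgc _)
      ((continuous_norm.comp continuous_subtype_val).pow 2)) _
  · refine Continuous.subtype_mk (continuous_lp_mk (fun i => ?_) ?_) _
    · exact hρ.continuous.comp ((continuous_rowSum_apply c i).comp (continuous_graph_fst _))
    · exact (continuous_graph_weight (rowWeight c)).congr fun y => (hnorm y.1.1).symm

/-! ### Examples of Lelek weights -/

section Lelek

variable {A B : Type*} [TopologicalSpace A] [TopologicalSpace B] {φ : A → ℝ} {ψ : B → ℝ}

theorem ClopenBasis.prod (hA : ClopenBasis A) (hB : ClopenBasis B) : ClopenBasis (A × B) := by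
  obtain ⟨D, hD, hb⟩ := hA
  obtain ⟨E, hE, hb'⟩ := hB
  refine ⟨fun n => D n.unpair.1 ×ˢ E n.unpair.2, fun n => (hD _).prod (hE _), fun x O hO => ?_⟩
  obtain ⟨u, hu, v, hv, huv⟩ := mem_nhds_prod_iff.1 hO
  obtain ⟨n, hn, hnu⟩ := hb _ u hu
  obtain ⟨m, hm, hmv⟩ := hb' _ v hv
  exact ⟨Nat.pair n m, by simp [hn, hm], by simpa using (prod_mono hnu hmv).trans huv⟩

theorem IsLelek.add [T2Space B] (hφ : IsLelek φ) (h0 : ∀ a, 0 ≤ φ a) (hB : ClopenBasis B)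
    (hψ : ∀ r, IsCompact {b | ψ b ≤ r}) (h0' : ∀ b, 0 ≤ ψ b) :
    IsLelek fun p : A × B => φ p.1 + ψ p.2 := by
  have := hφ.t2
  have hl : LowerSemicontinuous ψ :=
    lowerSemicontinuous_iff_isClosed_preimage.2 fun r => (hψ r).isClosed
  refine ⟨inferInstance, hφ.basis.prod hB, fun r => ?_, fun x O hO u v hu huv => ?_⟩
  · have hl' : LowerSemicontinuous fun p : A × B => φ p.1 + ψ p.2 :=
      (hφ.lowerSemicontinuous.comp continuous_fst).add (hl.comp continuous_snd)
    refine ((hφ.compact r).prod (hψ r)).of_isClosed_subset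
      (lowerSemicontinuous_iff_isClosed_preimage.1 hl' r) fun p hp => ?_
    have hp' : φ p.1 + ψ p.2 ≤ r := hp
    exact ⟨by have := h0' p.2; change φ p.1 ≤ r; linarith,
      by have := h0 p.1; change ψ p.2 ≤ r; linarith⟩
  · obtain ⟨s, hs, t, ht, hst⟩ := mem_nhds_prod_iff.1 hO
    obtain ⟨y, hy, h1, h2⟩ := hφ.dense x.1 s hs (u - ψ x.2) (v - ψ x.2) (by linarith) (by linarith)
    exact ⟨(y, x.2), hst ⟨hy, mem_of_mem_nhds ht⟩, by simp only; linarith, by simp only; linarith⟩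

theorem IsLelek.const_mul (hφ : IsLelek φ) {α : ℝ} (hα : 0 < α) : IsLelek fun a => α * φ a := by
  refine ⟨hφ.t2, hφ.basis, fun r => ?_, fun x O hO u v hu huv => ?_⟩
  · convert hφ.compact (r / α) using 3
    rw [le_div_iff₀ hα, mul_comm]
  · obtain ⟨y, hy, h1, h2⟩ := hφ.dense x O hO (u / α) (v / α)
      (by rwa [le_div_iff₀ hα, mul_comm]) (by gcongr)
    exact ⟨y, hy, by rwa [div_le_iff₀ hα, mul_comm] at h1, by rwa [lt_div_iff₀ hα, mul_comm] at h2⟩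

theorem IsLelek.add_const (hφ : IsLelek φ) (c : ℝ) : IsLelek fun a => φ a + c := by
  refine ⟨hφ.t2, hφ.basis, fun r => ?_, fun x O hO u v hu huv => ?_⟩
  · convert hφ.compact (r - c) using 3
    exact le_sub_iff_add_le.symm
  · obtain ⟨y, hy, h1, h2⟩ := hφ.dense x O hO (u - c) (v - c) (by linarith) (by linarith)
    exact ⟨y, hy, by linarith, by linarith⟩

theorem IsLelek.subtype (hφ : IsLelek φ) {q : A → Prop} (hq : IsClopen {a | q a}) :
    IsLelek fun a : {a // q a} => φ a.1 := by
  have := hφ.t2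
  refine ⟨inferInstance, hφ.basis.of_isInducing .subtypeVal, fun r => ?_,
    fun x O hO u v hu huv => ?_⟩
  · exact hq.isClosed.isClosedEmbedding_subtypeVal.isCompact_preimage (hφ.compact r)
  · have hO' : Subtype.val '' O ∈ 𝓝 x.1 := hq.isOpen.isOpenEmbedding_subtypeVal.image_mem_nhds.2 hO
    obtain ⟨_, ⟨y, hy, rfl⟩, h1, h2⟩ := hφ.dense x.1 _ hO' u v hu huv
    exact ⟨y, hy, h1, h2⟩

end Lelek

theorem hasSum_eventually_zero {P : Type*} {c : ℕ → P → ℝ} {x : ℕ → P} (N : ℕ)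
    (h : ∀ i, N ≤ i → c i (x i) = 0) :
    HasSum (fun i => c i (x i)) (∑ i ∈ Finset.range N, c i (x i)) :=
  hasSum_sum_of_ne_finset_zero fun i hi => h i (by simpa using hi)

theorem isLelek_rowWeight {P : Type*} [TopologicalSpace P] [SecondCountableTopology P]
    [CompactSpace P] [T2Space P] [TotallyDisconnectedSpace P] {c : ℕ → P → ℝ}
    (h0 : ∀ i p, 0 ≤ c i p) (hc : ∀ i, LowerSemicontinuous (c i)) {z : P} (hz : ∀ i, c i z = 0)
    {t : ℕ → P} (ht : Filter.Tendsto (fun i => c i (t i)) .atTop (𝓝 0))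
    (hdiv : ¬ Summable fun i => c i (t i)) : IsLelek (rowWeight c) := by
  have ind : IsInducing (fun x : RowSum c => x.1) := IsInducing.subtypeVal
  have psum : ∀ (x : ℕ → P) r, (∀ N, ∑ i ∈ Finset.range N, c i (x i) ≤ r) →
      Summable fun i => c i (x i) := fun x r h =>
    summable_of_sum_range_le (fun i => h0 i _) h
  refine ⟨inferInstanceAs (T2Space {x : ℕ → P // Summable fun i => c i (x i)}),
    clopenBasis_of_profinite.of_isInducing ind, fun r => ?_, fun x O hO u v hu huv => ?_⟩
  · rw [ind.isCompact_iff]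
    have : (fun x : RowSum c => x.1) '' {a | rowWeight c a ≤ r} =
        ⋂ N, {x : ℕ → P | ∑ i ∈ Finset.range N, c i (x i) ≤ r} := by
      ext x
      simp only [mem_image, mem_ofPred_eq, mem_iInter]
      constructor
      · rintro ⟨x, hx, rfl⟩ N
        exact (x.2.sum_le_tsum _ fun i _ => h0 i _).trans hx
      · exact fun h => ⟨⟨x, psum x r h⟩, (psum x r h).tsum_le_of_sum_range_le h, rfl⟩
    rw [this]
    refine (isClosed_iInter fun N => ?_).isCompact
    have hl : LowerSemicontinuous fun x : ℕ → P => ∑ i ∈ Finset.range N, c i (x i) :=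
      lowerSemicontinuous_sum fun i _ => (hc i).comp (continuous_apply i)
    exact lowerSemicontinuous_iff_isClosed_preimage.1 hl r
  · obtain ⟨N, hN⟩ : ∃ N, ∀ y : RowSum c, (∀ i < N, y.1 i = x.1 i) → y ∈ O := by
      rw [ind.nhds_eq_comap] at hO
      obtain ⟨s, hs, hsO⟩ := hO
      rw [nhds_pi, Filter.mem_pi] at hs
      obtain ⟨I, hI, w, hw, hws⟩ := hs
      obtain ⟨N, hN⟩ := hI.bddAbove
      refine ⟨N + 1, fun y hy => hsO (hws fun i hi => ?_)⟩
      change y.1 i ∈ w i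
      rw [hy i (Nat.lt_succ_of_le (hN hi))]
      exact mem_of_mem_nhds (hw i)
    obtain ⟨N', hN'⟩ := Filter.eventually_atTop.1 (ht.eventually_lt_const (sub_pos.2 huv))
    set K := max N N'
    let y : ℕ → ℕ → P := fun M i => if i < K then x.1 i else if i < M then t i else z
    have hsum : ∀ M, K ≤ M → HasSum (fun i => c i (y M i)) (∑ i ∈ Finset.range M, c i (y M i)) :=
      fun M hM => hasSum_eventually_zero M fun i hi => by
        simp [y, not_lt.2 hi, not_lt.2 (hM.trans hi), hz]
    have hval : ∀ M, K ≤ M → ∑ i ∈ Finset.range M, c i (y M i) =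
        ∑ i ∈ Finset.range K, c i (x.1 i) + ∑ i ∈ Finset.Ico K M, c i (t i) := fun M hM => by
      rw [← Finset.sum_range_add_sum_Ico _ hM]
      congr 1
      · exact Finset.sum_congr rfl fun i hi => by simp [y, Finset.mem_range.1 hi]
      · refine Finset.sum_congr rfl fun i hi => ?_
        obtain ⟨h1, h2⟩ := Finset.mem_Ico.1 hi
        simp [y, not_lt.2 h1, h2]
    have hex : ∃ M,
        u ≤ ∑ i ∈ Finset.range K, c i (x.1 i) + ∑ i ∈ Finset.Ico K (K + M), c i (t i) := by
      by_contra! hcon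
      refine hdiv ((summable_nat_add_iff K).1 (summable_of_sum_range_le (c := u -
        ∑ i ∈ Finset.range K, c i (x.1 i)) (fun i => h0 _ _) fun M => ?_))
      have := hcon M
      rw [Finset.sum_Ico_eq_sum_range] at this
      simp only [add_tsub_cancel_left] at this
      simp only [add_comm _ K]
      linarith
    classical
    set M := Nat.find hex with hM
    have hMs := Nat.find_spec hex
    refine ⟨⟨y (K + M), (hsum _ (by omega)).summable⟩, hN _ fun i hi => ?_, ?_⟩
    · have : i < K := hi.trans_le (le_max_left _ _)
      simp [y, this]
    have hw : rowWeight c ⟨y (K + M), (hsum _ (by omega)).summable⟩ =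
        ∑ i ∈ Finset.range K, c i (x.1 i) + ∑ i ∈ Finset.Ico K (K + M), c i (t i) :=
      (hsum _ (by omega)).tsum_eq.trans (hval _ (by omega))
    rw [hw]
    refine ⟨hMs, ?_⟩
    rcases Nat.eq_zero_or_pos M with h | h
    · rw [h]
      have : ∑ i ∈ Finset.range K, c i (x.1 i) ≤ rowWeight c x :=
        x.2.sum_le_tsum _ fun i _ => h0 i _
      simp
      linarith
    · obtain ⟨m, hm⟩ := Nat.exists_eq_succ_of_ne_zero h.ne'
      have hlt := Nat.find_min hex (m := m) (by omega)
      rw [hm, Nat.succ_eq_add_one, ← add_assoc, Finset.sum_Ico_succ_top (by omega)]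
      have := hN' (K + m) ((le_max_right N N').trans (by omega))
      push Not at hlt
      linarith

/-! ### A model of complete Erdős space -/

/-- The weight of the `i`-th binary digit. -/
def bitWeight (i : ℕ) (b : Bool) : ℝ := if b then 1 / ((i : ℝ) + 1) else 0

theorem bitWeight_nonneg (i : ℕ) (b : Bool) : 0 ≤ bitWeight i b := by
  unfold bitWeight; split_ifs <;> positivity

theorem bitWeight_le (i : ℕ) (b : Bool) : bitWeight i b ≤ 1 / ((i : ℝ) + 1) := by
  unfold bitWeight; split_ifs
  · exact le_rfl
  · positivity

theorem bitWeight_false (i : ℕ) : bitWeight i false = 0 := by simp [bitWeight]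

theorem isLelek_bitWeight : IsLelek (rowWeight bitWeight) := by
  refine isLelek_rowWeight bitWeight_nonneg
    (fun i => continuous_of_discreteTopology.lowerSemicontinuous) bitWeight_false
    (t := fun _ => true) ?_ ?_
  · simpa [bitWeight] using tendsto_one_div_add_atTop_nhds_zero_nat (𝕜 := ℝ)
  · have := (summable_nat_add_iff 1).not.2 Real.not_summable_one_div_natCast
    simpa [bitWeight] using this

/-- The sum of the weights of the digits. -/
def bitSum (x : ℕ → Bool) : ℝ := ∑' i, bitWeight i (x i)

theorem hasSum_bitWeight_trunc (d : ℕ) (x : ℕ → Bool) :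
    HasSum (fun i => bitWeight i (trunc d x i)) (∑ i ∈ Finset.range d, bitWeight i (x i)) := by
  have h := hasSum_eventually_zero (c := bitWeight) (x := trunc d x) d fun i hi => by
    simp [trunc, not_lt.2 hi, bitWeight_false]
  convert h using 1
  exact Finset.sum_congr rfl fun i hi => by simp [trunc, Finset.mem_range.1 hi]

theorem goodModel_bitSum :
    GoodModel {x | Summable fun i => bitWeight i (x i)} bitSum fun n => 1 / ((n : ℝ) + 1) := by
  set C : Set (ℕ → Bool) := {x | Summable fun i => bitWeight i (x i)} with hC
  have hL : IsLelek fun x : C => bitSum x := isLelek_bitWeight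
  have h0 : ∀ x, 0 ≤ bitSum x := fun x => tsum_nonneg fun i => bitWeight_nonneg _ _
  have hz : ∀ d x, trunc d x ∈ C := fun d x => (hasSum_bitWeight_trunc d x).summable
  have hval : ∀ d x, bitSum (trunc d x) = ∑ i ∈ Finset.range d, bitWeight i (x i) :=
    fun d x => (hasSum_bitWeight_trunc d x).tsum_eq
  let o : C := ⟨trunc 0 fun _ => false, hz _ _⟩
  have ho : bitSum o = 0 := by simp [o, hval]
  have := hL.t2
  refine ⟨⟨o, o.2⟩, hL.lowerSemicontinuous, fun α β ε hα hβ hε => ?_, ?_, fun d x ε hε => ?_,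
    fun d x => ?_, fun d => by positivity, ?_, tendsto_one_div_add_atTop_nhds_zero_nat⟩
  · have h1 : IsLelek fun p : C × C => α * bitSum p.1 + β * bitSum p.2 :=
      (hL.const_mul hα).add (fun a => mul_nonneg hα.le (h0 _)) hL.basis
        (hL.const_mul hβ).compact fun a => mul_nonneg hβ.le (h0 _)
    have h2 : IsLelek fun x : C => (α + β) * bitSum x := hL.const_mul (add_pos hα hβ)
    refine (h1.nearHomeo h2 (p₀ := (o, o)) (q₀ := o) (fun a => ?_) (fun a => ?_) hε).mono ?_
    · simp only [ho]
      have := mul_nonneg hα.le (h0 a.1)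
      have := mul_nonneg hβ.le (h0 a.2)
      linarith
    · simp only [ho, mul_zero]
      exact mul_nonneg (add_pos hα hβ).le (h0 _)
    · simp [ho]
  · intro K _ _ _ _ _ ε hε
    obtain ⟨k⟩ := ‹Nonempty K›
    have h1 : IsLelek fun p : C × K => bitSum p.1 + 0 :=
      hL.add (fun a => h0 _) clopenBasis_of_countable (ψ := fun _ => 0)
        (fun r => isClosed_const.isCompact) fun _ => le_rfl
    simp only [add_zero] at h1
    refine (h1.nearHomeo hL (p₀ := (o, k)) (q₀ := o) (fun a => ?_) (fun a => ?_) hε).mono ?_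
    · simpa only [ho] using h0 _
    · simpa only [ho] using h0 _
    · simp
  · have hcl : IsClopen {y : C | trunc d y = trunc d x} :=
      ((isLocallyConstant_trunc d).isClopen_fiber (trunc d x)).preimage continuous_subtype_val
    have h1 := hL.subtype hcl
    have e := NearHomeo.subtype (p := (· ∈ C)) (q := fun y : C => trunc d y = trunc d x)
      (r := fun y => y ∈ C ∧ trunc d y = trunc d x) bitSum fun y => by simp
    have h2 := hL.add_const (bitSum (trunc d x))
    have h3 := h1.nearHomeo h2 (p₀ := ⟨⟨trunc d x, hz _ _⟩, trunc_trunc le_rfl x⟩) (q₀ := o)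
      (fun a => ?_) (fun a => ?_) hε
    · refine (e.symm.trans h3).mono ?_
      simp [ho]
    · obtain ⟨a, ha⟩ := a
      change bitSum (trunc d x) ≤ bitSum a
      rw [← ha, hval]
      exact Summable.sum_le_tsum _ (fun i _ => bitWeight_nonneg _ _) a.2
    · simp only [ho, zero_add]
      have := h0 a
      linarith
  · rw [hval, hval, Finset.sum_range_succ, add_sub_cancel_left,
      abs_of_nonneg (bitWeight_nonneg _ _)]
    exact bitWeight_le _ _
  · intro m n h
    simp only
    gcongr

/-! ### Complete Erdős space -/

/-- The possible coordinates of points of complete Erdős space. -/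
abbrev Harmonic : Type := {t : ℝ // t = 0 ∨ ∃ m : ℕ, 0 < m ∧ t = 1 / (m : ℝ)}

theorem harmonic_eq : {t : ℝ | t = 0 ∨ ∃ m : ℕ, 0 < m ∧ t = 1 / (m : ℝ)} =
    insert 0 (range fun n : ℕ => 1 / ((n : ℝ) + 1)) := by
  ext t
  simp only [mem_ofPred_eq, mem_insert_iff, mem_range]
  refine or_congr_right ⟨?_, ?_⟩
  · rintro ⟨m, hm, rfl⟩
    exact ⟨m - 1, by rw [Nat.cast_sub hm]; simp⟩
  · rintro ⟨n, rfl⟩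
    exact ⟨n + 1, n.succ_pos, by push_cast; rfl⟩

theorem isLelek_harmonic : IsLelek (rowWeight fun (_ : ℕ) (p : Harmonic) => p.1 ^ 2) := by
  have hcpt : CompactSpace Harmonic := by
    refine isCompact_iff_compactSpace.1 ?_
    change IsCompact {t : ℝ | t = 0 ∨ ∃ m : ℕ, 0 < m ∧ t = 1 / (m : ℝ)}
    rw [harmonic_eq]
    exact (tendsto_one_div_add_atTop_nhds_zero_nat (𝕜 := ℝ)).isCompact_insert_range
  have htd : TotallyDisconnectedSpace Harmonic := by
    refine totallyDisconnectedSpace_subtype_iff.2 (Countable.isTotallyDisconnected ?_)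
    change Set.Countable {t : ℝ | t = 0 ∨ ∃ m : ℕ, 0 < m ∧ t = 1 / (m : ℝ)}
    rw [harmonic_eq]
    exact (countable_range _).insert _
  refine isLelek_rowWeight (fun _ _ => sq_nonneg _)
    (fun i => (continuous_subtype_val.pow 2).lowerSemicontinuous) (z := ⟨0, .inl rfl⟩) (by simp)
    (t := fun i => ⟨1 / ((Nat.sqrt i + 1 : ℕ) : ℝ), .inr ⟨_, Nat.succ_pos _, rfl⟩⟩) ?_ ?_
  · have h1 : Filter.Tendsto Nat.sqrt .atTop .atTop :=
      Filter.tendsto_atTop.2 fun n => Filter.eventually_atTop.2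
        ⟨n * n, fun m hm => Nat.le_sqrt.2 hm⟩
    have h2 := ((tendsto_one_div_add_atTop_nhds_zero_nat (𝕜 := ℝ)).comp h1).pow 2
    simpa using h2
  · intro hs
    refine (summable_nat_add_iff 1).not.2 Real.not_summable_one_div_natCast ?_
    refine Summable.of_nonneg_of_le (fun i => by positivity) (fun i => ?_) (hs.mul_left 2)
    have h1 : (Nat.sqrt i : ℝ) ^ 2 ≤ i := by
      exact_mod_cast Nat.sqrt_le' i
    simp only
    rw [div_pow, one_pow, mul_one_div, div_le_div_iff₀ (by positivity) (by positivity)]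
    push_cast
    nlinarith [sq_nonneg ((Nat.sqrt i : ℝ) - 1)]

theorem completeErdosSpace_homeomorph :
    Nonempty (CompleteErdosSpace ≃ₜ
      Graph fun x : {x : ℕ → Bool | Summable fun i => bitWeight i (x i)} => bitSum x) := by
  obtain ⟨h⟩ := nonempty_homeomorph_graph_rowWeight (P := Harmonic)
    (q := fun t => t = 0 ∨ ∃ m : ℕ, 0 < m ∧ t = 1 / (m : ℝ)) IsEmbedding.subtypeVal (by simp)
  have hz : Summable fun i : ℕ => ((⟨0, .inl rfl⟩ : Harmonic) : ℝ) ^ 2 := by simp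
  have hz' : Summable fun i : ℕ => bitWeight i false := by simp [bitWeight_false]
  have := isLelek_harmonic.nearHomeo isLelek_bitWeight
    (p₀ := ⟨fun _ => ⟨0, .inl rfl⟩, hz⟩) (q₀ := ⟨fun _ => false, hz'⟩)
    (fun a => ?_) (fun a => ?_) one_pos
  · obtain ⟨g⟩ := this.graph
    exact ⟨h.trans g⟩
  · simp only [rowWeight]
    simpa using tsum_nonneg fun i => sq_nonneg _
  · simp only [rowWeight, bitWeight_false, tsum_zero]
    exact tsum_nonneg fun i => bitWeight_nonneg _ _

/-! ### Weights with almost full range -/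

section RatLike

variable {A B : Type*} [TopologicalSpace A] [TopologicalSpace B]

theorem RatLike.of_continuous_injective (hA : RatLike A) [Countable B]
    [TopologicalSpace.MetrizableSpace B]
    (h : ∀ b : B, ∃ f : A → B, Continuous f ∧ Function.Injective f ∧ b ∈ range f) :
    RatLike B := by
  refine ⟨inferInstance, inferInstance, fun b => ?_⟩
  obtain ⟨f, hf, hi, a, rfl⟩ := h b
  have := hA.crowded a
  refine Filter.Tendsto.neBot (x := 𝓝[≠] a) (tendsto_nhdsWithin_iff.2
    ⟨hf.continuousAt.mono_left nhdsWithin_le_nhds, ?_⟩)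
  filter_upwards [self_mem_nhdsWithin] with y hy
  exact hi.ne hy

theorem RatLike.prod (hA : RatLike A) [Countable B] [TopologicalSpace.MetrizableSpace B] :
    RatLike (A × B) := by
  have := hA.countable
  have := hA.metrizable
  exact hA.of_continuous_injective fun b => ⟨fun a => (a, b.2), by fun_prop,
    fun _ _ h => (Prod.ext_iff.1 h).1, b.1, rfl⟩

theorem RatLike.pi (hA : RatLike A) (n : ℕ) : RatLike (Fin (n + 1) → A) := by
  have := hA.countable
  have := hA.metrizable
  exact hA.of_continuous_injective fun b => ⟨Function.update b 0,
    continuous_const.update 0 continuous_id, Function.update_injective b 0, b 0, by simp⟩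

theorem RatLike.subtype (hA : RatLike A) {q : A → Prop} (hq : IsOpen {a | q a}) :
    RatLike {a // q a} := by
  have := hA.countable
  have := hA.metrizable
  refine ⟨inferInstance, IsEmbedding.subtypeVal.metrizableSpace, fun a => ?_⟩
  have := hA.crowded a.1
  have h : 𝓝[≠] a = Filter.comap Subtype.val (𝓝[≠] a.1) := by
    rw [nhdsWithin, nhdsWithin, Filter.comap_inf, ← nhds_induced, Filter.comap_principal]
    congr 2
    ext b
    simp [Subtype.ext_iff]
  rw [h]
  refine Filter.NeBot.comap_of_range_mem this ?_
  exact nhdsWithin_le_nhds (Filter.mem_of_superset (hq.mem_nhds a.2) fun b hb => ⟨⟨b, hb⟩, rfl⟩)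

end RatLike

/-- The weight `c` has minimum at least `m` and comes `η`-close to every number above `m`. -/
def Full {A : Type*} (m η : ℝ) (c : A → ℝ) : Prop :=
  (∀ a, m ≤ c a) ∧ ∀ u, m ≤ u → ∃ a, |c a - u| ≤ η

theorem Full.of_section {A H : Type*} {m η : ℝ} {c : A → ℝ} (hc : Full 0 η c) {w : H → ℝ}
    (hm : ∀ h, m ≤ w h) (s : A → H) (hs : ∀ a, w (s a) = m + c a) : Full m η w := by
  refine ⟨hm, fun u hu => ?_⟩
  obtain ⟨a, ha⟩ := hc.2 (u - m) (by linarith)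
  refine ⟨s a, ?_⟩
  rw [hs]
  convert ha using 2
  ring

theorem Full.nonempty_fiber_iff {A : Type*} {c : A → ℝ} {m η θ : ℝ} (hη : 0 < η) (hc : Full m η c)
    (h1 : m + η < θ) (h2 : θ < m + 4 * η) (n : ℤ) :
    Nonempty {a // ⌊(c a - θ) / (4 * η)⌋ = n} ↔ -1 ≤ n := by
  have h4 : 0 < 4 * η := by linarith
  constructor
  · rintro ⟨a, rfl⟩
    rw [Int.le_floor, le_div_iff₀ h4]
    push_cast
    have := hc.1 a
    linarith
  · intro hn
    rcases hn.eq_or_lt with rfl | hn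
    · obtain ⟨a, ha⟩ := hc.2 m le_rfl
      refine ⟨a, ?_⟩
      rw [Int.floor_eq_iff, le_div_iff₀ h4, div_lt_iff₀ h4]
      have := abs_le.1 ha
      have := hc.1 a
      push_cast
      constructor <;> linarith
    · have hn' : (0 : ℝ) ≤ n := by exact_mod_cast Int.lt_iff_add_one_le.1 hn
      obtain ⟨a, ha⟩ := hc.2 (θ + 4 * η * n + 2 * η) (by have := mul_nonneg h4.le hn'; linarith)
      refine ⟨a, ?_⟩
      rw [Int.floor_eq_iff, le_div_iff₀ h4, div_lt_iff₀ h4]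
      have := abs_le.1 ha
      constructor <;> linarith

section Full

variable {A B : Type*} [TopologicalSpace A] [TopologicalSpace B]

theorem isLocallyConstant_floor {c : A → ℝ} (hc : Continuous c) {θ δ : ℝ} (hδ : 0 < δ)
    (hθ : ∀ a (n : ℤ), θ ≠ c a - δ * n) : IsLocallyConstant fun a => ⌊(c a - θ) / δ⌋ := by
  rw [IsLocallyConstant.iff_isOpen_fiber]
  intro n
  have : (fun a => ⌊(c a - θ) / δ⌋) ⁻¹' {n} =
      {a | θ + δ * n < c a} ∩ {a | c a < θ + δ * (n + 1)} := by
    ext a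
    simp only [mem_preimage, mem_singleton_iff, Int.floor_eq_iff, mem_inter_iff, mem_ofPred_eq]
    rw [le_div_iff₀ hδ, div_lt_iff₀ hδ]
    have h1 := hθ a n
    constructor
    · rintro ⟨h2, h3⟩
      exact ⟨lt_of_le_of_ne (by linarith) fun h => h1 (by linarith), by linarith⟩
    · rintro ⟨h2, h3⟩
      exact ⟨by linarith, by linarith⟩
  rw [this]
  exact (isOpen_lt continuous_const hc).inter (isOpen_lt hc continuous_const)

/-- Continuous weights with almost full range on countable spaces are nearly homeomorphic. -/
theorem Full.nearHomeo {c : A → ℝ} {c' : B → ℝ} {m η : ℝ} (hA : RatLike A) (hB : RatLike B)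
    (hc : Continuous c) (hc' : Continuous c') (hη : 0 < η) (h : Full m η c) (h' : Full m η c') :
    NearHomeo (4 * η) c c' := by
  have := hA.countable
  have := hB.countable
  obtain ⟨θ, hθ, h1, h2⟩ := (((countable_range fun p : A × ℤ => c p.1 - 4 * η * p.2).union
    (countable_range fun p : B × ℤ => c' p.1 - 4 * η * p.2)).dense_compl ℝ).exists_between
      (show m + η < m + 4 * η by linarith)
  have h4 : 0 < 4 * η := by linarith
  have l := isLocallyConstant_floor hc h4 fun a n hh => hθ (.inl ⟨(a, n), hh.symm⟩)
  have l' := isLocallyConstant_floor hc' h4 fun a n hh => hθ (.inr ⟨(a, n), hh.symm⟩)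
  refine NearHomeo.glue l l' fun n => ?_
  by_cases hn : -1 ≤ n
  · have := (h.nonempty_fiber_iff hη h1 h2 n).2 hn
    have := (h'.nonempty_fiber_iff hη h1 h2 n).2 hn
    obtain ⟨g⟩ := (hA.subtype (l.isOpen_fiber n)).nonempty_homeomorph
      (hB.subtype (l'.isOpen_fiber n))
    refine ⟨g, fun a => ?_, ?_⟩
    · have e1 := Int.floor_eq_iff.1 a.2
      have e2 := Int.floor_eq_iff.1 (g a).2
      rw [le_div_iff₀ h4, div_lt_iff₀ h4] at e1 e2
      refine abs_le.2 ?_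
      constructor <;> linarith [e1.1, e1.2, e2.1, e2.2]
    · exact (hc'.comp (continuous_subtype_val.comp g.continuous)).sub
        (hc.comp continuous_subtype_val)
  · have := not_nonempty_iff.1 ((h.nonempty_fiber_iff hη h1 h2 n).not.2 hn)
    have := not_nonempty_iff.1 ((h'.nonempty_fiber_iff hη h1 h2 n).not.2 hn)
    exact .of_isEmpty _ _ _

end Full

/-! ### Comparing spaces of summable sequences -/

section RowSum

variable {P Q : Type*} [TopologicalSpace P] [TopologicalSpace Q]

theorem NearHomeo.rowSum {c : ℕ → P → ℝ} {c' : ℕ → Q → ℝ} {ε : ℕ → ℝ} (hε : Summable ε)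
    (h : ∀ i, NearHomeo (ε i) (c i) (c' i)) :
    NearHomeo (∑' i, ε i) (rowWeight c) (rowWeight c') := by
  choose g hg hgc using h
  have hb : ∀ x : ℕ → P, Summable fun i => c' i (g i (x i)) - c i (x i) := fun x =>
    .of_norm_bounded hε fun i => hg i (x i)
  have hs : ∀ x : RowSum c, Summable fun i => c' i (g i (x.1 i)) := fun x =>
    ((hb x.1).add x.2).congr fun i => by ring
  have hs' : ∀ y : RowSum c', Summable fun i => c i ((g i).symm (y.1 i)) := fun y =>
    (y.2.sub (hb fun i => (g i).symm (y.1 i))).congr fun i => by simp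
  have hdiff : ∀ x : RowSum c, rowWeight c' ⟨fun i => g i (x.1 i), hs x⟩ - rowWeight c x =
      ∑' i, (c' i (g i (x.1 i)) - c i (x.1 i)) := fun x => ((hs x).tsum_sub x.2).symm
  refine ⟨⟨⟨fun x => ⟨fun i => g i (x.1 i), hs x⟩, fun y => ⟨fun i => (g i).symm (y.1 i), hs' y⟩,
    fun x => ?_, fun y => ?_⟩, ?_, ?_⟩, fun x => ?_, ?_⟩
  · exact Subtype.ext (funext fun i => (g i).symm_apply_apply _)
  · exact Subtype.ext (funext fun i => (g i).apply_symm_apply _)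
  · exact continuous_rowSum_mk (fun i => (g i).continuous.comp (continuous_rowSum_apply c i)) _
  · exact continuous_rowSum_mk
      (fun i => (g i).symm.continuous.comp (continuous_rowSum_apply c' i)) _
  · refine (congrArg abs (hdiff x)).trans_le ?_
    rw [← Real.norm_eq_abs]
    exact tsum_of_norm_bounded hε.hasSum fun i => hg i (x.1 i)
  · refine Continuous.congr ?_ fun x => (hdiff x).symm
    exact continuous_tsum (fun i => (hgc i).comp (continuous_rowSum_apply c i)) hε
      fun i x => hg i (x.1 i)

/-- The weight of the first `n` terms. -/
def headWeight {P : Type*} (c : ℕ → P → ℝ) (n : ℕ) (h : Fin n → P) : ℝ := ∑ i : Fin n, c i (h i)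

theorem continuous_headWeight {c : ℕ → P → ℝ} (hc : ∀ i, Continuous (c i)) (n : ℕ) :
    Continuous (headWeight c n) :=
  continuous_finsetSum _ fun i _ => (hc i).comp (continuous_apply i)

theorem headWeight_update {P : Type*} (c : ℕ → P → ℝ) (n : ℕ) (h : Fin (n + 1) → P) (p : P) :
    headWeight c (n + 1) (Function.update h (Fin.last n) p) + c n (h (Fin.last n)) =
      headWeight c (n + 1) h + c n p := by
  simp only [headWeight, Fin.sum_univ_castSucc, Function.update_self, Fin.val_last,
    Fin.val_castSucc]
  have : ∀ i : Fin n, Function.update h (Fin.last n) p i.castSucc = h i.castSucc := fun i =>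
    Function.update_of_ne (Fin.castSucc_lt_last i).ne _ _
  simp only [this]
  ring

/-- Split off the first `n` terms. -/
def rowSplit (c : ℕ → P → ℝ) (n : ℕ) :
    RowSum c ≃ₜ (Fin n → P) × RowSum (fun i => c (i + n)) where
  toFun x := (fun i => x.1 i, ⟨fun i => x.1 (i + n),
    (summable_nat_add_iff (f := fun i => c i (x.1 i)) n).2 x.2⟩)
  invFun y := ⟨fun i => if h : i < n then y.1 ⟨i, h⟩ else y.2.1 (i - n), by
    rw [← summable_nat_add_iff n]
    exact y.2.2.congr fun i => by simp⟩
  left_inv x := by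
    refine Subtype.ext (funext fun i => ?_)
    by_cases h : i < n
    · simp [h]
    · simp [h, Nat.sub_add_cancel (not_lt.1 h)]
  right_inv y := by
    refine Prod.ext (funext fun i => by simp) (Subtype.ext (funext fun i => by simp))
  continuous_toFun := .prodMk (continuous_pi fun i => continuous_rowSum_apply c i)
    (continuous_rowSum_mk (fun i => continuous_rowSum_apply c (i + n)) _)
  continuous_invFun := by
    refine continuous_rowSum_mk (fun i => ?_) _
    by_cases h : i < n
    · simp only [h, dite_true]
      exact (continuous_apply _).comp continuous_fst
    · simp only [h, dite_false]
      exact (continuous_rowSum_apply _ (i - n)).comp continuous_snd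

theorem rowWeight_eq_add (c : ℕ → P → ℝ) (n : ℕ) (x : RowSum c) :
    headWeight c n (rowSplit c n x).1 + rowWeight (fun i => c (i + n)) (rowSplit c n x).2 =
      rowWeight c x := by
  refine Eq.trans ?_ (x.2.sum_add_tsum_nat_add n)
  rw [← Fin.sum_univ_eq_sum_range (fun i => c i (x.1 i))]
  rfl

theorem NearHomeo.rowSplit (c : ℕ → P → ℝ) (n : ℕ) : NearHomeo 0 (rowWeight c)
    fun p : (Fin n → P) × RowSum (fun i => c (i + n)) =>
      headWeight c n p.1 + rowWeight (fun i => c (i + n)) p.2 :=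
  .of_homeo (ErdosModel.rowSplit c n) (rowWeight_eq_add c n)

/-- Sequences of weights with almost full range. -/
structure FullRows {P : Type*} [TopologicalSpace P] (c : ℕ → P → ℝ) (z : P) (η : ℕ → ℝ) :
    Prop where
  ratLike : RatLike P
  continuous : ∀ i, Continuous (c i)
  zero : ∀ i, c i z = 0
  full : ∀ i, Full 0 (η i) (c i)

theorem FullRows.headWeight_nonneg {c : ℕ → P → ℝ} {z : P} {η : ℕ → ℝ} (hc : FullRows c z η)
    (n : ℕ) (h : Fin n → P) : 0 ≤ headWeight c n h :=
  Finset.sum_nonneg fun i _ => (hc.full i).1 _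

theorem FullRows.full_headWeight {c : ℕ → P → ℝ} {z : P} {η : ℕ → ℝ} (hc : FullRows c z η)
    (n : ℕ) : Full 0 (η n) (headWeight c (n + 1)) := by
  refine (hc.full n).of_section (hc.headWeight_nonneg _)
    (fun p => Function.update (fun _ => z) (Fin.last n) p) fun p => ?_
  have h := headWeight_update c n (fun _ => z) p
  rw [hc.zero] at h
  rw [← add_zero (headWeight c _ _), h]
  simp [headWeight, hc.zero]

theorem FullRows.nearHomeo {c : ℕ → P → ℝ} {z : P} {η : ℕ → ℝ} (hc : FullRows c z η)
    {c' : ℕ → Q → ℝ} {z' : Q} (hc' : FullRows c' z' η) (hη : ∀ i, 0 < η i) (hs : Summable η)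
    {ε : ℝ} (hε : 0 < ε) : NearHomeo ε (rowWeight c) (rowWeight c') := by
  obtain ⟨n, hn⟩ := ((tendsto_sum_nat_add η).eventually_lt_const
    (show 0 < ε / 4 by linarith)).exists
  have h1 := Full.nearHomeo (hc.ratLike.pi n) (hc'.ratLike.pi n)
    (continuous_headWeight hc.continuous _) (continuous_headWeight hc'.continuous _) (hη n)
    (hc.full_headWeight n) (hc'.full_headWeight n)
  have hs' := (summable_nat_add_iff (n + 1)).2 hs
  have h2 := NearHomeo.rowSum (c := fun i => c (i + (n + 1))) (c' := fun i => c' (i + (n + 1)))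
    (hs'.mul_left 4) fun i => Full.nearHomeo hc.ratLike hc'.ratLike (hc.continuous _)
      (hc'.continuous _) (hη _) (hc.full _) (hc'.full _)
  have h3 := (NearHomeo.rowSplit c (n + 1)).trans
    ((h1.prod h2).trans (NearHomeo.rowSplit c' (n + 1)).symm)
  refine h3.mono ?_
  have hs2 := (summable_nat_add_iff n).2 hs
  rw [tsum_mul_left]
  rw [hs2.tsum_eq_zero_add] at hn
  simp only [zero_add, add_assoc, add_comm 1 n] at hn
  linarith

theorem FullRows.nearHomeo_prod {c : ℕ → P → ℝ} {z : P} {η : ℕ → ℝ} (hc : FullRows c z η)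
    (hη : ∀ i, 0 < η i) (hs : Summable η) (K : Type*) [TopologicalSpace K] [Countable K]
    [TopologicalSpace.MetrizableSpace K] [Nonempty K] {ε : ℝ} (hε : 0 < ε) :
    NearHomeo ε (fun p : RowSum c × K => rowWeight c p.1) (rowWeight c) := by
  obtain ⟨n, hn⟩ := (hs.tendsto_atTop_zero.eventually_lt_const
    (show 0 < ε / 4 by linarith)).exists
  obtain ⟨k⟩ := ‹Nonempty K›
  have hf : Full 0 (η n) fun p : (Fin (n + 1) → P) × K => headWeight c (n + 1) p.1 :=
    (hc.full_headWeight n).of_section (fun p => hc.headWeight_nonneg _ _) (fun h => (h, k))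
      fun p => (zero_add _).symm
  have h1 := Full.nearHomeo (hc.ratLike.pi n).prod (hc.ratLike.pi n)
    ((continuous_headWeight hc.continuous _).comp continuous_fst)
    (continuous_headWeight hc.continuous _) (hη n) hf (hc.full_headWeight n)
  have h2 := h1.prod (NearHomeo.refl (rowWeight fun i => c (i + (n + 1))))
  let e : RowSum c × K ≃ₜ ((Fin (n + 1) → P) × K) × RowSum (fun i => c (i + (n + 1))) :=
    ((rowSplit c (n + 1)).prodCongr (.refl K)).trans
      ((Homeomorph.prodAssoc _ _ _).trans (((Homeomorph.refl _).prodCongr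
        (Homeomorph.prodComm _ _)).trans (Homeomorph.prodAssoc _ _ _).symm))
  have h3 := NearHomeo.of_homeo (φ := fun p : RowSum c × K => rowWeight c p.1)
    (ψ := fun p : ((Fin (n + 1) → P) × K) × RowSum (fun i => c (i + (n + 1))) =>
      headWeight c (n + 1) p.1.1 + rowWeight (fun i => c (i + (n + 1))) p.2) e
    fun p => rowWeight_eq_add c (n + 1) p.1
  exact (h3.trans (h2.trans (NearHomeo.rowSplit c (n + 1)).symm)).mono (by linarith)

/-- A subset of the first factor times the second factor. -/
def subtypeProdHomeo {A B : Type*} [TopologicalSpace A] [TopologicalSpace B] (U : A → Prop) :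
    {p : A × B // U p.1} ≃ₜ {a // U a} × B where
  toFun p := (⟨p.1.1, p.2⟩, p.1.2)
  invFun p := ⟨(p.1.1, p.2), p.1.2⟩
  left_inv _ := rfl
  right_inv _ := rfl
  continuous_toFun := by fun_prop
  continuous_invFun := by fun_prop

/-- Restricting finitely many terms to an open set with a point of minimal weight amounts to
adding a constant to the weight. -/
theorem FullRows.nearHomeo_subtype {c : ℕ → P → ℝ} {z : P} {η : ℕ → ℝ} (hc : FullRows c z η)
    (hη : ∀ i, 0 < η i) {n : ℕ} {U : (Fin (n + 1) → P) → Prop} (hU : IsOpen {h | U h})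
    {h₀ : Fin (n + 1) → P} (hlast : c n (h₀ (Fin.last n)) = 0)
    (hup : ∀ p, U (Function.update h₀ (Fin.last n) p))
    (hmin : ∀ h, U h → headWeight c (n + 1) h₀ ≤ headWeight c (n + 1) h) :
    NearHomeo (4 * η n) (fun x : {x : RowSum c // U fun i => x.1 i} => rowWeight c x.1)
      fun x : RowSum c => rowWeight c x + headWeight c (n + 1) h₀ := by
  set m := headWeight c (n + 1) h₀
  have hf : Full m (η n) fun h : {h // U h} => headWeight c (n + 1) h.1 := by
    refine (hc.full n).of_section (fun h => hmin h.1 h.2)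
      (fun p => ⟨Function.update h₀ (Fin.last n) p, hup p⟩) fun p => ?_
    have h := headWeight_update c n h₀ p
    rwa [hlast, add_zero] at h
  have hf' : Full m (η n) fun h => headWeight c (n + 1) h + m :=
    (hc.full_headWeight n).of_section
      (fun h => by have := hc.headWeight_nonneg _ h; linarith) id fun h => add_comm _ _
  have h1 := Full.nearHomeo ((hc.ratLike.pi n).subtype hU) (hc.ratLike.pi n)
    ((continuous_headWeight hc.continuous _).comp continuous_subtype_val)
    ((continuous_headWeight hc.continuous _).add continuous_const) (hη n) hf hf'
  have h2 := h1.prod (NearHomeo.refl (rowWeight fun i => c (i + (n + 1))))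
  have h3 := NearHomeo.of_homeo
    (φ := fun x : {x : RowSum c // U fun i => x.1 i} => rowWeight c x.1)
    (ψ := fun p : {h // U h} × RowSum (fun i => c (i + (n + 1))) =>
      headWeight c (n + 1) p.1.1 + rowWeight (fun i => c (i + (n + 1))) p.2)
    (((rowSplit c (n + 1)).subtype (q := fun p => U p.1) fun x => Iff.rfl).trans
      (subtypeProdHomeo U))
    fun p => rowWeight_eq_add c (n + 1) p.1
  have h4 := NearHomeo.of_homeo (φ := fun x : RowSum c => rowWeight c x + m)
    (ψ := fun p : (Fin (n + 1) → P) × RowSum (fun i => c (i + (n + 1))) =>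
      headWeight c (n + 1) p.1 + m + rowWeight (fun i => c (i + (n + 1))) p.2)
    (rowSplit c (n + 1)) fun x => by
      rw [← rowWeight_eq_add c (n + 1) x]; ring
  exact (h3.trans (h2.trans h4.symm)).mono (by linarith)

end RowSum

/-! ### A model of Erdős space -/

/-- Eventually vanishing binary sequences. -/
abbrev FinSupp : Type := {r : ℕ → Bool // ∃ d, ∀ j, d ≤ j → r j = false}

theorem ratLike_finSupp : RatLike FinSupp := by
  have hcount : Countable FinSupp := by
    refine Function.Surjective.countable (α := Finset ℕ)
      (f := fun F => ⟨fun j => decide (j ∈ F), F.sup id + 1, fun j hj => ?_⟩) ?_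
    · simp only [decide_eq_false_iff_not]
      exact fun h => by have : j ≤ F.sup id := Finset.le_sup (f := id) h; omega
    · rintro ⟨r, d, hd⟩
      refine ⟨(Finset.range d).filter (r · = true), Subtype.ext (funext fun j => ?_)⟩
      by_cases h : j < d
      · simp [h]
      · simp [h, hd j (not_lt.1 h)]
  have : TopologicalSpace.MetrizableSpace (ℕ → Bool) :=
    TopologicalSpace.metrizableSpace_of_t3_secondCountable _
  refine ⟨hcount, IsEmbedding.subtypeVal.metrizableSpace, fun r => ?_⟩
  refine mem_closure_iff_nhdsWithin_neBot.1 (mem_closure_iff_nhds.2 fun O hO => ?_)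
  rw [nhds_subtype_eq_comap] at hO
  obtain ⟨s, hs, hsO⟩ := hO
  obtain ⟨d, hd⟩ := hasBasis_nhds_trunc _ hs
  obtain ⟨r, d', hd'⟩ := r
  refine ⟨⟨Function.update r (max d d') true, max d d' + 1, fun j hj => ?_⟩, hsO (hd _ ?_), ?_⟩
  · rw [Function.update_of_ne (by omega)]
    exact hd' j (by omega)
  · refine trunc_eq_iff.2 fun j hj => ?_
    exact Function.update_of_ne (by omega) _ _
  · intro h
    have := congrFun (congrArg Subtype.val h) (max d d')
    simp [hd' _ (le_max_right d d')] at this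

/-- The number of leading ones. -/
def lead (r : ℕ → Bool) : ℕ := sInf {j | r j = false}

theorem lead_eq {r : ℕ → Bool} {n : ℕ} (h : ∀ k < n, r k = true) (hn : r n = false) :
    lead r = n := by
  refine le_antisymm (Nat.sInf_le hn) (le_csInf ⟨n, hn⟩ fun j hj => ?_)
  by_contra! hlt
  have hj' : r j = false := hj
  simp [h j hlt] at hj'

theorem apply_lead {r : ℕ → Bool} {d : ℕ} (h : r d = false) : r (lead r) = false :=
  Nat.sInf_mem (s := {j | r j = false}) ⟨d, h⟩

theorem apply_of_lt_lead {r : ℕ → Bool} {k : ℕ} (h : k < lead r) : r k = true := by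
  have : ¬ r k = false := Nat.notMem_of_lt_sInf (s := {j | r j = false}) h
  simpa using this

/-- Harmonic numbers. -/
def harm (n : ℕ) : ℝ := ∑ j ∈ Finset.range n, 1 / ((j : ℝ) + 1)

theorem harm_mono : Monotone harm := fun m n h =>
  Finset.sum_le_sum_of_subset_of_nonneg (Finset.range_mono h) fun _ _ _ => by positivity

theorem harm_nonneg (n : ℕ) : 0 ≤ harm n := Finset.sum_nonneg fun _ _ => by positivity

/-- The weight of a binary sequence. -/
def leadWeight (r : ℕ → Bool) : ℝ := harm (lead r)

theorem leadWeight_zero {r : ℕ → Bool} (h : r 0 = false) : leadWeight r = 0 := by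
  rw [leadWeight, lead_eq (n := 0) (by simp) h]; simp [harm]

theorem leadWeight_mono {r s : ℕ → Bool} {d : ℕ} (hd : s d = false)
    (h : ∀ k, r k = true → s k = true) : leadWeight r ≤ leadWeight s := by
  refine harm_mono ?_
  by_contra! hlt
  have := h _ (apply_of_lt_lead hlt)
  rw [apply_lead hd] at this
  simp at this

theorem abs_leadWeight_trunc_le (r : ℕ → Bool) (j : ℕ) :
    |leadWeight (trunc (j + 1) r) - leadWeight (trunc j r)| ≤ 1 / ((j : ℝ) + 1) := by
  have hf : ∀ d, trunc d r d = false := fun d => by simp [trunc]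
  have hlow : ∀ k, k < j → trunc j r k = trunc (j + 1) r k := fun k hk => by
    simp [trunc, hk, hk.trans (Nat.lt_succ_self j)]
  have hl : lead (trunc (j + 1) r) ≤ j + 1 := Nat.sInf_le (hf (j + 1))
  have hp : (0 : ℝ) ≤ 1 / ((j : ℝ) + 1) := by positivity
  have h1 : ∀ k < lead (trunc (j + 1) r), trunc (j + 1) r k = true :=
    fun k hk => apply_of_lt_lead hk
  have h2 : trunc (j + 1) r (lead (trunc (j + 1) r)) = false := apply_lead (hf (j + 1))
  rcases lt_or_ge j (lead (trunc (j + 1) r)) with h | h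
  · have e1 : lead (trunc (j + 1) r) = j + 1 := by omega
    have e2 : lead (trunc j r) = j := lead_eq (fun k hk => by
      rw [hlow k hk]; exact h1 k (by omega)) (hf j)
    rw [leadWeight, leadWeight, e1, e2, harm, harm, Finset.sum_range_succ, add_sub_cancel_left,
      abs_of_nonneg hp]
  · have e2 : lead (trunc j r) = lead (trunc (j + 1) r) := by
      refine lead_eq (fun k hk => by rw [hlow k (by omega)]; exact h1 k hk) ?_
      rcases h.eq_or_lt with h' | h'
      · rw [h']; exact hf j
      · rw [hlow _ h', h2]
    rw [leadWeight, leadWeight, e2, sub_self, abs_zero]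
    exact hp

theorem continuous_leadWeight : Continuous fun r : FinSupp => leadWeight r.1 := by
  refine IsLocallyConstant.continuous ((IsLocallyConstant.iff_eventually_eq _).2 fun r => ?_)
  obtain ⟨r, d, hd⟩ := r
  have h := ((isLocallyConstant_trunc (lead r + 1)).eventually_eq r)
  have h' := continuous_subtype_val.continuousAt (x := (⟨r, d, hd⟩ : FinSupp)) |>.eventually h
  filter_upwards [h'] with s hs
  have hs' := trunc_eq_iff.1 hs
  have : lead s.1 = lead r := lead_eq (fun k hk => by
    rw [hs' k (by omega)]; exact apply_of_lt_lead hk) (by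
    rw [hs' _ (by omega)]; exact apply_lead (hd d le_rfl))
  simp only [leadWeight, this]

theorem full_leadWeight : Full 0 1 fun r : FinSupp => leadWeight r.1 := by
  refine ⟨fun r => harm_nonneg _, fun u hu => ?_⟩
  obtain ⟨n, hn1, hn2⟩ : ∃ n, u ≤ harm n ∧ harm n ≤ u + 1 := by
    have hex : ∃ n, u ≤ harm n :=
      (Real.tendsto_sum_range_one_div_nat_succ_atTop.eventually_ge_atTop u).exists
    classical
    refine ⟨Nat.find hex, Nat.find_spec hex, ?_⟩
    rcases h : Nat.find hex with _ | m
    · simp [harm]; linarith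
    · have := Nat.find_min hex (m := m) (by omega)
      push Not at this
      rw [harm, Finset.sum_range_succ]
      have h1 : (1 : ℝ) / ((m : ℝ) + 1) ≤ 1 := by
        rw [div_le_one (by positivity)]; linarith [(Nat.cast_nonneg m : (0 : ℝ) ≤ m)]
      rw [harm] at this
      linarith
  refine ⟨⟨fun j => decide (j < n), n, fun j hj => by simpa using hj⟩, ?_⟩
  have : lead (fun j => decide (j < n)) = n := lead_eq (fun k hk => by simpa using hk) (by simp)
  simp only [leadWeight, this]
  exact abs_le.2 ⟨by linarith, by linarith⟩

theorem Full.const_mul {A : Type*} {η : ℝ} {c : A → ℝ} (h : Full 0 η c) {α : ℝ} (hα : 0 < α) :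
    Full 0 (α * η) fun a => α * c a := by
  refine ⟨fun a => mul_nonneg hα.le (h.1 a), fun u hu => ?_⟩
  obtain ⟨a, ha⟩ := h.2 (u / α) (by positivity)
  refine ⟨a, ?_⟩
  have : α * c a - u = α * (c a - u / α) := by field_simp
  rw [this, abs_mul, abs_of_pos hα]
  gcongr

/-- The rescaled weights of the rows. -/
def geomWeight (i : ℕ) (r : FinSupp) : ℝ := (1 / 2) ^ i * leadWeight r.1

/-- The zero sequence. -/
def finZero : FinSupp := ⟨fun _ => false, 0, fun _ _ => rfl⟩

theorem fullRows_geomWeight : FullRows geomWeight finZero fun i => (1 / 2) ^ i where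
  ratLike := ratLike_finSupp
  continuous i := continuous_const.mul continuous_leadWeight
  zero i := by simp [geomWeight, leadWeight_zero, finZero]
  full i := by
    have := full_leadWeight.const_mul (α := (1 / 2) ^ i) (by positivity)
    rwa [mul_one] at this

theorem FullRows.const_mul {P : Type*} [TopologicalSpace P] {c : ℕ → P → ℝ} {z : P} {η : ℕ → ℝ}
    (hc : FullRows c z η) {α : ℝ} (hα : 0 < α) :
    FullRows (fun i p => α * c i p) z fun i => α * η i where
  ratLike := hc.ratLike
  continuous i := continuous_const.mul (hc.continuous i)
  zero i := by simp [hc.zero]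
  full i := (hc.full i).const_mul hα

theorem FullRows.prod {P : Type*} [TopologicalSpace P] {c : ℕ → P → ℝ} {z : P} {η : ℕ → ℝ}
    (hc : FullRows c z η) {α β : ℝ} (hα : 0 < α) (hβ : 0 < β) :
    FullRows (fun i (p : P × P) => α * c i p.1 + β * c i p.2) (z, z) fun i => (α + β) * η i := by
  have := hc.ratLike.countable
  have := hc.ratLike.metrizable
  refine ⟨hc.ratLike.prod, fun i => ?_, fun i => by simp [hc.zero], fun i => ?_⟩
  · exact (continuous_const.mul ((hc.continuous i).comp continuous_fst)).add
      (continuous_const.mul ((hc.continuous i).comp continuous_snd))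
  · refine ((hc.full i).const_mul (add_pos hα hβ)).of_section (fun p => ?_) (fun p => (p, p))
      fun p => by ring
    have h1 := mul_nonneg hα.le ((hc.full i).1 p.1)
    have h2 := mul_nonneg hβ.le ((hc.full i).1 p.2)
    linarith

/-- A weighted sum on the square is a weight of sequences of pairs. -/
theorem nearHomeo_rowSum_prod {P : Type*} [TopologicalSpace P] {c : ℕ → P → ℝ}
    (h0 : ∀ i p, 0 ≤ c i p) {α β : ℝ} (hα : 0 < α) (hβ : 0 < β) :
    NearHomeo 0 (fun p : RowSum c × RowSum c => α * rowWeight c p.1 + β * rowWeight c p.2)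
      (rowWeight fun i (p : P × P) => α * c i p.1 + β * c i p.2) := by
  obtain ⟨d, hd⟩ : ∃ d : ℕ → P × P → ℝ, ∀ i p, d i p = α * c i p.1 + β * c i p.2 :=
    ⟨_, fun _ _ => rfl⟩
  have hd' : (fun i (p : P × P) => α * c i p.1 + β * c i p.2) = d :=
    funext fun i => funext fun p => (hd i p).symm
  rw [hd']
  have hs : ∀ p : RowSum c × RowSum c, Summable fun i => d i (p.1.1 i, p.2.1 i) := fun p =>
    ((p.1.2.mul_left α).add (p.2.2.mul_left β)).congr fun i =>
      (hd i (p.1.1 i, p.2.1 i)).symm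
  have h1 : ∀ x : RowSum d, Summable fun i => c i (x.1 i).1 := fun x => by
    refine (summable_mul_left_iff hα.ne').1 (x.2.of_nonneg_of_le
      (fun i => mul_nonneg hα.le (h0 _ _)) fun i => ?_)
    have := mul_nonneg hβ.le (h0 i (x.1 i).2)
    have := hd i (x.1 i)
    linarith
  have h2 : ∀ x : RowSum d, Summable fun i => c i (x.1 i).2 := fun x => by
    refine (summable_mul_left_iff hβ.ne').1 (x.2.of_nonneg_of_le
      (fun i => mul_nonneg hβ.le (h0 _ _)) fun i => ?_)
    have := mul_nonneg hα.le (h0 i (x.1 i).1)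
    have := hd i (x.1 i)
    linarith
  have hcs : Continuous fun p : RowSum c × RowSum c =>
      (⟨fun i => (p.1.1 i, p.2.1 i), hs p⟩ : RowSum d) :=
    continuous_rowSum_mk (fun i => ((continuous_rowSum_apply c i).comp continuous_fst).prodMk
      ((continuous_rowSum_apply c i).comp continuous_snd)) hs
  have hc1 : Continuous fun x : RowSum d => (⟨fun i => (x.1 i).1, h1 x⟩ : RowSum c) :=
    continuous_rowSum_mk (fun i => continuous_fst.comp (continuous_rowSum_apply d i)) h1
  have hc2 : Continuous fun x : RowSum d => (⟨fun i => (x.1 i).2, h2 x⟩ : RowSum c) :=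
    continuous_rowSum_mk (fun i => continuous_snd.comp (continuous_rowSum_apply d i)) h2
  let e : RowSum c × RowSum c ≃ₜ RowSum d :=
    { toFun := fun p => ⟨fun i => (p.1.1 i, p.2.1 i), hs p⟩
      invFun := fun x => (⟨fun i => (x.1 i).1, h1 x⟩, ⟨fun i => (x.1 i).2, h2 x⟩)
      left_inv := fun p => rfl
      right_inv := fun x => rfl
      continuous_toFun := hcs
      continuous_invFun := hc1.prodMk hc2 }
  refine .of_homeo e fun p => ?_
  change ∑' i, d i (p.1.1 i, p.2.1 i) = α * ∑' i, c i (p.1.1 i) + β * ∑' i, c i (p.2.1 i)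
  rw [← tsum_mul_left, ← tsum_mul_left, ← (p.1.2.mul_left α).tsum_add (p.2.2.mul_left β)]
  exact tsum_congr fun i => hd i (p.1.1 i, p.2.1 i)

theorem nearHomeo_rowSum_const_mul {P : Type*} [TopologicalSpace P] (c : ℕ → P → ℝ) {α : ℝ}
    (hα : 0 < α) :
    NearHomeo 0 (fun x : RowSum c => α * rowWeight c x) (rowWeight fun i p => α * c i p) := by
  let d : ℕ → P → ℝ := fun i p => α * c i p
  have hs : ∀ x : RowSum c, Summable fun i => d i (x.1 i) := fun x => x.2.mul_left α
  have ht : ∀ x : RowSum d, Summable fun i => c i (x.1 i) := fun x =>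
    (summable_mul_left_iff hα.ne').1 x.2
  let e : RowSum c ≃ₜ RowSum d :=
    { toFun := fun x => ⟨x.1, hs x⟩
      invFun := fun x => ⟨x.1, ht x⟩
      left_inv := fun x => rfl
      right_inv := fun x => rfl
      continuous_toFun := continuous_rowSum_mk (c := d) (f := fun x : RowSum c => x.1)
        (continuous_rowSum_apply c) hs
      continuous_invFun := continuous_rowSum_mk (c := c) (f := fun x : RowSum d => x.1)
        (continuous_rowSum_apply d) ht }
  refine .of_homeo e fun x => ?_
  exact tsum_mul_left

/-- The rows of a binary sequence. -/
def row (i : ℕ) (x : ℕ → Bool) : ℕ → Bool := fun j => x (Nat.pair i j)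

theorem continuous_row (i : ℕ) : Continuous (row i) :=
  continuous_pi fun j => continuous_apply (Nat.pair i j)

/-- The sequences with eventually vanishing rows and summable weights of the rows. -/
def erdosSet : Set (ℕ → Bool) := {x | (∀ i, ∃ d, ∀ j, d ≤ j → row i x j = false) ∧
  Summable fun i => (1 / 2 : ℝ) ^ i * leadWeight (row i x)}

/-- The total weight of the rows. -/
def erdosSum (x : ℕ → Bool) : ℝ := ∑' i, (1 / 2 : ℝ) ^ i * leadWeight (row i x)

/-- The sequence with given rows. -/
def ofRows (y : RowSum geomWeight) : ℕ → Bool := fun n => (y.1 n.unpair.1).1 n.unpair.2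

theorem row_ofRows (y : RowSum geomWeight) (i : ℕ) : row i (ofRows y) = (y.1 i).1 := by
  funext j
  simp [row, ofRows]

theorem ofRows_mem (y : RowSum geomWeight) : ofRows y ∈ erdosSet := by
  refine ⟨fun i => ?_, ?_⟩
  · rw [row_ofRows]
    exact (y.1 i).2
  · simp only [row_ofRows]
    exact y.2

theorem continuous_ofRows : Continuous ofRows :=
  continuous_pi fun n : ℕ => (continuous_apply n.unpair.2).comp
    (continuous_subtype_val.comp (continuous_rowSum_apply geomWeight n.unpair.1))

/-- Points of the model are sequences of rows. -/
def rowsHomeo : erdosSet ≃ₜ RowSum geomWeight where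
  toFun x := ⟨fun i => ⟨row i x.1, x.2.1 i⟩, x.2.2⟩
  invFun y := ⟨ofRows y, ofRows_mem y⟩
  left_inv x := Subtype.ext (funext fun n => by simp [row, ofRows])
  right_inv y := Subtype.ext (funext fun i => Subtype.ext (row_ofRows y i))
  continuous_toFun := continuous_rowSum_mk (c := geomWeight)
    (f := fun (x : erdosSet) i => ⟨row i x.1, x.2.1 i⟩)
    (fun i => Continuous.subtype_mk ((continuous_row i).comp continuous_subtype_val) _)
    fun x => x.2.2
  continuous_invFun := continuous_ofRows.subtype_mk ofRows_mem

theorem rowWeight_rowsHomeo (x : erdosSet) : rowWeight geomWeight (rowsHomeo x) = erdosSum x := rfl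

theorem nearHomeo_rows :
    NearHomeo 0 (fun x : erdosSet => erdosSum x) (rowWeight geomWeight) :=
  .of_homeo rowsHomeo rowWeight_rowsHomeo

theorem geomWeight_nonneg (i : ℕ) (r : FinSupp) : 0 ≤ geomWeight i r :=
  mul_nonneg (by positivity) (harm_nonneg _)

theorem row_trunc_of_le {d i : ℕ} (h : d ≤ i) (x : ℕ → Bool) (j : ℕ) :
    row i (trunc d x) j = false := by
  simp [row, trunc, not_lt.2 (h.trans (Nat.left_le_pair i j))]

theorem row_trunc_of_le_right {d j : ℕ} (h : d ≤ j) (x : ℕ → Bool) (i : ℕ) :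
    row i (trunc d x) j = false := by
  simp [row, trunc, not_lt.2 (h.trans (Nat.right_le_pair i j))]

theorem summable_trunc (d : ℕ) (x : ℕ → Bool) :
    Summable fun i => (1 / 2 : ℝ) ^ i * leadWeight (row i (trunc d x)) :=
  summable_of_ne_finset_zero (s := Finset.range d) fun i hi => by
    rw [leadWeight_zero (row_trunc_of_le (by simpa using hi) x 0), mul_zero]

theorem trunc_mem_erdosSet (d : ℕ) (x : ℕ → Bool) : trunc d x ∈ erdosSet :=
  ⟨fun i => ⟨d, fun _ hj => row_trunc_of_le_right hj x i⟩, summable_trunc d x⟩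

theorem erdosSum_trunc_succ_sub (i j : ℕ) (x : ℕ → Bool) :
    erdosSum (trunc (Nat.pair i j + 1) x) - erdosSum (trunc (Nat.pair i j) x) =
      (1 / 2) ^ i * (leadWeight (trunc (j + 1) (row i x)) - leadWeight (trunc j (row i x))) := by
  rw [erdosSum, erdosSum, ← (summable_trunc _ x).tsum_sub (summable_trunc _ x),
    tsum_eq_single i fun i' hi' => ?_]
  · have h1 : row i (trunc (Nat.pair i j) x) = trunc j (row i x) := by
      funext k
      have : Nat.pair i k < Nat.pair i j ↔ k < j :=
        (StrictMono.lt_iff_lt fun _ _ h => Nat.pair_lt_pair_right i h)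
      simp [row, trunc, this]
    have h2 : row i (trunc (Nat.pair i j + 1) x) = trunc (j + 1) (row i x) := by
      funext k
      have : Nat.pair i k ≤ Nat.pair i j ↔ k ≤ j :=
        (StrictMono.le_iff_le fun _ _ h => Nat.pair_lt_pair_right i h)
      simp [row, trunc, this]
    rw [h1, h2, mul_sub]
  · have : row i' (trunc (Nat.pair i j + 1) x) = row i' (trunc (Nat.pair i j) x) := by
      funext k
      have : Nat.pair i' k ≠ Nat.pair i j := fun h => hi' (Nat.pair_eq_pair.1 h).1
      have : Nat.pair i' k < Nat.pair i j + 1 ↔ Nat.pair i' k < Nat.pair i j := by omega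
      simp only [row, trunc, this]
    rw [this, sub_self]

theorem abs_erdosSum_trunc_succ_sub_le (d : ℕ) (x : ℕ → Bool) :
    |erdosSum (trunc (d + 1) x) - erdosSum (trunc d x)| ≤ 1 / ((Nat.sqrt d : ℝ) + 1) := by
  obtain ⟨i, j, rfl⟩ : ∃ i j, d = Nat.pair i j := ⟨_, _, (Nat.pair_unpair d).symm⟩
  rw [erdosSum_trunc_succ_sub, abs_mul, abs_of_nonneg (by positivity)]
  have h1 := abs_leadWeight_trunc_le (row i x) j
  have h2 : ((1 : ℝ) / 2) ^ i ≤ 1 / ((i : ℝ) + 1) := by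
    rw [one_div_pow]
    refine one_div_le_one_div_of_le (by positivity) ?_
    exact_mod_cast Nat.lt_two_pow_self (n := i)
  have h3 : Nat.sqrt (Nat.pair i j) ≤ max i j :=
    Nat.lt_succ_iff.1 (Nat.sqrt_lt'.2 (Nat.pair_lt_max_add_one_sq i j))
  have one : ∀ n : ℕ, 1 / ((n : ℝ) + 1) ≤ 1 := fun n => by
    rw [div_le_one (by positivity)]; linarith [(Nat.cast_nonneg n : (0 : ℝ) ≤ n)]
  have h4 : 1 / (((max i j : ℕ) : ℝ) + 1) ≤ 1 / ((Nat.sqrt (Nat.pair i j) : ℝ) + 1) :=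
    one_div_le_one_div_of_le (by positivity) (by gcongr)
  refine le_trans ?_ h4
  refine (mul_le_mul h2 h1 (abs_nonneg _) (by positivity)).trans ?_
  rcases le_total i j with h | h
  · rw [max_eq_right h]
    exact mul_le_of_le_one_left (by positivity) (one i)
  · rw [max_eq_left h]
    exact mul_le_of_le_one_right (by positivity) (one j)

theorem nearHomeo_erdos_cell (d : ℕ) (x : ℕ → Bool) {ε : ℝ} (hε : 0 < ε) :
    NearHomeo ε (fun y : {y // y ∈ erdosSet ∧ trunc d y = trunc d x} => erdosSum y)
      (fun y : erdosSet => erdosSum y + erdosSum (trunc d x)) := by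
  have hlim := (tendsto_pow_atTop_nhds_zero_of_lt_one (r := (1 / 2 : ℝ)) (by norm_num)
    (by norm_num)).eventually_lt_const (show 0 < ε / 4 by linarith)
  obtain ⟨n, hn, hdn⟩ := (hlim.and (Filter.eventually_ge_atTop d)).exists
  let U : (Fin (n + 1) → FinSupp) → Prop := fun h =>
    ∀ (i : Fin (n + 1)) (j : ℕ), Nat.pair i j < d → (h i).1 j = x (Nat.pair i j)
  let t : erdosSet := ⟨trunc d x, trunc_mem_erdosSet d x⟩
  let h₀ : Fin (n + 1) → FinSupp := fun i => (rowsHomeo t).1 i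
  have hU : IsOpen {h | U h} := by
    have : {h | U h} = ⋂ i : Fin (n + 1), ⋂ j ∈ Finset.range d,
        {h | Nat.pair i j < d → (h i).1 j = x (Nat.pair i j)} := by
      ext h
      simp only [mem_ofPred_eq, mem_iInter, Finset.mem_range, U]
      exact ⟨fun H i j _ => H i j, fun H i j hij =>
        H i j ((Nat.right_le_pair _ _).trans_lt hij) hij⟩
    rw [this]
    refine isOpen_iInter_of_finite fun i => isOpen_biInter_finset fun j _ => ?_
    by_cases hij : Nat.pair i j < d
    · simp only [hij, forall_const]
      have hc : Continuous fun h : Fin (n + 1) → FinSupp => (h i).1 j :=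
        (continuous_apply j).comp (continuous_subtype_val.comp (continuous_apply i))
      exact (isOpen_discrete {x (Nat.pair i j)}).preimage hc
    · simp [hij]
  have hrow : ∀ i j, ((rowsHomeo t).1 i).1 j = row i (trunc d x) j := fun i j => rfl
  have hup : ∀ p, U (Function.update h₀ (Fin.last n) p) := fun p i j hij => by
    have hi : i ≠ Fin.last n := by
      rintro rfl
      have := Nat.left_le_pair n j
      simp only [Fin.val_last] at hij
      omega
    rw [Function.update_of_ne hi]
    simp [h₀, hrow, row, trunc, hij]
  have hmin : ∀ h, U h → headWeight geomWeight (n + 1) h₀ ≤ headWeight geomWeight (n + 1) h := by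
    intro h hh
    refine Finset.sum_le_sum fun i _ => mul_le_mul_of_nonneg_left ?_ (by positivity)
    obtain ⟨D, hD⟩ := (h i).2
    refine leadWeight_mono (hD D le_rfl) fun k hk => ?_
    change row i (trunc d x) k = true at hk
    by_cases hik : Nat.pair i k < d
    · rw [hh i k hik]
      simpa [row, trunc, hik] using hk
    · simp [row, trunc, hik] at hk
  have hw : headWeight geomWeight (n + 1) h₀ = erdosSum (trunc d x) := by
    have h1 : HasSum (fun i => geomWeight i ((rowsHomeo t).1 i))
        (∑ i ∈ Finset.range (n + 1), geomWeight i ((rowsHomeo t).1 i)) :=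
      hasSum_eventually_zero (n + 1) fun i hi => by
        rw [geomWeight, leadWeight_zero, mul_zero]
        exact row_trunc_of_le (by omega) x 0
    rw [← Fin.sum_univ_eq_sum_range (fun i => geomWeight i ((rowsHomeo t).1 i))] at h1
    exact h1.tsum_eq.symm
  have hlast : geomWeight n (h₀ (Fin.last n)) = 0 := by
    rw [geomWeight, leadWeight_zero, mul_zero]
    exact row_trunc_of_le (by simpa using hdn) x 0
  have key := fullRows_geomWeight.nearHomeo_subtype (fun i => by positivity) hU hlast hup hmin
  rw [hw] at key
  have e1 := (NearHomeo.subtype (p := (· ∈ erdosSet))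
      (q := fun y : erdosSet => trunc d y = trunc d x)
      (r := fun y => y ∈ erdosSet ∧ trunc d y = trunc d x) erdosSum fun y => by simp).symm
  have e2 := NearHomeo.of_homeo
    (φ := fun y : {y : erdosSet // trunc d y = trunc d x} => erdosSum y.1)
    (ψ := fun y : {y : RowSum geomWeight // U fun i => y.1 i} => rowWeight geomWeight y.1)
    (rowsHomeo.subtype fun y => by
      rw [trunc_eq_iff]
      refine ⟨fun H i j hij => H _ hij, fun H k hk => ?_⟩
      have hk1 : k.unpair.1 < n + 1 := by have := Nat.unpair_left_le k; omega
      have := H ⟨k.unpair.1, hk1⟩ k.unpair.2 (by simpa using hk)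
      change y.1 (Nat.pair k.unpair.1 k.unpair.2) = x (Nat.pair k.unpair.1 k.unpair.2) at this
      rwa [Nat.pair_unpair] at this) fun y => rfl
  have e3 := (nearHomeo_rows.add_const (erdosSum (trunc d x))).symm
  exact (e1.trans (e2.trans (key.trans e3))).mono (by linarith)

theorem goodModel_erdosSum :
    GoodModel erdosSet erdosSum fun n => 1 / ((Nat.sqrt n : ℝ) + 1) := by
  have hpos : ∀ i : ℕ, (0 : ℝ) < (1 / 2) ^ i := fun i => by positivity
  have hsum : Summable fun i : ℕ => (1 / 2 : ℝ) ^ i := summable_geometric_two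
  refine ⟨⟨_, trunc_mem_erdosSet 0 fun _ => false⟩, ?_, fun α β ε hα hβ hε => ?_, ?_,
    fun d x ε hε => nearHomeo_erdos_cell d x hε, abs_erdosSum_trunc_succ_sub_le,
    fun d => by positivity, ?_, ?_⟩
  · have h := (lowerSemicontinuous_rowWeight geomWeight_nonneg
      fun i => (fullRows_geomWeight.continuous i).lowerSemicontinuous).comp rowsHomeo.continuous
    exact (funext rowWeight_rowsHomeo : rowWeight geomWeight ∘ rowsHomeo = _) ▸ h
  · have h1 := (nearHomeo_rows.mul_const hα.le).prod (nearHomeo_rows.mul_const hβ.le)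
    have h2 := nearHomeo_rowSum_prod geomWeight_nonneg hα hβ
    have h3 := (fullRows_geomWeight.prod hα hβ).nearHomeo
      (fullRows_geomWeight.const_mul (add_pos hα hβ))
      (fun i => mul_pos (add_pos hα hβ) (hpos i)) (hsum.mul_left _) hε
    have h4 := (nearHomeo_rowSum_const_mul geomWeight (add_pos hα hβ)).symm
    have h5 := (nearHomeo_rows.mul_const (add_pos hα hβ).le).symm
    exact (h1.trans (h2.trans (h3.trans (h4.trans h5)))).mono (by simp)
  · intro K _ _ _ _ _ ε hε
    have h1 := nearHomeo_rows.prod_right K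
    have h2 := fullRows_geomWeight.nearHomeo_prod hpos hsum K hε
    exact (h1.trans (h2.trans nearHomeo_rows.symm)).mono (by simp)
  · intro m n h
    have := Nat.sqrt_le_sqrt h
    simp only
    gcongr
  · have h1 : Filter.Tendsto Nat.sqrt .atTop .atTop :=
      Filter.tendsto_atTop.2 fun n => Filter.eventually_atTop.2
        ⟨n * n, fun m hm => Nat.le_sqrt.2 hm⟩
    exact (tendsto_one_div_add_atTop_nhds_zero_nat (𝕜 := ℝ)).comp h1

/-! ### Erdős space -/

theorem fullRows_sq : FullRows (fun (_ : ℕ) (q : ℚ) => (q : ℝ) ^ 2) 0 fun i => (1 / 2) ^ i where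
  ratLike := ⟨inferInstance, inferInstance, fun x => inferInstance⟩
  continuous i := Rat.continuous_coe_real.pow 2
  zero i := by simp
  full i := by
    refine ⟨fun q => sq_nonneg _, fun u hu => ?_⟩
    have hpos : (0 : ℝ) < (1 / 2) ^ i := by positivity
    have ho : IsOpen {t : ℝ | |t ^ 2 - u| < (1 / 2) ^ i} :=
      isOpen_lt (by fun_prop) continuous_const
    obtain ⟨q, hq⟩ := Rat.denseRange_cast.exists_mem_open ho ⟨√u, by simp [Real.sq_sqrt hu]⟩
    exact ⟨q, le_of_lt hq⟩

theorem erdosSpace_homeomorph : Nonempty (ErdosSpace ≃ₜ Graph fun x : erdosSet => erdosSum x) := by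
  obtain ⟨h⟩ := nonempty_homeomorph_graph_rowWeight (P := ℚ)
    (q := fun t => ∃ q : ℚ, t = (q : ℝ)) Rat.isEmbedding_coe_real
    fun t => ⟨fun ⟨q, hq⟩ => ⟨q, hq.symm⟩, fun ⟨q, hq⟩ => ⟨q, hq.symm⟩⟩
  obtain ⟨g⟩ := ((fullRows_sq.nearHomeo fullRows_geomWeight (fun i => by positivity)
    summable_geometric_two one_pos).trans nearHomeo_rows.symm).graph
  exact ⟨h.trans g⟩

end ErdosModel

/-- For every `k ≥ 1`, `𝔈^k` is homeomorphic to `F_k(𝔈)` and `𝔈_c^k` is homeomorphic to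
`F_k(𝔈_c)`. -/
theorem power_homeomorph_symmetricProduct (k : ℕ) (hk : 1 ≤ k) :
    Nonempty ((Fin k → ErdosSpace) ≃ₜ HypFn k ErdosSpace) ∧
    Nonempty ((Fin k → CompleteErdosSpace) ≃ₜ HypFn k CompleteErdosSpace) :=
  ⟨ErdosModel.goodModel_erdosSum.nonempty_pi_homeomorph_hypFn hk ErdosModel.erdosSpace_homeomorph,
    ErdosModel.goodModel_bitSum.nonempty_pi_homeomorph_hypFn hk
      ErdosModel.completeErdosSpace_homeomorph⟩
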